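/- arXiv:2012.08445 — 3 statements merged into one kernel-verified Lean document; each statement's English description precedes it below -/
import Mathlib

section
/- Let d, r ≥ 1 and t : Fin r × (Fin d)³ → ℂ be such that the vectors |ĩ⟩ = d^{-1/2} ∑_{s1,s2,s3} t(i,s1,s2,s3)|s1⟩⊗|s2⟩⊗|s3⟩ are orthonormal. Then every density matrix ρ̃ supported in span{|ĩ⟩} satisfies −2 S(ρ̃) ≤ I₃(P1:P2:P3)(ρ̃) ≤ −2 S(ρ̃) + 2 log‖t⁽¹⁾‖_∞ + 2 log‖t⁽²⁾‖_∞ + 2 log‖t⁽³⁾‖_∞, where t⁽¹⁾((s2,s3),(i,s1)) = t⁽²⁾((s1,s3),(i,s2)) = t⁽³⁾((s1,s2),(i,s3)) = t(i,s1,s2,s3). -/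
open Matrix MeasureTheory ProbabilityTheory
open scoped ComplexOrder BigOperators

noncomputable section

/-- von Neumann entropy (natural logarithm), via the eigenvalues of a Hermitian matrix;
`Real.log 0 = 0` implements the convention `0 · log 0 = 0`. -/
def vN {n : Type*} [Fintype n] [DecidableEq n] (ρ : Matrix n n ℂ) : ℝ :=
  if h : ρ.IsHermitian then -∑ k, h.eigenvalues k * Real.log (h.eigenvalues k) else 0

/-- `ρ` is a density matrix: positive semidefinite with unit trace. -/
def IsDensity {n : Type*} [Fintype n] [DecidableEq n] (ρ : Matrix n n ℂ) : Prop :=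
  ρ.PosSemidef ∧ ρ.trace = 1

section reds
variable {α β γ : Type*} [Fintype α] [Fintype β] [Fintype γ]

/-- reduced density on party 1 (partial trace over parties 2, 3) -/
def red1 (ρ : Matrix (α × β × γ) (α × β × γ) ℂ) : Matrix α α ℂ :=
  Matrix.of fun a a' => ∑ b, ∑ c, ρ (a, b, c) (a', b, c)
/-- reduced density on party 2 -/
def red2 (ρ : Matrix (α × β × γ) (α × β × γ) ℂ) : Matrix β β ℂ :=
  Matrix.of fun b b' => ∑ a, ∑ c, ρ (a, b, c) (a, b', c)
/-- reduced density on party 3 -/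
def red3 (ρ : Matrix (α × β × γ) (α × β × γ) ℂ) : Matrix γ γ ℂ :=
  Matrix.of fun c c' => ∑ a, ∑ b, ρ (a, b, c) (a, b, c')
/-- reduced density on parties 1, 2 (partial trace over party 3) -/
def red12 (ρ : Matrix (α × β × γ) (α × β × γ) ℂ) : Matrix (α × β) (α × β) ℂ :=
  Matrix.of fun x y => ∑ c, ρ (x.1, x.2, c) (y.1, y.2, c)
/-- reduced density on parties 1, 3 -/
def red13 (ρ : Matrix (α × β × γ) (α × β × γ) ℂ) : Matrix (α × γ) (α × γ) ℂ :=
  Matrix.of fun x y => ∑ b, ρ (x.1, b, x.2) (y.1, b, y.2)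
/-- reduced density on parties 2, 3 -/
def red23 (ρ : Matrix (α × β × γ) (α × β × γ) ℂ) : Matrix (β × γ) (β × γ) ℂ :=
  Matrix.of fun x y => ∑ a, ρ (a, x.1, x.2) (a, y.1, y.2)

/-- tripartite information I₃(P1:P2:P3) -/
def I3 [DecidableEq α] [DecidableEq β] [DecidableEq γ]
    (ρ : Matrix (α × β × γ) (α × β × γ) ℂ) : ℝ :=
  vN (red1 ρ) + vN (red2 ρ) + vN (red3 ρ)
    - vN (red12 ρ) - vN (red13 ρ) - vN (red23 ρ) + vN ρ
end reds

/-- rank-one operator |v⟩⟨w| -/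
def outer {X : Type*} (v w : X → ℂ) : Matrix X X ℂ :=
  Matrix.of fun x y => v x * star (w y)

/-- orthonormal family of vectors -/
def ONFam {ι X : Type*} [DecidableEq ι] [Fintype X] (v : ι → X → ℂ) : Prop :=
  ∀ i j, (∑ x, star (v i x) * v j x) = if i = j then (1 : ℂ) else 0

/-- the support (range) of `ρ` is contained in the span of the family `v` -/
def SuppIn {ι X : Type*} [Fintype X] (ρ : Matrix X X ℂ) (v : ι → X → ℂ) : Prop :=
  LinearMap.range ρ.mulVecLin ≤ Submodule.span ℂ (Set.range v)

/-- a (rectangular) matrix is unitary -/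
def IsUnitaryM {A B : Type*} [Fintype A] [Fintype B] [DecidableEq A] [DecidableEq B]
    (U : Matrix A B ℂ) : Prop :=
  U * Uᴴ = 1 ∧ Uᴴ * U = 1

/-- operator norm (largest singular value) of a matrix -/
def opNorm {A B : Type*} [Fintype A] [Fintype B] [DecidableEq B]
    (M : Matrix A B ℂ) : ℝ :=
  ‖LinearMap.toContinuousLinearMap (Matrix.toEuclideanLin M)‖

/-- trace norm: the sum of the singular values -/
def traceNorm {A B : Type*} [Fintype A] [Fintype B] [DecidableEq B]
    (M : Matrix A B ℂ) : ℝ :=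
  ∑ k, Real.sqrt ((Matrix.posSemidef_conjTranspose_mul_self M).1.eigenvalues k)

/-- matrix logarithm taken on the support (eigenvalue `0 ↦ 0`, since `Real.log 0 = 0`) -/
def mlog {n : Type*} [Fintype n] [DecidableEq n] (ρ : Matrix n n ℂ) : Matrix n n ℂ :=
  if h : ρ.IsHermitian then
    (h.eigenvectorUnitary : Matrix n n ℂ) *
      Matrix.diagonal (fun k => (Real.log (h.eigenvalues k) : ℂ)) *
      (h.eigenvectorUnitary : Matrix n n ℂ)ᴴ
  else 0

/-- quantum relative entropy D(ρ‖σ) = Tr(ρ (log ρ − log σ)) -/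
def relEnt {n : Type*} [Fintype n] [DecidableEq n] (ρ σ : Matrix n n ℂ) : ℝ :=
  ((ρ * (mlog ρ - mlog σ)).trace).re

theorem le_sum_sum_of_nonneg {α β : Type*} [Fintype α] [Fintype β] {f : α → β → ℝ}
    (hf : ∀ a b, 0 ≤ f a b) (a : α) (b : β) : f a b ≤ ∑ a, ∑ b, f a b :=
  (Finset.single_le_sum (fun b _ => hf a b) (Finset.mem_univ b)).trans
    (Finset.single_le_sum (f := fun a => ∑ b, f a b)
      (fun a _ => Finset.sum_nonneg fun b _ => hf a b) (Finset.mem_univ a))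

theorem log_add_sub_le {w l q p : ℝ} (hw : 0 ≤ w) (hl : w ≠ 0 → 0 < l) (hq : w ≠ 0 → 0 < q)
    (hp : w ≠ 0 → 0 < p) :
    w * Real.log l + w * Real.log q - w * Real.log p ≤ l * q * (w / p) - w := by
  rcases eq_or_ne w 0 with rfl | h
  · simp
  have hl := hl h
  have hq := hq h
  have hp := hp h
  have h1 := Real.log_le_sub_one_of_pos (show 0 < l * q / p by positivity)
  rw [Real.log_div (by positivity) hp.ne', Real.log_mul hl.ne' hq.ne'] at h1
  have h2 := mul_le_mul_of_nonneg_left h1 hw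
  have h3 : w * (l * q / p - 1) = l * q * (w / p) - w := by ring
  linarith

theorem entropy_le_add_of_weights {A X K : Type*} [Fintype A] [Fintype X] [Fintype K]
    (w : A → X → K → ℝ) (q : A → ℝ) (p : X → ℝ) (l : K → ℝ) (hw : ∀ a x k, 0 ≤ w a x k)
    (hl : ∀ k, ∑ a, ∑ x, w a x k = l k) (hp : ∀ x, ∑ a, ∑ k, w a x k = p x)
    (hq : ∀ a, ∑ x, ∑ k, w a x k = q a) (hsum : ∑ k, l k = 1)
    (hbes : ∀ a k, ∑ x, w a x k / p x ≤ 1) :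
    -∑ x, p x * Real.log (p x) ≤
      -∑ a, q a * Real.log (q a) + -∑ k, l k * Real.log (l k) := by
  have nl : ∀ k, 0 ≤ l k := fun k => hl k ▸ Finset.sum_nonneg fun a _ =>
    Finset.sum_nonneg fun x _ => hw a x k
  have nq : ∀ a, 0 ≤ q a := fun a => hq a ▸ Finset.sum_nonneg fun x _ =>
    Finset.sum_nonneg fun k _ => hw a x k
  have ll : ∀ a x k, w a x k ≤ l k := fun a x k => by
    rw [← hl k]
    exact le_sum_sum_of_nonneg (fun a x => hw a x k) a x
  have lp : ∀ a x k, w a x k ≤ p x := fun a x k => by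
    rw [← hp x]
    exact le_sum_sum_of_nonneg (fun a k => hw a x k) a k
  have lq : ∀ a x k, w a x k ≤ q a := fun a x k => by
    rw [← hq a]
    exact le_sum_sum_of_nonneg (fun x k => hw a x k) x k
  have total : ∑ a, ∑ x, ∑ k, w a x k = 1 := by
    rw [← hsum]
    simp_rw [← hl]
    rw [Finset.sum_comm (s := (Finset.univ : Finset K))]
    exact Finset.sum_congr rfl fun a _ => Finset.sum_comm
  have totq : ∑ a, q a = 1 := by rw [← total]; exact Finset.sum_congr rfl fun a _ => (hq a).symm
  have pos : ∀ a x k, w a x k ≠ 0 → 0 < w a x k := fun a x k h => (hw a x k).lt_of_ne' h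
  have key : ∑ a, ∑ x, ∑ k, (w a x k * Real.log (l k) + w a x k * Real.log (q a)
      - w a x k * Real.log (p x)) ≤ ∑ a, ∑ x, ∑ k, (l k * q a * (w a x k / p x) - w a x k) :=
    Finset.sum_le_sum fun a _ => Finset.sum_le_sum fun x _ => Finset.sum_le_sum fun k _ =>
      log_add_sub_le (hw a x k) (fun h => (pos a x k h).trans_le (ll a x k))
        (fun h => (pos a x k h).trans_le (lq a x k)) (fun h => (pos a x k h).trans_le (lp a x k))
  have e1 : ∑ a, ∑ x, ∑ k, w a x k * Real.log (l k) = ∑ k, l k * Real.log (l k) := by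
    simp_rw [← hl, Finset.sum_mul]
    rw [Finset.sum_comm (s := (Finset.univ : Finset K))]
    refine Finset.sum_congr rfl fun a _ => ?_
    rw [Finset.sum_comm]
  have e2 : ∑ a, ∑ x, ∑ k, w a x k * Real.log (q a) = ∑ a, q a * Real.log (q a) := by
    simp_rw [← hq, Finset.sum_mul]
  have e3 : ∑ a, ∑ x, ∑ k, w a x k * Real.log (p x) = ∑ x, p x * Real.log (p x) := by
    rw [Finset.sum_comm]
    simp_rw [← hp, Finset.sum_mul]
  have e4 : ∑ a, ∑ x, ∑ k, l k * q a * (w a x k / p x) ≤ 1 := by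
    calc _ = ∑ a, ∑ k, l k * q a * ∑ x, w a x k / p x := by
          refine Finset.sum_congr rfl fun a _ => ?_
          rw [Finset.sum_comm]
          simp_rw [Finset.mul_sum]
      _ ≤ ∑ a, ∑ k, l k * q a := Finset.sum_le_sum fun a _ => Finset.sum_le_sum fun k _ =>
          mul_le_of_le_one_right (mul_nonneg (nl k) (nq a)) (hbes a k)
      _ = 1 := by simp_rw [← Finset.sum_mul, hsum, one_mul, totq]
  simp only [Finset.sum_add_distrib, Finset.sum_sub_distrib] at key
  linarith

theorem entropy_add_log_le_of_weights {A X K : Type*} [Fintype A] [Fintype X] [Fintype K]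
    (w : A → X → K → ℝ) (p : X → ℝ) (l : K → ℝ) (N : ℝ) (hN : 0 < N)
    (hw : ∀ a x k, 0 ≤ w a x k)
    (hl : ∀ k, ∑ a, ∑ x, w a x k = l k) (hp : ∀ x, ∑ a, ∑ k, w a x k = p x)
    (hsum : ∑ k, l k = 1) (hbd : ∀ x, ∑ a, ∑ k, w a x k / l k ≤ N) :
    -∑ k, l k * Real.log (l k) ≤ -∑ x, p x * Real.log (p x) + Real.log N := by
  have np : ∀ x, 0 ≤ p x := fun x => hp x ▸ Finset.sum_nonneg fun a _ =>
    Finset.sum_nonneg fun k _ => hw a x k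
  have ll : ∀ a x k, w a x k ≤ l k := fun a x k => by
    rw [← hl k]
    exact le_sum_sum_of_nonneg (fun a x => hw a x k) a x
  have lp : ∀ a x k, w a x k ≤ p x := fun a x k => by
    rw [← hp x]
    exact le_sum_sum_of_nonneg (fun a k => hw a x k) a k
  have e1 : ∑ x, ∑ a, ∑ k, w a x k * Real.log (l k) = ∑ k, l k * Real.log (l k) := by
    rw [Finset.sum_comm]
    simp_rw [← hl, Finset.sum_mul]
    rw [Finset.sum_comm (s := (Finset.univ : Finset K))]
    refine Finset.sum_congr rfl fun a _ => ?_
    rw [Finset.sum_comm]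
  have e3 : ∑ x, ∑ a, ∑ k, w a x k * Real.log (p x) = ∑ x, p x * Real.log (p x) := by
    simp_rw [← hp, Finset.sum_mul]
  have total : ∑ x, ∑ a, ∑ k, w a x k = 1 := by
    rw [← hsum, Finset.sum_comm]
    simp_rw [← hl]
    rw [Finset.sum_comm (s := (Finset.univ : Finset K))]
    exact Finset.sum_congr rfl fun a _ => Finset.sum_comm
  have pos : ∀ a x k, w a x k ≠ 0 → 0 < w a x k := fun a x k h => (hw a x k).lt_of_ne' h
  have key : ∑ x, ∑ a, ∑ k, (w a x k * Real.log (p x) + w a x k * Real.log N⁻¹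
      - w a x k * Real.log (l k)) ≤ ∑ x, ∑ a, ∑ k, (p x * N⁻¹ * (w a x k / l k) - w a x k) :=
    Finset.sum_le_sum fun x _ => Finset.sum_le_sum fun a _ => Finset.sum_le_sum fun k _ =>
      log_add_sub_le (hw a x k) (fun h => (pos a x k h).trans_le (lp a x k))
        (fun _ => inv_pos.2 hN) (fun h => (pos a x k h).trans_le (ll a x k))
  have e2 : ∑ x, ∑ a, ∑ k, w a x k * Real.log N⁻¹ = - Real.log N := by
    simp_rw [← Finset.sum_mul, total, Real.log_inv, one_mul]
  have e4 : ∑ x, ∑ a, ∑ k, p x * N⁻¹ * (w a x k / l k) ≤ 1 := by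
    calc _ = ∑ x, p x * N⁻¹ * ∑ a, ∑ k, w a x k / l k := by simp_rw [Finset.mul_sum]
      _ ≤ ∑ x, p x * N⁻¹ * N := Finset.sum_le_sum fun x _ =>
          mul_le_mul_of_nonneg_left (hbd x) (mul_nonneg (np x) (inv_pos.2 hN).le)
      _ = ∑ x, p x := Finset.sum_congr rfl fun x _ => by field_simp
      _ = 1 := by rw [← total]; exact Finset.sum_congr rfl fun x _ => (hp x).symm
  simp only [Finset.sum_add_distrib, Finset.sum_sub_distrib] at key
  linarith

theorem entropy_le_log_card {A : Type*} [Fintype A] (q : A → ℝ) (hq : ∀ a, 0 ≤ q a)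
    (hsum : ∑ a, q a = 1) :
    -∑ a, q a * Real.log (q a) ≤ Real.log (Fintype.card A) := by
  simpa using entropy_add_log_le_of_weights (A := Unit) (X := Unit) (fun _ _ a => q a)
    (fun _ => 1) q (Fintype.card A)
    (by
      have : Nonempty A := by
        by_contra h
        rw [not_nonempty_iff] at h
        simp at hsum
      exact_mod_cast Fintype.card_pos)
    (fun _ _ => hq) (by simp) (by simpa using hsum) hsum
    (by
      intro x
      simp only [Finset.univ_unique, Finset.sum_singleton]
      calc _ ≤ ∑ _a : A, (1 : ℝ) := Finset.sum_le_sum fun a _ => div_self_le_one _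
        _ = _ := by simp)

/-- The marginal on the second factor of `Z ≃ A × X` of a matrix indexed by `Z`. -/
def partialTrace {A X Z : Type*} [Fintype A] (e : A × X ≃ Z) (ρ : Matrix Z Z ℂ) :
    Matrix X X ℂ :=
  Matrix.of fun x y => ∑ a, ρ (e (a, x)) (e (a, y))

theorem partialTrace_posSemidef {A X Z : Type*} [Fintype A] (e : A × X ≃ Z)
    {ρ : Matrix Z Z ℂ} (hρ : ρ.PosSemidef) : (partialTrace e ρ).PosSemidef := by
  have : partialTrace e ρ = ∑ a, ρ.submatrix (fun x => e (a, x)) (fun x => e (a, x)) := by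
    ext x y
    simp [partialTrace, Matrix.sum_apply]
  rw [this]
  exact Matrix.posSemidef_sum _ fun a _ => hρ.submatrix _

theorem trace_partialTrace {A X Z : Type*} [Fintype A] [Fintype X] [Fintype Z] (e : A × X ≃ Z)
    (ρ : Matrix Z Z ℂ) : (partialTrace e ρ).trace = ρ.trace := by
  simp only [Matrix.trace, Matrix.diag, partialTrace, Matrix.of_apply]
  rw [Finset.sum_comm, ← e.sum_comp, Fintype.sum_prod_type]

theorem vN_eq {n : Type*} [Fintype n] [DecidableEq n] {ρ : Matrix n n ℂ} (h : ρ.IsHermitian) :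
    vN ρ = -∑ k, h.eigenvalues k * Real.log (h.eigenvalues k) :=
  dif_pos h

theorem sum_eigenvalues_eq_one {n : Type*} [Fintype n] [DecidableEq n] {ρ : Matrix n n ℂ}
    (h : ρ.IsHermitian) (htr : ρ.trace = 1) : ∑ k, h.eigenvalues k = 1 := by
  simpa [htr] using (congrArg Complex.re h.trace_eq_sum_eigenvalues).symm

theorem vN_le_log_card {n : Type*} [Fintype n] [DecidableEq n] {ρ : Matrix n n ℂ}
    (h : ρ.PosSemidef) (htr : ρ.trace = 1) : vN ρ ≤ Real.log (Fintype.card n) := by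
  rw [vN_eq h.1]
  exact entropy_le_log_card _ h.eigenvalues_nonneg (sum_eigenvalues_eq_one h.1 htr)

theorem eq_mul_diagonal_mul {n : Type*} [Fintype n] [DecidableEq n] {ρ : Matrix n n ℂ}
    (h : ρ.IsHermitian) :
    ρ = (h.eigenvectorUnitary : Matrix n n ℂ) * Matrix.diagonal (fun k => (h.eigenvalues k : ℂ)) *
      (h.eigenvectorUnitary : Matrix n n ℂ)ᴴ := by
  conv_lhs => rw [h.spectral_theorem, Unitary.conjStarAlgAut_apply]
  rfl

theorem conj_mul_eq_diagonal {n : Type*} [Fintype n] [DecidableEq n] {ρ : Matrix n n ℂ}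
    (h : ρ.IsHermitian) :
    (h.eigenvectorUnitary : Matrix n n ℂ)ᴴ * ρ * (h.eigenvectorUnitary : Matrix n n ℂ) =
      Matrix.diagonal (fun k => (h.eigenvalues k : ℂ)) := by
  have := h.conjStarAlgAut_star_eigenvectorUnitary
  rw [Unitary.conjStarAlgAut_star_apply] at this
  exact this

/-- The matrix of an eigenbasis `U` of the whole system in a product basis `H ⊗ F`. -/
def amplitude {A X Z : Type*} [Fintype A] [Fintype X] (e : A × X ≃ Z)
    (H : Matrix A A ℂ) (F : Matrix X X ℂ) (U : Matrix Z Z ℂ) : Matrix (A × X) Z ℂ :=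
  (Matrix.kroneckerMap (· * ·) H F)ᴴ * U.submatrix e id

theorem amplitude_conjTranspose_mul_self {A X Z : Type*} [Fintype A] [Fintype X] [Fintype Z]
    [DecidableEq A] [DecidableEq X] [DecidableEq Z] (e : A × X ≃ Z)
    {H : Matrix A A ℂ} {F : Matrix X X ℂ} {U : Matrix Z Z ℂ}
    (hH : H * Hᴴ = 1) (hF : F * Fᴴ = 1) (hU : Uᴴ * U = 1) :
    (amplitude e H F U)ᴴ * amplitude e H F U = 1 := by
  have hK : Matrix.kroneckerMap (· * ·) H F * (Matrix.kroneckerMap (· * ·) H F)ᴴ = 1 := by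
    rw [Matrix.conjTranspose_kronecker, ← Matrix.mul_kronecker_mul, hH, hF,
      Matrix.one_kronecker_one]
  rw [amplitude, Matrix.conjTranspose_mul, Matrix.conjTranspose_conjTranspose, Matrix.mul_assoc,
    ← Matrix.mul_assoc (Matrix.kroneckerMap (· * ·) H F), hK, Matrix.one_mul,
    Matrix.conjTranspose_submatrix, Matrix.submatrix_mul_equiv, hU, Matrix.submatrix_id_id]

theorem partialTrace_kronecker_conj {A X : Type*} [Fintype A] [Fintype X]
    [DecidableEq A] {H : Matrix A A ℂ} (F : Matrix X X ℂ) (hH : H * Hᴴ = 1)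
    (R : Matrix (A × X) (A × X) ℂ) :
    partialTrace (Equiv.refl _)
      ((Matrix.kroneckerMap (· * ·) H F)ᴴ * R * Matrix.kroneckerMap (· * ·) H F) =
      Fᴴ * partialTrace (Equiv.refl _) R * F := by
  have hH' : ∀ b c, ∑ a, H b a * star (H c a) = if b = c then 1 else 0 := fun b c => by
    have := congrFun (congrFun hH b) c
    simpa [Matrix.mul_apply, Matrix.one_apply] using this
  ext x y
  simp only [partialTrace, Matrix.of_apply, Matrix.mul_apply, Equiv.refl_apply,
    Matrix.conjTranspose_apply, Matrix.kroneckerMap_apply, Fintype.sum_prod_type, star_mul']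
  calc _ = ∑ b, ∑ z, ∑ c, ∑ z', (∑ a, H b a * star (H c a)) *
        (star (F z' x) * R (c, z') (b, z) * F z y) := by
        rw [Finset.sum_comm]
        refine Finset.sum_congr rfl fun b _ => ?_
        rw [Finset.sum_comm]
        refine Finset.sum_congr rfl fun z _ => ?_
        simp_rw [Finset.sum_mul]
        rw [Finset.sum_comm]
        refine Finset.sum_congr rfl fun c _ => ?_
        rw [Finset.sum_comm]
        refine Finset.sum_congr rfl fun z' _ => Finset.sum_congr rfl fun a _ => by ring
    _ = ∑ b, ∑ z, ∑ z', star (F z' x) * R (b, z') (b, z) * F z y := by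
        simp only [hH', ite_mul, one_mul, zero_mul]
        refine Finset.sum_congr rfl fun b _ => Finset.sum_congr rfl fun z _ => ?_
        rw [Finset.sum_comm]
        simp
    _ = _ := by
        rw [Finset.sum_comm]
        refine Finset.sum_congr rfl fun z _ => ?_
        rw [Finset.sum_comm, Finset.sum_mul]
        simp_rw [Finset.mul_sum, Finset.sum_mul]

theorem amplitude_mul_diagonal_mul {A X Z : Type*} [Fintype A] [Fintype X] [Fintype Z]
    [DecidableEq Z] (e : A × X ≃ Z)
    (H : Matrix A A ℂ) (F : Matrix X X ℂ) {ρ : Matrix Z Z ℂ} (h : ρ.IsHermitian) :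
    amplitude e H F h.eigenvectorUnitary * Matrix.diagonal (fun k => (h.eigenvalues k : ℂ)) *
      (amplitude e H F h.eigenvectorUnitary)ᴴ =
    (Matrix.kroneckerMap (· * ·) H F)ᴴ * ρ.submatrix e e * Matrix.kroneckerMap (· * ·) H F := by
  conv_rhs => rw [eq_mul_diagonal_mul h, Matrix.submatrix_mul _ _ e id e Function.bijective_id,
    Matrix.submatrix_mul _ _ e id id Function.bijective_id, Matrix.submatrix_id_id]
  rw [amplitude, Matrix.conjTranspose_mul, Matrix.conjTranspose_conjTranspose,
    Matrix.conjTranspose_submatrix]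
  simp only [Matrix.mul_assoc]

theorem sum_amplitude_eq {A X Z : Type*} [Fintype A] [Fintype X] [Fintype Z]
    [DecidableEq A] [DecidableEq X] [DecidableEq Z] (e : A × X ≃ Z)
    {H : Matrix A A ℂ} (hH : H * Hᴴ = 1) {ρ : Matrix Z Z ℂ} (h : ρ.IsHermitian)
    (hX : (partialTrace e ρ).IsHermitian) (x y : X) :
    ∑ a, ∑ k, amplitude e H hX.eigenvectorUnitary h.eigenvectorUnitary (a, x) k *
        (h.eigenvalues k : ℂ) *
        star (amplitude e H hX.eigenvectorUnitary h.eigenvectorUnitary (a, y) k) =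
      if x = y then (hX.eigenvalues x : ℂ) else 0 := by
  have h1 := congrArg (partialTrace (Equiv.refl _))
    (amplitude_mul_diagonal_mul e H (hX.eigenvectorUnitary : Matrix X X ℂ) h)
  rw [partialTrace_kronecker_conj _ hH] at h1
  have h2 : partialTrace (Equiv.refl _) (ρ.submatrix e e) = partialTrace e ρ := rfl
  rw [h2, conj_mul_eq_diagonal hX] at h1
  have := congrFun (congrFun h1 x) y
  rw [Matrix.diagonal_apply] at this
  rw [← this]
  simp [partialTrace, Matrix.mul_apply, Matrix.diagonal_apply]

/-- The joint weight of a product eigenbasis of the marginals and an eigenbasis of the state. -/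
def weight {A X Z : Type*} [Fintype A] [Fintype X] [Fintype Z] [DecidableEq Z] (e : A × X ≃ Z)
    (H : Matrix A A ℂ) (F : Matrix X X ℂ) {ρ : Matrix Z Z ℂ} (h : ρ.IsHermitian)
    (a : A) (x : X) (k : Z) : ℝ :=
  h.eigenvalues k * ‖amplitude e H F h.eigenvectorUnitary (a, x) k‖ ^ 2

theorem weight_nonneg {A X Z : Type*} [Fintype A] [Fintype X] [Fintype Z]
    [DecidableEq Z] (e : A × X ≃ Z) {H : Matrix A A ℂ} {F : Matrix X X ℂ} {ρ : Matrix Z Z ℂ}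
    (h : ρ.PosSemidef) (a : A) (x : X) (k : Z) : 0 ≤ weight e H F h.1 a x k :=
  mul_nonneg (h.eigenvalues_nonneg k) (sq_nonneg _)

theorem amplitude_swap {A X Z : Type*} [Fintype A] [Fintype X] (e : A × X ≃ Z)
    {H : Matrix A A ℂ} {F : Matrix X X ℂ} (U : Matrix Z Z ℂ) (a : A) (x : X) (k : Z) :
    amplitude ((Equiv.prodComm X A).trans e) F H U (x, a) k = amplitude e H F U (a, x) k := by
  simp only [amplitude, Matrix.mul_apply, Fintype.sum_prod_type, Matrix.conjTranspose_apply,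
    Matrix.kroneckerMap_apply, Matrix.submatrix_apply]
  rw [Finset.sum_comm]
  refine Finset.sum_congr rfl fun b _ => Finset.sum_congr rfl fun y _ => ?_
  simp [mul_comm]

theorem weight_swap {A X Z : Type*} [Fintype A] [Fintype X] [Fintype Z]
    [DecidableEq Z] (e : A × X ≃ Z) {H : Matrix A A ℂ} {F : Matrix X X ℂ} {ρ : Matrix Z Z ℂ}
    (h : ρ.IsHermitian) (a : A) (x : X) (k : Z) :
    weight ((Equiv.prodComm X A).trans e) F H h x a k = weight e H F h a x k := by
  simp only [weight, amplitude_swap]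

section weight

variable {A X Z : Type*} [Fintype A] [Fintype X] [Fintype Z]
    [DecidableEq A] [DecidableEq X] [DecidableEq Z] (e : A × X ≃ Z)
    {H : Matrix A A ℂ} {F : Matrix X X ℂ} {ρ : Matrix Z Z ℂ}

theorem sum_weight_state (hH : H * Hᴴ = 1) (hF : F * Fᴴ = 1) (h : ρ.IsHermitian) (k : Z) :
    ∑ a, ∑ x, weight e H F h a x k = h.eigenvalues k := by
  have hU : (h.eigenvectorUnitary : Matrix Z Z ℂ)ᴴ * h.eigenvectorUnitary = 1 :=
    Unitary.coe_star_mul_self h.eigenvectorUnitary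
  have := congrFun (congrFun (amplitude_conjTranspose_mul_self e hH hF hU) k) k
  simp only [Matrix.mul_apply, Matrix.conjTranspose_apply, Fintype.sum_prod_type,
    Matrix.one_apply_eq, RCLike.star_def, Complex.conj_mul'] at this
  simp_rw [weight, ← Finset.mul_sum]
  rw [show ∑ a, ∑ x, ‖amplitude e H F h.eigenvectorUnitary (a, x) k‖ ^ 2 = 1 by
    exact_mod_cast this, mul_one]

theorem sum_weight_marginal (hH : H * Hᴴ = 1) (h : ρ.IsHermitian)
    (hX : (partialTrace e ρ).IsHermitian) (x : X) :
    ∑ a, ∑ k, weight e H hX.eigenvectorUnitary h a x k = hX.eigenvalues x := by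
  have := sum_amplitude_eq e hH h hX x x
  rw [if_pos rfl] at this
  have h2 : ∀ (z : ℂ) (r : ℝ), z * r * star z = ((r * ‖z‖ ^ 2 : ℝ) : ℂ) := fun z r => by
    rw [mul_right_comm, RCLike.star_def, Complex.mul_conj']
    push_cast
    ring
  simp_rw [h2] at this
  exact_mod_cast this

theorem sum_weight_div_le_one (hH : H * Hᴴ = 1) (h : ρ.PosSemidef)
    (hX : (partialTrace e ρ).PosSemidef) (a : A) (k : Z) :
    ∑ x, weight e H hX.1.eigenvectorUnitary h.1 a x k / hX.1.eigenvalues x ≤ 1 := by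
  set p := hX.1.eigenvalues
  set C := amplitude e H hX.1.eigenvectorUnitary h.1.eigenvectorUnitary
  let φ : {x // p x ≠ 0} → EuclideanSpace ℂ (A × Z) := fun x =>
    WithLp.toLp 2 fun j => (Real.sqrt (h.1.eigenvalues j.2) : ℂ) * star (C (j.1, x.1) j.2) /
      (Real.sqrt (p x.1) : ℂ)
  have hφ : Orthonormal ℂ φ := by
    rw [orthonormal_iff_ite]
    intro x y
    have key := sum_amplitude_eq e hH h.1 hX.1 x.1 y.1
    have hs : ∀ k, ((Real.sqrt (h.1.eigenvalues k) : ℂ)) * (Real.sqrt (h.1.eigenvalues k) : ℂ)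
        = (h.1.eigenvalues k : ℂ) := fun k => by
      rw [← Complex.ofReal_mul, Real.mul_self_sqrt (h.eigenvalues_nonneg k)]
    have : inner ℂ (φ x) (φ y) = (∑ a, ∑ k, C (a, x.1) k * (h.1.eigenvalues k : ℂ) *
        star (C (a, y.1) k)) / ((Real.sqrt (p x.1) : ℂ) * (Real.sqrt (p y.1) : ℂ)) := by
      simp only [φ, PiLp.inner_apply, RCLike.inner_apply, Fintype.sum_prod_type, Finset.sum_div]
      refine Finset.sum_congr rfl fun a _ => Finset.sum_congr rfl fun k _ => ?_
      rw [← hs]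
      simp only [map_div₀, map_mul, Complex.conj_ofReal, RCLike.star_def, Complex.conj_conj]
      rw [div_mul_div_comm]
      congr 1 <;> ring
    rw [this, key]
    by_cases hxy : x = y
    · subst hxy
      rw [if_pos rfl, if_pos rfl, ← Complex.ofReal_mul,
        Real.mul_self_sqrt (hX.eigenvalues_nonneg x.1)]
      exact div_self (by exact_mod_cast x.2)
    · rw [if_neg (fun hh => hxy (Subtype.ext hh)), if_neg hxy, zero_div]
  have hb := hφ.sum_inner_products_le (s := Finset.univ) (EuclideanSpace.single (a, k) (1 : ℂ))
  have h0 : ∑ x, weight e H hX.1.eigenvectorUnitary h.1 a x k / p x =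
      ∑ x : {x // p x ≠ 0}, weight e H hX.1.eigenvectorUnitary h.1 a x k / p x := by
    rw [← Finset.sum_subtype (Finset.univ.filter fun x => p x ≠ 0) (by simp)
      (fun x => weight e H hX.1.eigenvectorUnitary h.1 a x k / p x), Finset.sum_filter_of_ne]
    intro x _ hx h0
    simp [h0] at hx
  rw [h0]
  refine le_trans (le_of_eq (Finset.sum_congr rfl fun x _ => ?_)) (hb.trans (by simp))
  rw [EuclideanSpace.inner_single_right]
  simp only [φ, weight, one_mul, RCLike.norm_conj, norm_div, norm_mul, Complex.norm_real,
    Real.norm_eq_abs, abs_of_nonneg (Real.sqrt_nonneg _), RCLike.star_def, div_pow, mul_pow,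
    Real.sq_sqrt (h.eigenvalues_nonneg k)]
  rw [show Real.sqrt (p x.1) ^ 2 = p x.1 from Real.sq_sqrt (hX.eigenvalues_nonneg x.1)]

theorem vN_partialTrace_le (h : ρ.PosSemidef) (htr : ρ.trace = 1) :
    vN (partialTrace e ρ) ≤ vN (partialTrace ((Equiv.prodComm X A).trans e) ρ) + vN ρ := by
  have hX := partialTrace_posSemidef e h
  have hA := partialTrace_posSemidef ((Equiv.prodComm X A).trans e) h
  have uX : (hX.1.eigenvectorUnitary : Matrix X X ℂ) * (hX.1.eigenvectorUnitary : Matrix X X ℂ)ᴴ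
    = 1 := Unitary.coe_mul_star_self _
  have uA : (hA.1.eigenvectorUnitary : Matrix A A ℂ) * (hA.1.eigenvectorUnitary : Matrix A A ℂ)ᴴ
    = 1 := Unitary.coe_mul_star_self _
  rw [vN_eq hX.1, vN_eq hA.1, vN_eq h.1]
  refine entropy_le_add_of_weights
    (weight e (hA.1.eigenvectorUnitary : Matrix A A ℂ) (hX.1.eigenvectorUnitary : Matrix X X ℂ) h.1)
    _ _ _ (weight_nonneg e h) (sum_weight_state e uA uX h.1) (sum_weight_marginal e uA h.1 hX.1)
    (fun a => ?_) (sum_eigenvalues_eq_one h.1 htr) (sum_weight_div_le_one e uA h hX)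
  rw [← sum_weight_marginal _ uX h.1 hA.1]
  simp_rw [weight_swap]

end weight

theorem sum_sq_inner_le_of_mem_span {ι κ E : Type*} [Fintype ι] [Fintype κ]
    [NormedAddCommGroup E] [InnerProductSpace ℂ E] {v : ι → E} {u : κ → E}
    (hv : Orthonormal ℂ v) (hu : Orthonormal ℂ u)
    (huv : ∀ k, u k ∈ Submodule.span ℂ (Set.range v)) (g : E) :
    ∑ k, ‖inner ℂ (u k) g‖ ^ 2 ≤ ∑ i, ‖inner ℂ (v i) g‖ ^ 2 := by
  classical
  set g' : E := ∑ i, inner ℂ (v i) g • v i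
  have hin : ∀ w ∈ Submodule.span ℂ (Set.range v), inner ℂ w g = inner ℂ w g' := by
    intro w hw
    induction hw using Submodule.span_induction with
    | mem x hx =>
      obtain ⟨i, rfl⟩ := hx
      exact (hv.inner_right_fintype (fun i => inner ℂ (v i) g) i).symm
    | zero => simp
    | add x y _ _ hx hy => rw [inner_add_left, inner_add_left, hx, hy]
    | smul c x _ hx => rw [inner_smul_left, inner_smul_left, hx]
  have hnorm : ‖g'‖ ^ 2 = ∑ i, ‖inner ℂ (v i) g‖ ^ 2 := by
    have h1 : inner ℂ g' g' = ∑ i, (starRingEnd ℂ) (inner ℂ (v i) g) * inner ℂ (v i) g :=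
      hv.inner_sum _ _ Finset.univ
    rw [inner_self_eq_norm_sq_to_K] at h1
    simp_rw [Complex.conj_mul'] at h1
    exact Complex.ofReal_injective (by simpa using h1)
  rw [← hnorm]
  simp_rw [hin _ (huv _)]
  exact hu.sum_inner_products_le g'

theorem ONFam.orthonormal {ι Z : Type*} [DecidableEq ι] [Fintype Z] {v : ι → Z → ℂ}
    (hv : ONFam v) :
    Orthonormal ℂ fun i => (WithLp.toLp 2 (v i) : EuclideanSpace ℂ Z) := by
  rw [orthonormal_iff_ite]
  intro i j
  rw [← hv i j]
  simp [PiLp.inner_apply, mul_comm]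

theorem SuppIn.eigenvectorBasis_mem {ι Z : Type*} [Fintype Z] [DecidableEq Z] {v : ι → Z → ℂ}
    {ρ : Matrix Z Z ℂ} (hs : SuppIn ρ v) (h : ρ.IsHermitian) {k : Z}
    (hk : h.eigenvalues k ≠ 0) :
    h.eigenvectorBasis k ∈
      Submodule.span ℂ (Set.range fun i => (WithLp.toLp 2 (v i) : EuclideanSpace ℂ Z)) := by
  have h1 : (h.eigenvectorBasis k : Z → ℂ) ∈ LinearMap.range ρ.mulVecLin := by
    refine ⟨(h.eigenvalues k : ℂ)⁻¹ • (h.eigenvectorBasis k : Z → ℂ), ?_⟩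
    rw [map_smul, Matrix.mulVecLin_apply, h.mulVec_eigenvectorBasis]
    ext z
    simp only [Pi.smul_apply, Complex.real_smul, smul_eq_mul]
    rw [inv_mul_cancel_left₀ (by exact_mod_cast hk)]
  have h2 := Submodule.mem_map_of_mem
    (f := ((WithLp.linearEquiv 2 ℂ (Z → ℂ)).symm : (Z → ℂ) →ₗ[ℂ] EuclideanSpace ℂ Z)) (hs h1)
  rw [Submodule.map_span, ← Set.range_comp] at h2
  exact h2

theorem sum_sq_mulVec_le {m n : Type*} [Fintype m] [Fintype n] [DecidableEq n]
    (M : Matrix m n ℂ) (f : EuclideanSpace ℂ m) :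
    ∑ j, ‖∑ x, star (f x) * M x j‖ ^ 2 ≤ opNorm M ^ 2 * ‖f‖ ^ 2 := by
  classical
  open scoped Matrix.Norms.L2Operator in
  have h := Matrix.l2_opNorm_mulVec Mᴴ f
  rw [Matrix.l2_opNorm_conjTranspose] at h
  have h2 := pow_le_pow_left₀ (norm_nonneg _) h 2
  rw [EuclideanSpace.norm_sq_eq, mul_pow] at h2
  refine le_trans (le_of_eq (Finset.sum_congr rfl fun j _ => ?_)) h2
  rw [← norm_star]
  simp [Matrix.mulVec, dotProduct, mul_comm]

theorem opNorm_nonneg {m n : Type*} [Fintype m] [Fintype n] [DecidableEq n]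
    (M : Matrix m n ℂ) : 0 ≤ opNorm M := norm_nonneg _

theorem opNorm_ne_zero {m n : Type*} [Fintype m] [Fintype n] [DecidableEq n]
    {M : Matrix m n ℂ} (hM : M ≠ 0) : opNorm M ≠ 0 := by
  rw [opNorm, norm_ne_zero_iff]
  simpa using hM

theorem opNorm_smul {m n : Type*} [Fintype m] [Fintype n] [DecidableEq n] (c : ℂ)
    (M : Matrix m n ℂ) : opNorm (c • M) = ‖c‖ * opNorm M := by
  rw [opNorm, map_smul, map_smul, norm_smul, opNorm]

theorem opNorm_of_onFam_ne_zero {A X Z ι : Type*} [Fintype A] [Fintype X] [Fintype Z]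
    [Fintype ι] [DecidableEq A] [DecidableEq ι] (e : A × X ≃ Z) {v : ι → Z → ℂ} (hv : ONFam v) [Nonempty ι] :
    opNorm (Matrix.of fun (y : X) (q : ι × A) => v q.1 (e (q.2, y))) ≠ 0 := by
  refine opNorm_ne_zero fun h0 => ?_
  obtain ⟨i⟩ := ‹Nonempty ι›
  have h1 : ∀ z, v i z = 0 := fun z => by
    simpa using congrFun (congrFun h0 (e.symm z).2) (i, (e.symm z).1)
  simpa [h1] using hv i i

section upper

variable {A X Z ι : Type*} [Fintype A] [Fintype X] [Fintype Z] [Fintype ι]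
    [DecidableEq A] [DecidableEq X] [DecidableEq Z] [DecidableEq ι] (e : A × X ≃ Z)
    {ρ : Matrix Z Z ℂ}

theorem sum_weight_div_eigenvalues_le (h : ρ.IsHermitian) {F : Matrix X X ℂ} (hF : Fᴴ * F = 1)
    {v : ι → Z → ℂ} (hv : ONFam v) (hs : SuppIn ρ v) (x : X) :
    ∑ a, ∑ k, weight e 1 F h a x k / h.eigenvalues k ≤
      opNorm (Matrix.of fun (y : X) (q : ι × A) => v q.1 (e (q.2, y))) ^ 2 := by
  have hnorm : ‖(WithLp.toLp 2 fun y => F y x : EuclideanSpace ℂ X)‖ ^ 2 = 1 := by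
    have := congrFun (congrFun hF x) x
    simp only [Matrix.mul_apply, Matrix.conjTranspose_apply, Matrix.one_apply_eq,
      RCLike.star_def, Complex.conj_mul'] at this
    rw [EuclideanSpace.norm_sq_eq]
    exact_mod_cast this
  have hb := sum_sq_mulVec_le (Matrix.of fun (y : X) (q : ι × A) => v q.1 (e (q.2, y)))
    (WithLp.toLp 2 fun y => F y x)
  rw [hnorm, mul_one] at hb
  refine le_trans ?_ hb
  rw [Fintype.sum_prod_type_right]
  refine Finset.sum_le_sum fun a _ => ?_
  let g : EuclideanSpace ℂ Z :=
    WithLp.toLp 2 fun z => if (e.symm z).1 = a then F (e.symm z).2 x else 0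
  have hg : ∀ u : EuclideanSpace ℂ Z,
      ‖inner ℂ u g‖ = ‖∑ y, star (F y x) * u (e (a, y))‖ := by
    intro u
    rw [← norm_inner_symm, PiLp.inner_apply, ← e.sum_comp, Fintype.sum_prod_type_right]
    congr 1
    refine Finset.sum_congr rfl fun y _ => ?_
    simp [g, mul_comm, apply_ite]
  have hbes := sum_sq_inner_le_of_mem_span hv.orthonormal
    (u := fun k : {k // h.eigenvalues k ≠ 0} => h.eigenvectorBasis k)
    (h.eigenvectorBasis.orthonormal.comp _ Subtype.val_injective)
    (fun k => hs.eigenvectorBasis_mem h k.2) g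
  simp_rw [hg] at hbes
  refine le_trans (le_of_eq ?_) hbes
  rw [← Finset.sum_subtype (Finset.univ.filter fun k => h.eigenvalues k ≠ 0) (by simp)
    (fun k => ‖∑ y, star (F y x) * h.eigenvectorBasis k (e (a, y))‖ ^ 2), Finset.sum_filter]
  refine Finset.sum_congr rfl fun k _ => ?_
  split_ifs with hk
  · rw [weight, mul_div_cancel_left₀ _ hk]
    congr 2
    simp [amplitude, Matrix.mul_apply, Fintype.sum_prod_type, Matrix.one_apply, apply_ite,
      ite_mul, Finset.sum_ite_irrel]
  · rw [not_not] at hk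
    simp [hk]

theorem vN_le_vN_partialTrace_add (h : ρ.PosSemidef) (htr : ρ.trace = 1)
    {v : ι → Z → ℂ} (hv : ONFam v) (hs : SuppIn ρ v) [Nonempty ι] :
    vN ρ ≤ vN (partialTrace e ρ) +
      2 * Real.log (opNorm (Matrix.of fun (y : X) (q : ι × A) => v q.1 (e (q.2, y)))) := by
  have hX := partialTrace_posSemidef e h
  have hpos := (opNorm_nonneg _).lt_of_ne' (opNorm_of_onFam_ne_zero e hv)
  rw [vN_eq hX.1, vN_eq h.1, ← Nat.cast_two, ← Real.log_pow]
  exact entropy_add_log_le_of_weights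
    (weight e 1 (hX.1.eigenvectorUnitary : Matrix X X ℂ) h.1) _ _ _ (by positivity)
    (weight_nonneg e h) (sum_weight_state e (by simp) (Unitary.coe_mul_star_self _) h.1)
    (sum_weight_marginal e (by simp) h.1 hX.1) (sum_eigenvalues_eq_one h.1 htr)
    (sum_weight_div_eigenvalues_le e h.1 (Unitary.coe_star_mul_self _) hv hs)

theorem vN_add_log_card_le (h : ρ.PosSemidef) (htr : ρ.trace = 1) {d : ℕ} (hd : 1 ≤ d)
    {v t : ι → Z → ℂ} (hvt : ∀ i z, v i z = (Real.sqrt d : ℂ)⁻¹ * t i z)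
    (hv : ONFam v) (hs : SuppIn ρ v) [Nonempty ι] :
    vN ρ + Real.log d ≤ vN (partialTrace e ρ) +
      2 * Real.log (opNorm (Matrix.of fun (y : X) (q : ι × A) => t q.1 (e (q.2, y)))) := by
  have hd' : (0 : ℝ) < d := by exact_mod_cast hd
  have key := vN_le_vN_partialTrace_add e h htr hv hs
  have hne := opNorm_of_onFam_ne_zero e hv
  have hsmul : (Matrix.of fun (y : X) (q : ι × A) => v q.1 (e (q.2, y))) =
      (Real.sqrt d : ℂ)⁻¹ • Matrix.of fun (y : X) (q : ι × A) => t q.1 (e (q.2, y)) := by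
    ext y q
    simp [hvt]
  rw [hsmul, opNorm_smul] at key hne
  rw [Real.log_mul (left_ne_zero_of_mul hne) (right_ne_zero_of_mul hne), norm_inv,
    Complex.norm_real, Real.norm_of_nonneg (Real.sqrt_nonneg _), Real.log_inv,
    Real.log_sqrt hd'.le] at key
  linarith

theorem vN_partialTrace_sub_bounds (h : IsDensity ρ) {d : ℕ} (hd : 1 ≤ d)
    (hcard : Fintype.card A = d) {v t : ι → Z → ℂ}
    (hvt : ∀ i z, v i z = (Real.sqrt d : ℂ)⁻¹ * t i z)
    (hv : ONFam v) (hs : SuppIn ρ v) [Nonempty ι] :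
    -vN ρ ≤ vN (partialTrace ((Equiv.prodComm X A).trans e) ρ) - vN (partialTrace e ρ) ∧
    vN (partialTrace ((Equiv.prodComm X A).trans e) ρ) - vN (partialTrace e ρ) ≤ -vN ρ +
      2 * Real.log (opNorm (Matrix.of fun (y : X) (q : ι × A) => t q.1 (e (q.2, y)))) := by
  have h1 := vN_partialTrace_le e h.1 h.2
  have h2 := vN_add_log_card_le e h.1 h.2 hd hvt hv hs
  have h3 := vN_le_log_card (partialTrace_posSemidef ((Equiv.prodComm X A).trans e) h.1)
    ((trace_partialTrace _ _).trans h.2)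
  rw [hcard] at h3
  constructor <;> linarith

end upper

/-- Regrouping of three factors that singles out the second one. -/
def middleEquiv (α β γ : Type*) : β × α × γ ≃ α × β × γ where
  toFun p := (p.2.1, p.1, p.2.2)
  invFun p := (p.2.1, p.1, p.2.2)
  left_inv _ := rfl
  right_inv _ := rfl

/-- Regrouping of three factors that singles out the third one. -/
def lastEquiv (α β γ : Type*) : γ × α × β ≃ α × β × γ where
  toFun p := (p.2.1, p.2.2, p.1)
  invFun p := (p.2.2, p.1, p.2.1)
  left_inv _ := rfl
  right_inv _ := rfl

theorem red1_eq_partialTrace {α β γ : Type*} [Fintype β] [Fintype γ]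
    (ρ : Matrix (α × β × γ) (α × β × γ) ℂ) :
    red1 ρ = partialTrace ((Equiv.prodComm (β × γ) α).trans (Equiv.refl _)) ρ := by
  ext x y
  simp [red1, partialTrace, Fintype.sum_prod_type]

theorem red2_eq_partialTrace {α β γ : Type*} [Fintype α] [Fintype γ]
    (ρ : Matrix (α × β × γ) (α × β × γ) ℂ) :
    red2 ρ = partialTrace ((Equiv.prodComm (α × γ) β).trans (middleEquiv α β γ)) ρ := by
  ext x y
  simp [red2, partialTrace, Fintype.sum_prod_type, middleEquiv]

theorem red3_eq_partialTrace {α β γ : Type*} [Fintype α] [Fintype β]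
    (ρ : Matrix (α × β × γ) (α × β × γ) ℂ) :
    red3 ρ = partialTrace ((Equiv.prodComm (α × β) γ).trans (lastEquiv α β γ)) ρ := by
  ext x y
  simp [red3, partialTrace, Fintype.sum_prod_type, lastEquiv]

/-- for every density matrix supported in the code space of the tensor `t`,
`−2 S(ρ̃) ≤ I₃(ρ̃) ≤ −2 S(ρ̃) + 2 log‖t⁽¹⁾‖∞ + 2 log‖t⁽²⁾‖∞ + 2 log‖t⁽³⁾‖∞`. -/
theorem stmt8 (d r : ℕ) (hd : 1 ≤ d) (hr : 1 ≤ r)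
    (t : Fin r → Fin d → Fin d → Fin d → ℂ)
    (v : Fin r → (Fin d × Fin d × Fin d) → ℂ)
    (hv : ∀ i x, v i x = (Real.sqrt d : ℂ)⁻¹ * t i x.1 x.2.1 x.2.2)
    (hon : ONFam v)
    (ρ : Matrix (Fin d × Fin d × Fin d) (Fin d × Fin d × Fin d) ℂ)
    (hρ : IsDensity ρ) (hsupp : SuppIn ρ v) :
    -2 * vN ρ ≤ I3 ρ ∧
    I3 ρ ≤ -2 * vN ρ
        + 2 * Real.log (opNorm (Matrix.of fun (p : Fin d × Fin d) (q : Fin r × Fin d) => t q.1 q.2 p.1 p.2))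
        + 2 * Real.log (opNorm (Matrix.of fun (p : Fin d × Fin d) (q : Fin r × Fin d) => t q.1 p.1 q.2 p.2))
        + 2 * Real.log (opNorm (Matrix.of fun (p : Fin d × Fin d) (q : Fin r × Fin d) => t q.1 p.1 p.2 q.2)) := by
  have : Nonempty (Fin r) := ⟨⟨0, hr⟩⟩
  have h1 := vN_partialTrace_sub_bounds (Equiv.refl (Fin d × Fin d × Fin d)) hρ hd
    (Fintype.card_fin d) hv hon hsupp
  have h2 := vN_partialTrace_sub_bounds (middleEquiv (Fin d) (Fin d) (Fin d)) hρ hd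
    (Fintype.card_fin d) hv hon hsupp
  have h3 := vN_partialTrace_sub_bounds (lastEquiv (Fin d) (Fin d) (Fin d)) hρ hd
    (Fintype.card_fin d) hv hon hsupp
  rw [← red1_eq_partialTrace, show partialTrace (Equiv.refl _) ρ = red23 ρ from rfl] at h1
  rw [← red2_eq_partialTrace, show partialTrace (middleEquiv _ _ _) ρ = red13 ρ from rfl] at h2
  rw [← red3_eq_partialTrace, show partialTrace (lastEquiv _ _ _) ρ = red12 ρ from rfl] at h3
  simp only [middleEquiv, lastEquiv, Equiv.refl_apply, Equiv.coe_fn_mk] at h1 h2 h3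
  rw [I3]
  constructor <;> linarith
end
end

section
/- Let d ≥ 1 and let u be a Haar-distributed random unitary in U(d²), regarded as a matrix indexed by (Fin d × Fin d) × (Fin d × Fin d) with entries u((s2,s3),(i,s1)). Define the reshuffling u^R((s1,s3),(i,s2)) := u((s2,s3),(i,s1)) and the partial transpose with flip u^Γ((s1,s2),(i,s3)) := u((s2,s3),(i,s1)). Then for every δ with 0 < δ ≤ e^{-1}, with Haar probability at least 1 − δ one has max{‖u‖_∞, ‖u^R‖_∞, ‖u^Γ‖_∞} ≤ 48·e·√(2·log(1/δ)). -/
open Matrix MeasureTheory ProbabilityTheory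
open scoped ComplexOrder BigOperators

noncomputable section

section HaarMoments

variable {I : Type*} [Fintype I] [DecidableEq I]

/-- The unitary group is compact. -/
theorem compactSpace_unitaryGroup : CompactSpace (Matrix.unitaryGroup I ℂ) := by
  suffices h : IsCompact (Matrix.unitaryGroup I ℂ : Set (Matrix I I ℂ)) from
    isCompact_iff_compactSpace.1 h
  have hclosed : IsClosed (Matrix.unitaryGroup I ℂ : Set (Matrix I I ℂ)) := isClosed_unitary
  have hK : IsCompact (Set.univ.pi fun _ : I => Set.univ.pi fun _ : I =>
      Metric.closedBall (0 : ℂ) 1) :=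
    isCompact_univ_pi fun _ => isCompact_univ_pi fun _ => isCompact_closedBall 0 1
  refine IsCompact.of_isClosed_subset hK hclosed fun U hU i _ j _ => ?_
  simpa using entry_norm_bound_of_unitary hU i j

/-- The real linear functional `M ↦ Re tr (A M)`. -/
def reTrace (A M : Matrix I I ℂ) : ℝ := (A * M).trace.re

omit [DecidableEq I] in
theorem continuous_reTrace (A : Matrix I I ℂ) : Continuous (reTrace A) := by
  unfold reTrace
  fun_prop

theorem integrable_of_continuous_unitaryGroup
    [MeasurableSpace (Matrix.unitaryGroup I ℂ)] [BorelSpace (Matrix.unitaryGroup I ℂ)]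
    (ν : Measure (Matrix.unitaryGroup I ℂ)) [IsFiniteMeasure ν]
    {g : Matrix.unitaryGroup I ℂ → ℝ} (hg : Continuous g) : Integrable g ν := by
  have := compactSpace_unitaryGroup (I := I)
  exact hg.integrable_of_hasCompactSupport (HasCompactSupport.of_compactSpace g)

theorem exp_smul_mem_unitaryGroup {X : Matrix I I ℂ} (hX : Xᴴ = -X) (s : ℝ) :
    NormedSpace.exp (s • X) ∈ Matrix.unitaryGroup I ℂ := by
  have h : (s • X)ᴴ = -(s • X) := by
    rw [Matrix.conjTranspose_smul, hX]
    simp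
  rw [Matrix.mem_unitaryGroup_iff', Matrix.star_eq_conjTranspose, ← Matrix.exp_conjTranspose, h,
    ← Matrix.exp_add_of_commute _ _ (Commute.refl (s • X)).neg_left, neg_add_cancel,
    NormedSpace.exp_zero]

/-- The one-parameter unitary group generated by a skew-adjoint matrix. -/
theorem exists_unitary_curve {X : Matrix I I ℂ} (hX : Xᴴ = -X) :
    ∃ c : ℝ → Matrix.unitaryGroup I ℂ, c 0 = 1 ∧ ∀ (A M : Matrix I I ℂ) (s : ℝ),
      HasDerivAt (fun s => reTrace A ((c s : Matrix I I ℂ) * M))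
        (reTrace (A * X) ((c s : Matrix I I ℂ) * M)) s := by
  let : NormedRing (Matrix I I ℂ) := Matrix.linftyOpNormedRing
  let : NormedAlgebra ℝ (Matrix I I ℂ) := Matrix.linftyOpNormedAlgebra
  let : NormedAlgebra ℚ (Matrix I I ℂ) := NormedAlgebra.restrictScalars ℚ ℝ _
  have hmem := exp_smul_mem_unitaryGroup hX
  refine ⟨fun s => ⟨NormedSpace.exp (s • X), hmem s⟩, Subtype.ext (by simp), fun A M s => ?_⟩
  have h1 := hasDerivAt_exp_smul_const' (𝕂 := ℝ) X s
  let ℓ : Matrix I I ℂ →L[ℝ] ℝ := LinearMap.toContinuousLinearMap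
    { toFun := fun N => reTrace A (N * M)
      map_add' := fun N N' => by simp [reTrace, Matrix.add_mul, Matrix.mul_add]
      map_smul' := fun r N => by simp [reTrace] }
  have h2 := ℓ.hasFDerivAt.comp_hasDerivAt s h1
  have he : reTrace (A * X) (NormedSpace.exp (s • X) * M) = ℓ (X * NormedSpace.exp (s • X)) := by
    change _ = reTrace A (X * NormedSpace.exp (s • X) * M)
    simp only [reTrace, Matrix.mul_assoc]
  change HasDerivAt _ (reTrace (A * X) (NormedSpace.exp (s • X) * M)) s
  rw [he]
  exact h2

/-- Real antisymmetric generator of the unitary group. -/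
def antisymmGen (p q : I) : Matrix I I ℂ :=
  (1 / 2 : ℂ) • (Matrix.single p q 1 - Matrix.single q p 1)

/-- Imaginary symmetric generator of the unitary group. -/
def symmGen (p q : I) : Matrix I I ℂ :=
  (Complex.I / 2) • (Matrix.single p q 1 + Matrix.single q p 1)

omit [Fintype I] in
theorem conjTranspose_antisymmGen (p q : I) : (antisymmGen p q)ᴴ = -antisymmGen p q := by
  simp only [antisymmGen, Matrix.conjTranspose_smul, Matrix.conjTranspose_sub,
    Matrix.conjTranspose_single, star_one, star_div₀, star_ofNat]
  module

omit [Fintype I] in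
theorem conjTranspose_symmGen (p q : I) : (symmGen p q)ᴴ = -symmGen p q := by
  simp only [symmGen, Matrix.conjTranspose_smul, Matrix.conjTranspose_add,
    Matrix.conjTranspose_single, star_one, star_div₀, star_ofNat, Complex.star_def,
    Complex.conj_I]
  module

theorem antisymmGen_sq_add_symmGen_sq (p q : I) :
    antisymmGen p q * antisymmGen p q + symmGen p q * symmGen p q
      = -(1 / 2 : ℂ) • (Matrix.single p p 1 + Matrix.single q q 1) := by
  have hI : Complex.I / 2 * (Complex.I / 2) = -(1 / 4) := by
    rw [div_mul_div_comm, Complex.I_mul_I]; norm_num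
  simp only [antisymmGen, symmGen, Matrix.smul_mul, Matrix.mul_smul, smul_smul, hI]
  simp only [Matrix.sub_mul, Matrix.mul_sub, Matrix.add_mul, Matrix.mul_add,
    Matrix.single_mul_single_same, mul_one]
  module

theorem sum_sq_generators :
    ∑ p : I, ∑ q : I, (antisymmGen p q * antisymmGen p q + symmGen p q * symmGen p q)
      = -(Fintype.card I : ℂ) • (1 : Matrix I I ℂ) := by
  have h1 : ∑ p : I, Matrix.single p p (1 : ℂ) = 1 := by
    exact Matrix.sum_single_one
  simp only [antisymmGen_sq_add_symmGen_sq, ← Finset.smul_sum, Finset.sum_add_distrib, h1,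
    Finset.sum_const, Finset.card_univ]
  rw [← Nat.cast_smul_eq_nsmul ℂ]
  module

theorem reTrace_antisymmGen (A U : Matrix I I ℂ) (p q : I) :
    reTrace (A * antisymmGen p q) U = (((U * A) q p).re - ((U * A) p q).re) / 2 := by
  have h : (A * antisymmGen p q * U).trace = (U * A * antisymmGen p q).trace := by
    rw [Matrix.trace_mul_comm, Matrix.mul_assoc]
  rw [reTrace, h]
  simp [antisymmGen, Matrix.mul_sub, Matrix.trace_mul_single]
  ring

theorem reTrace_symmGen (A U : Matrix I I ℂ) (p q : I) :
    reTrace (A * symmGen p q) U = -(((U * A) q p).im + ((U * A) p q).im) / 2 := by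
  have h : (A * symmGen p q * U).trace = (U * A * symmGen p q).trace := by
    rw [Matrix.trace_mul_comm, Matrix.mul_assoc]
  rw [reTrace, h]
  simp [symmGen, Matrix.mul_add, Matrix.trace_mul_single]
  ring

/-- Squared Frobenius norm. -/
def frobSq (A : Matrix I I ℂ) : ℝ := ∑ p, ∑ q, ‖A p q‖ ^ 2

omit [DecidableEq I] in
theorem frobSq_eq_trace (A : Matrix I I ℂ) : (frobSq A : ℂ) = (Aᴴ * A).trace := by
  simp only [frobSq, Matrix.trace, Matrix.diag, Matrix.mul_apply, Matrix.conjTranspose_apply]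
  push_cast
  rw [Finset.sum_comm]
  refine Finset.sum_congr rfl fun p _ => Finset.sum_congr rfl fun q _ => ?_
  rw [← Complex.conj_mul']
  rfl

theorem frobSq_unitary_mul (A : Matrix I I ℂ) (U : Matrix.unitaryGroup I ℂ) :
    frobSq ((U : Matrix I I ℂ) * A) = frobSq A := by
  have hU : (U : Matrix I I ℂ)ᴴ * U = 1 := Matrix.mem_unitaryGroup_iff'.1 U.2
  have : (frobSq ((U : Matrix I I ℂ) * A) : ℂ) = frobSq A := by
    rw [frobSq_eq_trace, frobSq_eq_trace, Matrix.conjTranspose_mul, Matrix.mul_assoc,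
      ← Matrix.mul_assoc _ _ A, hU, Matrix.one_mul]
  exact_mod_cast this

theorem sum_sq_reTrace_generators_le (A : Matrix I I ℂ) (U : Matrix.unitaryGroup I ℂ) :
    ∑ p : I, ∑ q : I, (reTrace (A * antisymmGen p q) U ^ 2 + reTrace (A * symmGen p q) U ^ 2)
      ≤ frobSq A := by
  rw [← frobSq_unitary_mul A U]
  set B := (U : Matrix I I ℂ) * A
  have hB : frobSq B = ∑ p, ∑ q, (‖B q p‖ ^ 2 + ‖B p q‖ ^ 2) / 2 := by
    simp only [add_div, Finset.sum_add_distrib]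
    rw [Finset.sum_comm]
    simp only [← Finset.sum_add_distrib, add_halves]
    rfl
  rw [hB]
  refine Finset.sum_le_sum fun p _ => Finset.sum_le_sum fun q _ => ?_
  rw [reTrace_antisymmGen, reTrace_symmGen, Complex.sq_norm, Complex.sq_norm,
    Complex.normSq_apply, Complex.normSq_apply]
  change (((B q p).re - (B p q).re) / 2) ^ 2 + (-((B q p).im + (B p q).im) / 2) ^ 2 ≤ _
  nlinarith [sq_nonneg ((B q p).re + (B p q).re), sq_nonneg ((B q p).im - (B p q).im)]

theorem sum_reTrace_sq_generators (A M : Matrix I I ℂ) :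
    ∑ p : I, ∑ q : I, (reTrace (A * antisymmGen p q * antisymmGen p q) M
      + reTrace (A * symmGen p q * symmGen p q) M) = -(Fintype.card I) * reTrace A M := by
  have h : ∑ p : I, ∑ q : I, (A * antisymmGen p q * antisymmGen p q * M
      + A * symmGen p q * symmGen p q * M) = -(Fintype.card I : ℂ) • (A * M) := by
    have := congrArg (fun N => A * N * M) (sum_sq_generators (I := I))
    simp only [Matrix.mul_sum, Matrix.sum_mul, Matrix.mul_add, Matrix.add_mul,
      ← Matrix.mul_assoc] at this
    rw [this]
    simp
  have := congrArg (fun N => N.trace.re) h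
  simp only [Matrix.trace_sum, Matrix.trace_add, Complex.re_sum, Complex.add_re] at this
  simp only [reTrace, this]
  simp

omit [DecidableEq I] in
theorem frobSq_nonneg (A : Matrix I I ℂ) : 0 ≤ frobSq A :=
  Finset.sum_nonneg fun _ _ => Finset.sum_nonneg fun _ _ => sq_nonneg _

variable [MeasurableSpace (Matrix.unitaryGroup I ℂ)] [BorelSpace (Matrix.unitaryGroup I ℂ)]

/-- Integration by parts for the Haar measure along a one-parameter subgroup. -/
theorem integral_reTrace_mul_pow_add_eq_zero (ν : Measure (Matrix.unitaryGroup I ℂ))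
    [IsProbabilityMeasure ν] [ν.IsMulLeftInvariant]
    (A : Matrix I I ℂ) {X : Matrix I I ℂ} (hX : Xᴴ = -X) (j : ℕ) :
    ∫ U : Matrix.unitaryGroup I ℂ, (reTrace (A * X * X) U * reTrace A U ^ (j + 1)
      + (j + 1) * reTrace (A * X) U ^ 2 * reTrace A U ^ j) ∂ν = 0 := by
  have := compactSpace_unitaryGroup (I := I)
  obtain ⟨c, hc0, hc⟩ := exists_unitary_curve hX
  let g : Matrix.unitaryGroup I ℂ → ℝ := fun U => reTrace (A * X) U * reTrace A U ^ (j + 1)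
  let g' : Matrix.unitaryGroup I ℂ → ℝ := fun U => reTrace (A * X * X) U * reTrace A U ^ (j + 1)
      + (j + 1) * reTrace (A * X) U ^ 2 * reTrace A U ^ j
  have hL : ∀ B : Matrix I I ℂ, Continuous fun U : Matrix.unitaryGroup I ℂ => reTrace B U :=
    fun B => (continuous_reTrace B).comp continuous_subtype_val
  have hg : Continuous g := (hL _).mul ((hL _).pow _)
  have hg' : Continuous g' := ((hL _).mul ((hL _).pow _)).add
    ((continuous_const.mul ((hL _).pow _)).mul ((hL _).pow _))
  obtain ⟨C, hC⟩ := isCompact_univ.exists_bound_of_continuousOn hg'.continuousOn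
  have hmul : ∀ V : Matrix.unitaryGroup I ℂ, Continuous fun U => V * U := fun V =>
    continuous_const.mul continuous_id
  have hderiv := (hasDerivAt_integral_of_dominated_loc_of_deriv_le (μ := ν) (x₀ := (0 : ℝ))
    (F := fun s U => g (c s * U)) (F' := fun s U => g' (c s * U)) (bound := fun _ => C)
    Filter.univ_mem
    (Filter.Eventually.of_forall fun s =>
      (integrable_of_continuous_unitaryGroup ν (hg.comp (hmul (c s)))).aestronglyMeasurable)
    (integrable_of_continuous_unitaryGroup ν (hg.comp (hmul (c 0))))
    (integrable_of_continuous_unitaryGroup ν (hg'.comp (hmul (c 0)))).aestronglyMeasurable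
    (Filter.Eventually.of_forall fun U s _ => hC _ (Set.mem_univ _))
    (integrable_const C)
    (Filter.Eventually.of_forall fun U s _ => by
      have h1 := hc (A * X) U s
      have h2 := (hc A U s).pow (j + 1)
      refine (h1.mul h2).congr_deriv ?_
      rw [Nat.add_sub_cancel, Pi.pow_apply]
      change _ = reTrace (A * X * X) (c s * U : Matrix I I ℂ) * reTrace A (c s * U) ^ (j + 1)
        + (j + 1) * reTrace (A * X) (c s * U) ^ 2 * reTrace A (c s * U) ^ j
      push_cast
      ring)).2
  have hconst : (fun s => ∫ U, g (c s * U) ∂ν) = fun _ => ∫ U, g U ∂ν := by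
    funext s
    exact integral_mul_left_eq_self g (c s)
  rw [hconst] at hderiv
  have := hderiv.unique (hasDerivAt_const (0 : ℝ) _)
  simpa [hc0, g'] using this

/-- Recursive moment bound for a linear functional of a Haar unitary. -/
theorem card_mul_moment_le (ν : Measure (Matrix.unitaryGroup I ℂ))
    [IsProbabilityMeasure ν] [ν.IsMulLeftInvariant] (A : Matrix I I ℂ) (k : ℕ) :
    (Fintype.card I : ℝ) * ∫ U : Matrix.unitaryGroup I ℂ, reTrace A U ^ (2 * (k + 1)) ∂ν
      ≤ (2 * k + 1) * frobSq A * ∫ U : Matrix.unitaryGroup I ℂ, reTrace A U ^ (2 * k) ∂ν := by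
  have hL : ∀ B : Matrix I I ℂ, Continuous fun U : Matrix.unitaryGroup I ℂ => reTrace B U :=
    fun B => (continuous_reTrace B).comp continuous_subtype_val
  let T : Matrix I I ℂ → Matrix.unitaryGroup I ℂ → ℝ := fun X U =>
    reTrace (A * X * X) U * reTrace A U ^ (2 * k + 1)
      + ((2 * k : ℕ) + 1) * reTrace (A * X) U ^ 2 * reTrace A U ^ (2 * k)
  have hT : ∀ X, Integrable (T X) ν := fun X => integrable_of_continuous_unitaryGroup ν
    (((hL _).mul ((hL _).pow _)).add ((continuous_const.mul ((hL _).pow _)).mul ((hL _).pow _)))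
  have hzero : ∫ U, ∑ p : I, ∑ q : I, (T (antisymmGen p q) U + T (symmGen p q) U) ∂ν = 0 := by
    have hT₂ : ∀ p q, Integrable (fun U => T (antisymmGen p q) U + T (symmGen p q) U) ν :=
      fun p q => (hT _).add (hT _)
    rw [integral_finsetSum _ fun p _ => integrable_finsetSum _ fun q _ => hT₂ p q]
    refine Finset.sum_eq_zero fun p _ => ?_
    rw [integral_finsetSum _ fun q _ => hT₂ p q]
    refine Finset.sum_eq_zero fun q _ => ?_
    rw [integral_add (hT _) (hT _),
      integral_reTrace_mul_pow_add_eq_zero ν A (conjTranspose_antisymmGen p q),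
      integral_reTrace_mul_pow_add_eq_zero ν A (conjTranspose_symmGen p q), add_zero]
  have hpt : ∀ U : Matrix.unitaryGroup I ℂ,
      ∑ p : I, ∑ q : I, (T (antisymmGen p q) U + T (symmGen p q) U)
        ≤ -(Fintype.card I) * reTrace A U ^ (2 * (k + 1))
          + (2 * k + 1) * frobSq A * reTrace A U ^ (2 * k) := by
    intro U
    have hsplit : ∑ p : I, ∑ q : I, (T (antisymmGen p q) U + T (symmGen p q) U)
        = (∑ p : I, ∑ q : I, (reTrace (A * antisymmGen p q * antisymmGen p q) U
            + reTrace (A * symmGen p q * symmGen p q) U)) * reTrace A U ^ (2 * k + 1)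
          + (2 * k + 1) * (∑ p : I, ∑ q : I, (reTrace (A * antisymmGen p q) U ^ 2
            + reTrace (A * symmGen p q) U ^ 2)) * reTrace A U ^ (2 * k) := by
      simp only [Finset.sum_mul, Finset.mul_sum, ← Finset.sum_add_distrib]
      refine Finset.sum_congr rfl fun p _ => Finset.sum_congr rfl fun q _ => ?_
      simp only [T]
      push_cast
      ring
    rw [hsplit, sum_reTrace_sq_generators]
    have h1 := sum_sq_reTrace_generators_le A U
    have h2 : 0 ≤ reTrace A U ^ (2 * k) := by rw [pow_mul]; positivity
    have h3 : -(Fintype.card I : ℝ) * reTrace A U * reTrace A U ^ (2 * k + 1)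
        = -(Fintype.card I) * reTrace A U ^ (2 * (k + 1)) := by ring
    rw [h3]
    gcongr
  have hP : ∀ m : ℕ, Integrable (fun U : Matrix.unitaryGroup I ℂ => reTrace A U ^ m) ν :=
    fun m => integrable_of_continuous_unitaryGroup ν ((hL A).pow m)
  have hint := integral_mono
    (integrable_finsetSum _ fun p _ => integrable_finsetSum _ fun q _ =>
      (hT (antisymmGen p q)).add (hT (symmGen p q)))
    (((hP (2 * (k + 1))).const_mul (-(Fintype.card I : ℝ))).add
      ((hP (2 * k)).const_mul ((2 * k + 1) * frobSq A))) hpt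
  have hz : ∫ U, ∑ p : I, ∑ q : I, (T (antisymmGen p q) + T (symmGen p q)) U ∂ν = 0 := hzero
  simp only [Pi.add_apply] at hint hz
  rw [hz, integral_add ((hP _).const_mul _) ((hP _).const_mul _), integral_const_mul,
    integral_const_mul] at hint
  linarith

/-- Sub-Gaussian even moments of a linear functional of a Haar unitary. -/
theorem moment_reTrace_le [Nonempty I] (ν : Measure (Matrix.unitaryGroup I ℂ))
    [IsProbabilityMeasure ν] [ν.IsMulLeftInvariant] (A : Matrix I I ℂ) (K : ℕ) :
    ∫ U : Matrix.unitaryGroup I ℂ, reTrace A U ^ (2 * K) ∂ν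
      ≤ (2 * K * frobSq A / Fintype.card I) ^ K := by
  have hn : (0 : ℝ) < Fintype.card I := by exact_mod_cast Fintype.card_pos
  have hA := frobSq_nonneg A
  suffices h : ∀ k ≤ K, ∫ U : Matrix.unitaryGroup I ℂ, reTrace A U ^ (2 * k) ∂ν
      ≤ (2 * K * frobSq A / Fintype.card I) ^ k from h K le_rfl
  intro k
  induction k with
  | zero => intro _; simp
  | succ k ih =>
    intro hk
    have hk' : (k : ℝ) + 1 ≤ K := by exact_mod_cast hk
    have h1 := card_mul_moment_le ν A k
    have h2 := ih (by omega)
    have h3 : (2 * k + 1) * frobSq A * ∫ U : Matrix.unitaryGroup I ℂ, reTrace A U ^ (2 * k) ∂ν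
        ≤ (2 * K) * frobSq A * (2 * K * frobSq A / Fintype.card I) ^ k := by
      have : (2 * (k : ℝ) + 1) ≤ 2 * K := by linarith
      have hnn : 0 ≤ ∫ U : Matrix.unitaryGroup I ℂ, reTrace A U ^ (2 * k) ∂ν :=
        integral_nonneg fun U => by
          change 0 ≤ reTrace A U ^ (2 * k)
          rw [pow_mul]; positivity
      gcongr
    rw [pow_succ, mul_div_assoc', le_div_iff₀ hn]
    linarith

end HaarMoments

section EntryPermutation

variable {I : Type*} [Fintype I] [DecidableEq I]

/-- The matrix obtained by permuting all entries of `M` along `e`. -/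
def permEntries (e : I × I ≃ I × I) (M : Matrix I I ℂ) : Matrix I I ℂ :=
  Matrix.of fun p q => M (e (p, q)).1 (e (p, q)).2

/-- The matrix representing `M ↦ ⟪x, permEntries e M y⟫` as a trace. -/
def traceDual (e : I × I ≃ I × I) (x y : EuclideanSpace ℂ I) : Matrix I I ℂ :=
  Matrix.of fun b a => star (x (e.symm (a, b)).1) * y (e.symm (a, b)).2

theorem reTrace_traceDual (e : I × I ≃ I × I) (x y : EuclideanSpace ℂ I) (M : Matrix I I ℂ) :
    reTrace (traceDual e x y) M
      = (inner ℂ x (Matrix.toEuclideanLin (permEntries e M) y)).re := by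
  have h1 : (traceDual e x y * M).trace
      = ∑ z : I × I, star (x (e.symm z).1) * y (e.symm z).2 * M z.1 z.2 := by
    rw [Fintype.sum_prod_type, Finset.sum_comm]
    rfl
  have h2 : inner ℂ x (Matrix.toEuclideanLin (permEntries e M) y)
      = ∑ z : I × I, star (x z.1) * y z.2 * M (e z).1 (e z).2 := by
    rw [Fintype.sum_prod_type]
    simp only [PiLp.inner_apply, Matrix.toLpLin_apply, Matrix.mulVec, dotProduct,
      RCLike.inner_apply, Finset.sum_mul, permEntries, Matrix.of_apply]
    refine Finset.sum_congr rfl fun p _ => Finset.sum_congr rfl fun q _ => ?_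
    rw [Complex.star_def]
    ring
  rw [reTrace, h1, h2, ← Equiv.sum_comp e]
  simp

omit [DecidableEq I] in
theorem frobSq_traceDual (e : I × I ≃ I × I) (x y : EuclideanSpace ℂ I) :
    frobSq (traceDual e x y) = ‖x‖ ^ 2 * ‖y‖ ^ 2 := by
  have h : frobSq (traceDual e x y)
      = ∑ z : I × I, ‖x (e.symm z).1‖ ^ 2 * ‖y (e.symm z).2‖ ^ 2 := by
    rw [Fintype.sum_prod_type, Finset.sum_comm, frobSq]
    simp [traceDual, mul_pow]
  rw [h, Equiv.sum_comp e.symm fun z : I × I => ‖x z.1‖ ^ 2 * ‖y z.2‖ ^ 2,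
    Fintype.sum_prod_type, EuclideanSpace.norm_sq_eq, EuclideanSpace.norm_sq_eq,
    Finset.sum_mul_sum]

end EntryPermutation

/-- A bounded operator has a matrix coefficient that is comparable to its norm on whole balls. -/
theorem exists_ball_re_inner_ge {E : Type*} [NormedAddCommGroup E] [InnerProductSpace ℂ E]
    (f : E →L[ℂ] E) (hf : 0 < ‖f‖) :
    ∃ x₀ y₀ : E, Metric.ball x₀ (1 / 4) ⊆ Metric.ball 0 (5 / 4) ∧
      Metric.ball y₀ (1 / 4) ⊆ Metric.ball 0 (5 / 4) ∧
      ∀ x ∈ Metric.ball x₀ (1 / 4), ∀ y ∈ Metric.ball y₀ (1 / 4),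
        3 / 8 * ‖f‖ ≤ (inner ℂ x (f y)).re := by
  obtain ⟨y₀, hy₀, hfy⟩ := f.exists_lt_apply_of_lt_opNorm (r := 15 / 16 * ‖f‖) (by linarith)
  have hfy0 : 0 < ‖f y₀‖ := by nlinarith
  set x₀ : E := ((‖f y₀‖⁻¹ : ℝ) : ℂ) • f y₀ with hx₀
  have hx₀n : ‖x₀‖ = 1 := by
    rw [hx₀, norm_smul, Complex.norm_real, norm_inv, norm_norm, inv_mul_cancel₀ hfy0.ne']
  have hinner : (inner ℂ x₀ (f y₀)).re = ‖f y₀‖ := by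
    rw [hx₀, inner_smul_left, Complex.conj_ofReal, Complex.re_ofReal_mul,
      inner_self_eq_norm_sq_to_K]
    have : ((‖f y₀‖ : ℂ) ^ 2).re = ‖f y₀‖ ^ 2 := by
      rw [← Complex.ofReal_pow, Complex.ofReal_re]
    simp only [Complex.coe_algebraMap]
    rw [this]
    field_simp
  have hball : ∀ z₀ : E, ‖z₀‖ ≤ 1 → ∀ z ∈ Metric.ball z₀ (1 / 4), ‖z‖ < 5 / 4 := by
    intro z₀ hz₀ z hz
    rw [mem_ball_iff_norm] at hz
    linarith [norm_le_norm_add_norm_sub' z z₀]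
  refine ⟨x₀, y₀, fun z hz => by simpa using hball x₀ hx₀n.le z hz,
    fun z hz => by simpa using hball y₀ hy₀.le z hz, fun x hx y hy => ?_⟩
  have hxn := hball x₀ hx₀n.le x hx
  rw [mem_ball_iff_norm] at hx hy
  have hsplit : inner ℂ x (f y) = inner ℂ x₀ (f y₀) + inner ℂ (x - x₀) (f y₀)
      + inner ℂ x (f (y - y₀)) := by
    rw [map_sub, inner_sub_left, inner_sub_right]
    ring
  have h1 : -(1 / 4 * ‖f‖) ≤ (inner ℂ (x - x₀) (f y₀)).re := by
    have hb : ‖inner ℂ (x - x₀) (f y₀)‖ ≤ 1 / 4 * ‖f‖ := by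
      refine (norm_inner_le_norm _ _).trans ?_
      have := f.le_opNorm y₀
      have : ‖f y₀‖ ≤ ‖f‖ := this.trans (mul_le_of_le_one_right hf.le hy₀.le)
      gcongr
    linarith [neg_abs_le (inner ℂ (x - x₀) (f y₀)).re,
      Complex.abs_re_le_norm (inner ℂ (x - x₀) (f y₀))]
  have h2 : -(5 / 16 * ‖f‖) ≤ (inner ℂ x (f (y - y₀))).re := by
    have hb : ‖inner ℂ x (f (y - y₀))‖ ≤ 5 / 4 * (‖f‖ * (1 / 4)) := by
      refine (norm_inner_le_norm _ _).trans ?_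
      have := f.le_opNorm (y - y₀)
      have : ‖f (y - y₀)‖ ≤ ‖f‖ * (1 / 4) := this.trans (by gcongr)
      gcongr
    linarith [neg_abs_le (inner ℂ x (f (y - y₀))).re,
      Complex.abs_re_le_norm (inner ℂ x (f (y - y₀)))]
  rw [hsplit, Complex.add_re, Complex.add_re, hinner]
  linarith

section Tail

variable {I : Type*} [Fintype I] [DecidableEq I] [Nonempty I]
  [MeasurableSpace (Matrix.unitaryGroup I ℂ)] [BorelSpace (Matrix.unitaryGroup I ℂ)]

/-- Moment form of the tail bound for the operator norm of a Haar unitary with permuted entries;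
the bad event is contained in a measurable set of small measure. -/
theorem exists_measurableSet_opNorm_gt (ν : Measure (Matrix.unitaryGroup I ℂ))
    [IsProbabilityMeasure ν] [ν.IsMulLeftInvariant] (e : I × I ≃ I × I) (K : ℕ)
    {T : ℝ} (hT : 0 < T) :
    ∃ S : Set (Matrix.unitaryGroup I ℂ), MeasurableSet S ∧
      {U : Matrix.unitaryGroup I ℂ | T < opNorm (permEntries e (U : Matrix I I ℂ))} ⊆ S ∧
      ν S ≤ ENNReal.ofReal (5 ^ (4 * Fintype.card I) *
        (625 * K / (18 * Fintype.card I * T ^ 2)) ^ K) := by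
  have : SecondCountableTopology (Matrix I I ℂ) :=
    inferInstanceAs (SecondCountableTopology (I → I → ℂ))
  have hn : (0 : ℝ) < Fintype.card I := by exact_mod_cast Fintype.card_pos
  let E := EuclideanSpace ℂ I
  let μ : Measure E := volume
  let B : Set E := Metric.ball 0 (5 / 4)
  let w : ENNReal := μ (Metric.ball 0 (1 / 4))
  let π : Measure (E × E) := (μ.prod μ).restrict (B ×ˢ B)
  let φ : Matrix.unitaryGroup I ℂ → E × E → ENNReal := fun U z =>
    ENNReal.ofReal (reTrace (traceDual e z.1 z.2) U ^ (2 * K))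
  let F : Matrix.unitaryGroup I ℂ → ENNReal := fun U => ∫⁻ z, φ U z ∂π
  let c : ENNReal := ENNReal.ofReal ((3 / 8 * T) ^ (2 * K))
  let D : ℝ := (2 * K * (25 / 16) ^ 2 / Fintype.card I) ^ K
  have hw0 : w ≠ 0 := (Metric.measure_ball_pos μ 0 (by norm_num)).ne'
  have hwt : w ≠ ⊤ := measure_ball_lt_top.ne
  have hfr : Module.finrank ℝ E = 2 * Fintype.card I := by
    rw [finrank_real_of_complex, finrank_euclideanSpace]
  have hB : μ B = ENNReal.ofReal (5 ^ (2 * Fintype.card I)) * w := by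
    have := Measure.addHaar_ball_mul_of_pos μ (0 : E) (r := 5) (by norm_num) (1 / 4)
    rw [hfr] at this
    rw [← this]
    norm_num [B]
  have hcont : Continuous fun p : Matrix.unitaryGroup I ℂ × (E × E) =>
      reTrace (traceDual e p.2.1 p.2.2) p.1 := by
    simp only [reTrace, traceDual, Matrix.trace, Matrix.diag, Matrix.mul_apply, Matrix.of_apply]
    refine Complex.continuous_re.comp (continuous_finsetSum _ fun b _ =>
      continuous_finsetSum _ fun a _ => ?_)
    have : Continuous fun p : Matrix.unitaryGroup I ℂ × (E × E) => (p.1 : Matrix I I ℂ) a b :=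
      (continuous_subtype_val.comp continuous_fst).matrix_elem a b
    have hx : ∀ i, Continuous fun p : Matrix.unitaryGroup I ℂ × (E × E) =>
        (p.2.1 : EuclideanSpace ℂ I) i := fun i =>
      (EuclideanSpace.proj (𝕜 := ℂ) i).continuous.comp (continuous_fst.comp continuous_snd)
    have hy : ∀ i, Continuous fun p : Matrix.unitaryGroup I ℂ × (E × E) =>
        (p.2.2 : EuclideanSpace ℂ I) i := fun i =>
      (EuclideanSpace.proj (𝕜 := ℂ) i).continuous.comp (continuous_snd.comp continuous_snd)
    exact ((hx _).star.mul (hy _)).mul this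
  have hφ : Measurable (Function.uncurry φ) := (hcont.pow _).measurable.ennreal_ofReal
  have hF : Measurable F := hφ.lintegral_prod_right'
  refine ⟨{U | c * (w * w) ≤ F U}, measurableSet_le measurable_const hF, fun U hU => ?_, ?_⟩
  · have hU' : T < opNorm (permEntries e (U : Matrix I I ℂ)) := hU
    obtain ⟨x₀, y₀, hx₀, hy₀, hxy⟩ := exists_ball_re_inner_ge
      (LinearMap.toContinuousLinearMap (Matrix.toEuclideanLin (permEntries e (U : Matrix I I ℂ))))
      (hT.trans hU')
    let Q : Set (E × E) := Metric.ball x₀ (1 / 4) ×ˢ Metric.ball y₀ (1 / 4)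
    have hQ : MeasurableSet Q := measurableSet_ball.prod measurableSet_ball
    have hQB : Q ⊆ B ×ˢ B := Set.prod_mono hx₀ hy₀
    have hπQ : π Q = w * w := by
      rw [Measure.restrict_apply hQ, Set.inter_eq_left.2 hQB, Measure.prod_prod,
        Measure.addHaar_ball_center μ x₀, Measure.addHaar_ball_center μ y₀]
    calc c * (w * w) = ∫⁻ _ in Q, c ∂π := by rw [setLIntegral_const, hπQ]
      _ ≤ ∫⁻ z in Q, φ U z ∂π := by
        refine setLIntegral_mono' hQ fun z hz => ENNReal.ofReal_le_ofReal ?_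
        rw [reTrace_traceDual]
        refine pow_le_pow_left₀ (by positivity) ?_ _
        refine le_trans ?_ (hxy z.1 hz.1 z.2 hz.2)
        exact mul_le_mul_of_nonneg_left hU'.le (by norm_num)
      _ ≤ F U := setLIntegral_le_lintegral _ _
  · have hmarkov := mul_meas_ge_le_lintegral (μ := ν) hF (c * (w * w))
    have hmom : ∀ z ∈ B ×ˢ B, ∫⁻ U, φ U z ∂ν ≤ ENNReal.ofReal D := by
      intro z hz
      have hcz : Continuous fun U : Matrix.unitaryGroup I ℂ =>
          reTrace (traceDual e z.1 z.2) U ^ (2 * K) :=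
        ((continuous_reTrace _).comp continuous_subtype_val).pow _
      rw [← ofReal_integral_eq_lintegral_ofReal (integrable_of_continuous_unitaryGroup ν hcz)
        (Filter.Eventually.of_forall fun U => by
          change 0 ≤ reTrace (traceDual e z.1 z.2) U ^ (2 * K)
          rw [pow_mul]; positivity)]
      refine ENNReal.ofReal_le_ofReal ((moment_reTrace_le ν _ K).trans ?_)
      have hf : frobSq (traceDual e z.1 z.2) ≤ (25 / 16) ^ 2 := by
        have h1 : ‖z.1‖ < 5 / 4 := by simpa [B] using hz.1
        have h2 : ‖z.2‖ < 5 / 4 := by simpa [B] using hz.2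
        rw [frobSq_traceDual]
        calc ‖z.1‖ ^ 2 * ‖z.2‖ ^ 2 ≤ (5 / 4) ^ 2 * (5 / 4) ^ 2 := by gcongr
          _ = (25 / 16) ^ 2 := by norm_num
      have := frobSq_nonneg (traceDual e z.1 z.2)
      simp only [D]
      gcongr
    have hint : ∫⁻ U, F U ∂ν ≤ ENNReal.ofReal (D * 5 ^ (4 * Fintype.card I)) * (w * w) := by
      calc ∫⁻ U, F U ∂ν = ∫⁻ z, ∫⁻ U, φ U z ∂ν ∂π := lintegral_lintegral_swap hφ.aemeasurable
        _ ≤ ∫⁻ _ in B ×ˢ B, ENNReal.ofReal D ∂(μ.prod μ) :=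
          setLIntegral_mono' (measurableSet_ball.prod measurableSet_ball) hmom
        _ = ENNReal.ofReal (D * 5 ^ (4 * Fintype.card I)) * (w * w) := by
          rw [setLIntegral_const, Measure.prod_prod, hB, ENNReal.ofReal_mul (by positivity),
            show 4 * Fintype.card I = 2 * Fintype.card I + 2 * Fintype.card I by ring, pow_add,
            ENNReal.ofReal_mul (by positivity)]
          ring
    have hc0 : c ≠ 0 := (ENNReal.ofReal_pos.2 (by positivity)).ne'
    have hww0 : w * w ≠ 0 := mul_ne_zero hw0 hw0
    have hwwt : w * w ≠ ⊤ := ENNReal.mul_ne_top hwt hwt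
    have hcancel : ν {U | c * (w * w) ≤ F U} * c
        ≤ ENNReal.ofReal (D * 5 ^ (4 * Fintype.card I)) := by
      rw [← ENNReal.mul_le_mul_iff_left hww0 hwwt]
      calc ν {U | c * (w * w) ≤ F U} * c * (w * w)
          = c * (w * w) * ν {U | c * (w * w) ≤ F U} := by ring
        _ ≤ _ := hmarkov.trans hint
    rw [← ENNReal.le_div_iff_mul_le (Or.inl hc0) (Or.inl ENNReal.ofReal_ne_top),
      ← ENNReal.ofReal_div_of_pos (by positivity)] at hcancel
    refine hcancel.trans (ENNReal.ofReal_le_ofReal (le_of_eq ?_))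
    simp only [D]
    rw [pow_mul (3 / 8 * T), mul_div_right_comm, ← div_pow, mul_comm]
    congr 2
    field_simp
    ring

end Tail

theorem tail_constant_le {n : ℕ} (hn : 0 < n) {p : ℝ} (hp : 1 ≤ p) {T : ℝ}
    (hT : T = 48 * Real.exp 1 * Real.sqrt (2 * p)) :
    (5 : ℝ) ^ (4 * n) * (625 * (n * (2 * ⌈p⌉₊) : ℕ) / (18 * n * T ^ 2)) ^ (n * (2 * ⌈p⌉₊))
      ≤ Real.exp (-p) / 2 := by
  set m := ⌈p⌉₊
  have hn' : (0 : ℝ) < n := by exact_mod_cast hn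
  have hm : p ≤ m := Nat.le_ceil p
  have hm1 : (m : ℝ) < p + 1 := Nat.ceil_lt_add_one (by linarith)
  have hm0 : m ≠ 0 := by
    rintro h
    rw [h] at hm
    norm_num at hm
    linarith
  have he : (2.7 : ℝ) < Real.exp 1 := by linarith [Real.exp_one_gt_d9]
  have he' : Real.exp 1 < 3 := by linarith [Real.exp_one_lt_d9]
  have hT2 : 33000 * p ≤ T ^ 2 := by
    rw [hT, mul_pow, mul_pow, Real.sq_sqrt (by linarith)]
    nlinarith [mul_pos (sub_pos.2 he) (sub_pos.2 he)]
  have hTpos : 0 < T ^ 2 := by linarith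
  have hratio : 625 * ((n * (2 * m) : ℕ) : ℝ) / (18 * n * T ^ 2) ≤ 1 / 200 := by
    push_cast
    rw [div_le_div_iff₀ (by positivity) (by norm_num)]
    have : 625 * (2 * (m : ℝ)) * 200 ≤ 18 * T ^ 2 := by linarith
    nlinarith
  have hexp : Real.exp (-p) ≥ (1 / 3) ^ m := by
    have h1 : Real.exp (-(m : ℝ)) ≤ Real.exp (-p) := Real.exp_le_exp.2 (by linarith)
    have h2 : Real.exp (-(m : ℝ)) = (Real.exp (-1)) ^ m := by
      rw [← Real.exp_nat_mul]; ring_nf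
    have h3 : (1 / 3 : ℝ) ≤ Real.exp (-1) := by
      rw [Real.exp_neg, one_div]
      exact inv_anti₀ (Real.exp_pos 1) he'.le
    calc (1 / 3 : ℝ) ^ m ≤ (Real.exp (-1)) ^ m := pow_le_pow_left₀ (by norm_num) h3 m
      _ ≤ Real.exp (-p) := by rw [← h2]; exact h1
  have hsmall : (625 : ℝ) * (1 / 200) ^ (2 * m) ≤ (1 / 3) ^ m / 2 := by
    obtain ⟨k, hk⟩ := Nat.exists_eq_succ_of_ne_zero hm0
    rw [hk, pow_mul, pow_succ _ k, pow_succ _ k]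
    have : ((1 / 200 : ℝ) ^ 2) ^ k ≤ (1 / 3) ^ k := pow_le_pow_left₀ (by norm_num) (by norm_num) k
    have h0 : (0 : ℝ) < (1 / 3) ^ k := by positivity
    nlinarith
  have hhalf : ((1 / 3 : ℝ)) ^ m / 2 ≤ 1 := by
    have := pow_le_one₀ (n := m) (by norm_num : (0 : ℝ) ≤ 1 / 3) (by norm_num)
    linarith
  calc (5 : ℝ) ^ (4 * n) * (625 * (n * (2 * m) : ℕ) / (18 * n * T ^ 2)) ^ (n * (2 * m))
      ≤ 5 ^ (4 * n) * (1 / 200) ^ (n * (2 * m)) := by gcongr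
    _ = (625 * (1 / 200) ^ (2 * m)) ^ n := by
      rw [mul_pow, ← pow_mul, pow_mul 5 4 n, mul_comm n (2 * m)]
      norm_num
    _ ≤ ((1 / 3) ^ m / 2) ^ n := pow_le_pow_left₀ (by positivity) hsmall n
    _ ≤ (1 / 3) ^ m / 2 := pow_le_of_le_one (by positivity) hhalf hn.ne'
    _ ≤ Real.exp (-p) / 2 := by linarith

open scoped Matrix.Norms.L2Operator in
theorem opNorm_unitary {I : Type*} [Fintype I] [DecidableEq I] [Nonempty I]
    (U : Matrix.unitaryGroup I ℂ) : opNorm (U : Matrix I I ℂ) = 1 :=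
  (Matrix.l2_opNorm_def (U : Matrix I I ℂ)).symm.trans (CStarRing.norm_of_mem_unitary U.2)

/-- with Haar probability at least `1 − δ`, a random unitary `u ∈ U(d²)` and its
reshuffling `u^R` and flipped partial transpose `u^Γ` all have operator norm at most
`48·e·√(2 log(1/δ))`. The Haar probability measure on `U(d²)` is axiomatized as a left-invariant
Borel probability measure `ν`. -/
theorem stmt12 (d : ℕ) (hd : 1 ≤ d)
    [MeasurableSpace (Matrix.unitaryGroup (Fin d × Fin d) ℂ)]
    [BorelSpace (Matrix.unitaryGroup (Fin d × Fin d) ℂ)]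
    (ν : Measure (Matrix.unitaryGroup (Fin d × Fin d) ℂ))
    [IsProbabilityMeasure ν] [ν.IsMulLeftInvariant]
    (δ : ℝ) (hδ0 : 0 < δ) (hδ1 : δ ≤ Real.exp (-1)) :
    ENNReal.ofReal (1 - δ) ≤
      ν {U : Matrix.unitaryGroup (Fin d × Fin d) ℂ |
          max (opNorm (U : Matrix (Fin d × Fin d) (Fin d × Fin d) ℂ))
            (max
              -- the reshuffling u^R((s1,s3),(i,s2)) = u((s2,s3),(i,s1))
              (opNorm (Matrix.of fun p q : Fin d × Fin d =>
                (U : Matrix (Fin d × Fin d) (Fin d × Fin d) ℂ) (q.2, p.2) (q.1, p.1)))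
              -- the partial transpose with flip u^Γ((s1,s2),(i,s3)) = u((s2,s3),(i,s1))
              (opNorm (Matrix.of fun p q : Fin d × Fin d =>
                (U : Matrix (Fin d × Fin d) (Fin d × Fin d) ℂ) (p.2, q.2) (q.1, p.1))))
            ≤ 48 * Real.exp 1 * Real.sqrt (2 * Real.log (1/δ))} := by
  have : Nonempty (Fin d) := ⟨⟨0, hd⟩⟩
  set p := Real.log (1 / δ) with hp_def
  have hp : 1 ≤ p := by
    rw [hp_def, one_div, Real.log_inv, le_neg, Real.log_le_iff_le_exp hδ0]
    exact hδ1
  have hδp : Real.exp (-p) = δ := by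
    rw [hp_def, one_div, Real.log_inv, neg_neg, Real.exp_log hδ0]
  set T := 48 * Real.exp 1 * Real.sqrt (2 * p) with hT
  have hT1 : 1 ≤ T := by
    have h1 : 1 ≤ Real.sqrt (2 * p) := Real.one_le_sqrt.2 (by linarith)
    have h2 : 1 ≤ Real.exp 1 := Real.one_le_exp zero_le_one
    nlinarith
  let e₁ : (Fin d × Fin d) × (Fin d × Fin d) ≃ (Fin d × Fin d) × (Fin d × Fin d) :=
    { toFun := fun z => ((z.2.2, z.1.2), (z.2.1, z.1.1))
      invFun := fun z => ((z.2.2, z.1.2), (z.2.1, z.1.1))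
      left_inv := fun _ => rfl
      right_inv := fun _ => rfl }
  let e₂ : (Fin d × Fin d) × (Fin d × Fin d) ≃ (Fin d × Fin d) × (Fin d × Fin d) :=
    { toFun := fun z => ((z.1.2, z.2.2), (z.2.1, z.1.1))
      invFun := fun z => ((z.2.2, z.1.1), (z.2.1, z.1.2))
      left_inv := fun _ => rfl
      right_inv := fun _ => rfl }
  have htail := tail_constant_le (Fintype.card_pos (α := Fin d × Fin d)) hp hT
  obtain ⟨S₁, hS₁, hbad₁, hν₁⟩ := exists_measurableSet_opNorm_gt ν e₁
    (Fintype.card (Fin d × Fin d) * (2 * ⌈p⌉₊)) (T := T) (by linarith)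
  obtain ⟨S₂, hS₂, hbad₂, hν₂⟩ := exists_measurableSet_opNorm_gt ν e₂
    (Fintype.card (Fin d × Fin d) * (2 * ⌈p⌉₊)) (T := T) (by linarith)
  have hν : ν (S₁ ∪ S₂) ≤ ENNReal.ofReal δ := by
    calc ν (S₁ ∪ S₂) ≤ ν S₁ + ν S₂ := measure_union_le _ _
      _ ≤ ENNReal.ofReal (Real.exp (-p) / 2) + ENNReal.ofReal (Real.exp (-p) / 2) :=
        add_le_add (hν₁.trans (ENNReal.ofReal_le_ofReal htail))
          (hν₂.trans (ENNReal.ofReal_le_ofReal htail))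
      _ = ENNReal.ofReal δ := by
        rw [← ENNReal.ofReal_add (by positivity) (by positivity), add_halves, hδp]
  calc ENNReal.ofReal (1 - δ) = 1 - ENNReal.ofReal δ := by
        rw [ENNReal.ofReal_sub _ hδ0.le, ENNReal.ofReal_one]
    _ ≤ 1 - ν (S₁ ∪ S₂) := tsub_le_tsub_left hν 1
    _ = ν (S₁ ∪ S₂)ᶜ := (prob_compl_eq_one_sub (hS₁.union hS₂)).symm
    _ ≤ _ := measure_mono fun U hU => by
      rw [Set.mem_compl_iff, Set.mem_union, not_or] at hU
      exact max_le ((opNorm_unitary U).trans_le hT1)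
        (max_le (not_lt.1 fun h => hU.1 (hbad₁ h)) (not_lt.1 fun h => hU.2 (hbad₂ h)))
end
end

section
/- Let d ≥ 1 and μ ≥ 1. Let u be a Haar-distributed random unitary in U(d²), regarded as a matrix indexed by (Fin d × Fin d) × (Fin d × Fin d), and define the orthonormal vectors |ĩ⟩ = d^{-1/2} ∑_{s1,s2,s3} u((s2,s3),(i,s1)) |s1⟩⊗|s2⟩⊗|s3⟩ ∈ (ℂ^d)^{⊗3} for i ∈ Fin d. Then with Haar probability at least 1 − e^{−μ}, the following holds simultaneously for every density matrix ρ̃ supported in span{|ĩ⟩}: −2 S(ρ̃) ≤ I₃(P1:P2:P3)(ρ̃) ≤ −2 S(ρ̃) + 6·log(48·e·√2) + 3·log μ. -/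
open Matrix MeasureTheory ProbabilityTheory
open scoped ComplexOrder BigOperators

noncomputable section

section Polar
variable {ι : Type*} [Fintype ι] [DecidableEq ι]

theorem Matrix.mul_conjTranspose_eq_one_of_orthonormalBasis
    (b : OrthonormalBasis ι ℂ (EuclideanSpace ℂ ι)) :
    (Matrix.of fun i k => b k i : Matrix ι ι ℂ)ᴴ * (Matrix.of fun i k => b k i) = 1 := by
  ext i j
  have h := orthonormal_iff_ite.mp b.orthonormal i j
  rw [EuclideanSpace.inner_eq_star_dotProduct] at h
  rw [Matrix.mul_apply, Matrix.one_apply, ← h]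
  simp [dotProduct, mul_comm]

theorem Matrix.IsHermitian.eq_mul_diagonal_mul {A : Matrix ι ι ℂ} (hA : A.IsHermitian) :
    A = (hA.eigenvectorUnitary : Matrix ι ι ℂ) *
      Matrix.diagonal (fun k => (hA.eigenvalues k : ℂ)) *
        (hA.eigenvectorUnitary : Matrix ι ι ℂ)ᴴ := by
  conv_lhs => rw [hA.spectral_theorem, Unitary.conjStarAlgAut_apply]
  rfl

/-- Every square matrix `G` has a unitary `w` with `Tr (G w) = ‖G‖₁`; the trace norm is bounded
below through the second and fourth Schatten norms. -/
theorem exists_unitary_trace_mul (G : Matrix ι ι ℂ) :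
    ∃ w ∈ Matrix.unitaryGroup ι ℂ, ∃ r : ℝ, (G * w).trace = r ∧
      ∀ a : ℝ, 0 < a → 3 * a ^ 2 * (Gᴴ * G).trace.re - ((Gᴴ * G) * (Gᴴ * G)).trace.re
        ≤ 2 * a ^ 3 * r := by
  have hP := Matrix.posSemidef_conjTranspose_mul_self G
  have hH := hP.1
  set V : Matrix ι ι ℂ := (hH.eigenvectorUnitary).1 with hV
  set ev := hH.eigenvalues with hev
  have hVV : Vᴴ * V = 1 := Unitary.coe_star_mul_self hH.eigenvectorUnitary
  have hVV' : V * Vᴴ = 1 := Unitary.coe_mul_star_self hH.eigenvectorUnitary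
  have hspec := hH.eq_mul_diagonal_mul
  have hev0 : ∀ k, 0 ≤ ev k := hP.eigenvalues_nonneg
  have hGV : (G * V)ᴴ * (G * V) = Matrix.diagonal (fun k => (ev k : ℂ)) := by
    calc (G * V)ᴴ * (G * V) = Vᴴ * (Gᴴ * G) * V := by
          rw [Matrix.conjTranspose_mul]; simp only [Matrix.mul_assoc]
      _ = (Vᴴ * V) * Matrix.diagonal (fun k => (ev k : ℂ)) * (Vᴴ * V) := by
          rw [hspec]; simp only [Matrix.mul_assoc]; rfl
      _ = _ := by rw [hVV]; simp
  have hGVe : ∀ i j, ∑ x, star ((G * V) x i) * (G * V) x j = if i = j then (ev i : ℂ) else 0 := by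
    intro i j
    have := congrFun (congrFun hGV i) j
    rw [Matrix.mul_apply, Matrix.diagonal_apply] at this
    simpa using! this
  let f : ι → EuclideanSpace ℂ ι := fun k =>
    WithLp.toLp 2 (fun x => ((Real.sqrt (ev k) : ℂ))⁻¹ * (G * V) x k)
  have hf : Orthonormal ℂ ({k | ev k ≠ 0}.domRestrict f) := by
    rw [orthonormal_iff_ite]
    rintro ⟨i, hi⟩ ⟨j, hj⟩
    rw [EuclideanSpace.inner_eq_star_dotProduct]
    have h1 : (f j).ofLp ⬝ᵥ star (f i).ofLp = ((Real.sqrt (ev i) : ℂ))⁻¹ *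
        ((Real.sqrt (ev j) : ℂ))⁻¹ * ∑ x, star ((G * V) x i) * (G * V) x j := by
      simp only [dotProduct, f, Finset.mul_sum, Pi.star_apply, star_mul', star_inv₀]
      refine Finset.sum_congr rfl fun x _ => ?_
      simp only [RCLike.star_def, Complex.conj_ofReal]
      ring
    simp only [Set.domRestrict_apply]
    rw [h1, hGVe]
    by_cases hij : i = j
    · subst hij
      have : (Real.sqrt (ev i) : ℂ) * Real.sqrt (ev i) = ev i := by
        rw [← Complex.ofReal_mul, Real.mul_self_sqrt (hev0 i)]
      have h0 : (Real.sqrt (ev i) : ℂ) ≠ 0 := by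
        intro h
        rw [h] at this
        simp at this
        exact hi (by exact_mod_cast this.symm)
      simp
      rw [← this]
      field_simp
    · simp [hij]
  obtain ⟨b, hb⟩ := hf.exists_orthonormalBasis_extension_of_card_eq finrank_euclideanSpace
  set F : Matrix ι ι ℂ := Matrix.of fun i k => b k i with hF
  have hFF : Fᴴ * F = 1 := Matrix.mul_conjTranspose_eq_one_of_orthonormalBasis b
  have hFF' : F * Fᴴ = 1 := mul_eq_one_comm.mp hFF
  have hGF : G * V = F * Matrix.diagonal (fun k => (Real.sqrt (ev k) : ℂ)) := by
    ext x k
    rw [Matrix.mul_diagonal]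
    by_cases hk : ev k = 0
    · have h2 := hGVe k k
      simp only [hk, Complex.ofReal_zero, if_true] at h2
      have h3 : ∑ x, ‖(G * V) x k‖ ^ 2 = 0 := by
        have : ((∑ x, ‖(G * V) x k‖ ^ 2 : ℝ) : ℂ) = 0 := by
          rw [← h2]; push_cast
          refine Finset.sum_congr rfl fun x _ => ?_
          rw [RCLike.star_def, Complex.conj_mul']
        exact_mod_cast this
      rw [Finset.sum_eq_zero_iff_of_nonneg (fun _ _ => by positivity)] at h3
      have := h3 x (Finset.mem_univ _)
      simp at this
      simp [hk, this]
    · have h0 : (Real.sqrt (ev k) : ℂ) ≠ 0 := by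
        simpa using! (Real.sqrt_ne_zero (hev0 k)).mpr hk
      have := hb k hk
      simp only [hF, Matrix.of_apply, this, f]
      field_simp
  refine ⟨V * Fᴴ, ?_, ∑ k, Real.sqrt (ev k), ?_, ?_⟩
  · rw [Matrix.mem_unitaryGroup_iff, Matrix.star_eq_conjTranspose, Matrix.conjTranspose_mul,
      Matrix.conjTranspose_conjTranspose]
    calc V * Fᴴ * (F * Vᴴ) = V * (Fᴴ * F) * Vᴴ := by simp only [Matrix.mul_assoc]
      _ = 1 := by rw [hFF, Matrix.mul_one, hVV']
  · rw [← Matrix.mul_assoc, hGF, Matrix.trace_mul_comm, ← Matrix.mul_assoc, hFF, Matrix.one_mul,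
      Matrix.trace_diagonal]
    push_cast; rfl
  · intro a ha
    have t1 : (Gᴴ * G).trace.re = ∑ k, ev k := by
      rw [hH.trace_eq_sum_eigenvalues]; simp [hev]
    have t2 : ((Gᴴ * G) * (Gᴴ * G)).trace.re = ∑ k, ev k ^ 2 := by
      have : ((Gᴴ * G) * (Gᴴ * G)).trace = ∑ k, (ev k : ℂ) ^ 2 := by
        rw [hspec]
        calc _ = (V * (Matrix.diagonal (fun k => (ev k : ℂ)) * (Vᴴ * V) *
              Matrix.diagonal (fun k => (ev k : ℂ)) * Vᴴ)).trace := by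
              simp only [Matrix.mul_assoc]; rfl
          _ = _ := by
              rw [Matrix.trace_mul_comm, Matrix.mul_assoc _ Vᴴ, hVV, Matrix.mul_one,
                Matrix.mul_one, Matrix.diagonal_mul_diagonal, Matrix.trace_diagonal]
              simp only [sq]
      rw [this, Complex.re_sum]
      refine Finset.sum_congr rfl fun k _ => ?_
      rw [← Complex.ofReal_pow, Complex.ofReal_re]
    rw [t1, t2, Finset.mul_sum, Finset.mul_sum, ← Finset.sum_sub_distrib]
    refine Finset.sum_le_sum fun k _ => ?_
    set s := Real.sqrt (ev k) with hs
    have hs0 : 0 ≤ s := Real.sqrt_nonneg _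
    have hsk : ev k = s ^ 2 := (Real.sq_sqrt (hev0 k)).symm
    rw [hsk]
    nlinarith [mul_nonneg hs0 (mul_nonneg (sq_nonneg (s - a)) (by positivity : 0 ≤ s + 2 * a))]

end Polar

section Signs
variable {ι : Type*} [Fintype ι]

/-- The complex matrix with entries `±1` given by an array of signs. -/
def signMatrix (s : ι × ι → ℤˣ) : Matrix ι ι ℂ := Matrix.of fun i j => ((s (i, j) : ℤ) : ℂ)

theorem trace_signMatrix_sq (s : ι × ι → ℤˣ) :
    ((signMatrix s)ᴴ * signMatrix s).trace = (Fintype.card ι : ℂ) ^ 2 := by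
  have : ∀ e : ℤˣ, (((e : ℤ) : ℂ)) * ((e : ℤ) : ℂ) = 1 := by
    intro e
    rw [← Int.cast_mul, Int.units_coe_mul_self]; simp
  simp [Matrix.trace, Matrix.mul_apply, signMatrix, this, sq]

variable [DecidableEq ι]

theorem sum_exp_sign_le {κ : Type*} [Fintype κ] [DecidableEq κ] (x : κ → ℝ) :
    ∑ s : κ → ℤˣ, Real.exp (∑ i, ((s i : ℤ) : ℝ) * x i)
      ≤ 2 ^ Fintype.card κ * Real.exp ((∑ i, x i ^ 2) / 2) := by
  have h1 : ∑ s : κ → ℤˣ, Real.exp (∑ i, ((s i : ℤ) : ℝ) * x i)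
      = ∏ i, ∑ e : ℤˣ, Real.exp (((e : ℤ) : ℝ) * x i) := by
    rw [Finset.prod_univ_sum, Fintype.piFinset_univ]
    exact Finset.sum_congr rfl fun s _ => Real.exp_sum _ _
  have h2 : (2 : ℝ) ^ Fintype.card κ * Real.exp ((∑ i, x i ^ 2) / 2)
      = ∏ i, (2 * Real.exp (x i ^ 2 / 2)) := by
    rw [Finset.prod_mul_distrib, Finset.prod_const, Finset.card_univ, Finset.sum_div,
      Real.exp_sum]
  rw [h1, h2]
  refine Finset.prod_le_prod (fun i _ => Finset.sum_nonneg fun _ _ => (Real.exp_pos _).le)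
    fun i _ => ?_
  have h3 := Real.cosh_le_exp_half_sq (x i)
  rw [Real.cosh_eq] at h3
  have h4 : ∑ e : ℤˣ, Real.exp (((e : ℤ) : ℝ) * x i) = Real.exp (x i) + Real.exp (-x i) := by
    rw [UnitsInt.univ]
    simp
  rw [h4]
  linarith

theorem sum_exp_signMatrix_le (Y : Matrix ι ι ℂ) :
    ∑ s : ι × ι → ℤˣ, Real.exp (signMatrix s * Y).trace.re
      ≤ 2 ^ (Fintype.card ι ^ 2) * Real.exp ((∑ i, ∑ j, ‖Y i j‖ ^ 2) / 2) := by
  have h := sum_exp_sign_le (κ := ι × ι) (fun p => (Y p.2 p.1).re)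
  rw [Fintype.card_prod, ← sq] at h
  have h1 : ∀ s : ι × ι → ℤˣ,
      (signMatrix s * Y).trace.re = ∑ p, ((s p : ℤ) : ℝ) * (Y p.2 p.1).re := by
    intro s
    rw [Fintype.sum_prod_type]
    simp [Matrix.trace, Matrix.mul_apply, signMatrix]
  simp only [h1]
  refine h.trans ?_
  gcongr
  rw [Fintype.sum_prod_type, Finset.sum_comm]
  refine Finset.sum_le_sum fun i _ => Finset.sum_le_sum fun j _ => ?_
  exact sq_le_sq' (neg_le_of_abs_le (Complex.abs_re_le_norm _)) (Complex.re_le_norm _)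

theorem sum_sign_prod_eq_zero {i j k l : ι} (hik : i ≠ k) (hjl : j ≠ l) :
    ∑ s : ι × ι → ℤˣ, ((s (i, j) * s (k, j) * s (k, l) * s (i, l) : ℤˣ) : ℤ) = 0 := by
  refine Finset.sum_involution (fun s _ => Function.update s (i, j) (- s (i, j))) ?_ ?_ ?_ ?_
  · intro s _
    have h1 : (k, j) ≠ (i, j) := by simp [hik.symm]
    have h2 : (k, l) ≠ (i, j) := by simp [hik.symm]
    have h3 : (i, l) ≠ (i, j) := by simp [hjl.symm]
    simp [Function.update_of_ne h1, Function.update_of_ne h2, Function.update_of_ne h3]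
  · intro s _ _ h
    exact absurd (congrFun h (i, j)) (by simp)
  · simp
  · intro s _
    simp

theorem sum_trace_signMatrix_pow_four_le :
    ∑ s : ι × ι → ℤˣ, (((signMatrix s)ᴴ * signMatrix s) * ((signMatrix s)ᴴ * signMatrix s)).trace.re
      ≤ 2 ^ (Fintype.card ι ^ 2) * (2 * (Fintype.card ι : ℝ) ^ 3) := by
  have h1 : ∀ s : ι × ι → ℤˣ,
      (((signMatrix s)ᴴ * signMatrix s) * ((signMatrix s)ᴴ * signMatrix s)).trace.re
        = ∑ j, ∑ l, ∑ i, ∑ k, (((s (i, j) * s (k, j) * s (k, l) * s (i, l) : ℤˣ) : ℤ) : ℝ) := by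
    intro s
    simp only [Matrix.trace, Matrix.diag, Matrix.mul_apply (M := (signMatrix s)ᴴ * signMatrix s),
      Complex.re_sum]
    refine Finset.sum_congr rfl fun j _ => Finset.sum_congr rfl fun l _ => ?_
    rw [Matrix.mul_apply, Matrix.mul_apply, Finset.sum_mul_sum, Complex.re_sum]
    refine Finset.sum_congr rfl fun i _ => ?_
    rw [Complex.re_sum]
    refine Finset.sum_congr rfl fun k _ => ?_
    simp only [signMatrix, Matrix.conjTranspose_apply, Matrix.of_apply, star_intCast,
      ← Int.cast_mul, Complex.intCast_re]
    push_cast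
    ring
  simp only [h1]
  have h2 : ∀ i j k l : ι,
      ∑ s : ι × ι → ℤˣ, (((s (i, j) * s (k, j) * s (k, l) * s (i, l) : ℤˣ) : ℤ) : ℝ)
        ≤ 2 ^ (Fintype.card ι ^ 2) * ((if i = k then 1 else 0) + (if j = l then 1 else 0)) := by
    intro i j k l
    by_cases hc : i = k ∨ j = l
    · have hb : ∀ e : ℤˣ, ((e : ℤ) : ℝ) ≤ 1 := by
        intro e
        rcases Int.units_eq_one_or e with rfl | rfl <;> simp
      calc _ ≤ ∑ s : ι × ι → ℤˣ, (1 : ℝ) := Finset.sum_le_sum fun s _ => hb _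
        _ = 2 ^ (Fintype.card ι ^ 2) * 1 := by
          simp [Finset.card_univ, Fintype.card_units_int, sq]
        _ ≤ _ := by
          gcongr
          rcases hc with h | h
          · rw [if_pos h]; split_ifs <;> norm_num
          · rw [if_pos h]; split_ifs <;> norm_num
    · push Not at hc
      rw [← Int.cast_sum, sum_sign_prod_eq_zero hc.1 hc.2]
      simp [hc.1, hc.2]
  calc _ = ∑ j, ∑ l, ∑ i, ∑ k, ∑ s : ι × ι → ℤˣ,
        (((s (i, j) * s (k, j) * s (k, l) * s (i, l) : ℤˣ) : ℤ) : ℝ) := by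
        rw [Finset.sum_comm]
        refine Finset.sum_congr rfl fun j _ => ?_
        rw [Finset.sum_comm]
        refine Finset.sum_congr rfl fun l _ => ?_
        rw [Finset.sum_comm]
        refine Finset.sum_congr rfl fun i _ => ?_
        rw [Finset.sum_comm]
    _ ≤ ∑ j : ι, ∑ l : ι, ∑ i : ι, ∑ k : ι, (2 : ℝ) ^ (Fintype.card ι ^ 2) *
          ((if i = k then 1 else 0) + (if j = l then 1 else 0)) := by
        gcongr with j _ l _ i _ k _
        exact h2 i j k l
    _ = _ := by
        simp only [← Finset.mul_sum, Finset.sum_add_distrib]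
        simp
        ring
end Signs

section SignedPerm
variable {ι : Type*} [Fintype ι] [DecidableEq ι]

/-- The signed permutation matrix with signs `e` and permutation `π`. -/
def signedPerm (e : ι → ℤˣ) (π : Equiv.Perm ι) : Matrix ι ι ℂ :=
  Matrix.of fun i j => if j = π i then ((e i : ℤ) : ℂ) else 0

theorem signedPerm_mul_mul_conjTranspose_apply (e : ι → ℤˣ) (π : Equiv.Perm ι)
    (P : Matrix ι ι ℂ) (i j : ι) :
    (signedPerm e π * P * (signedPerm e π)ᴴ) i j
      = (((e i * e j : ℤˣ) : ℤ) : ℂ) * P (π i) (π j) := by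
  simp [Matrix.mul_apply, signedPerm, apply_ite (star : ℂ → ℂ)]
  ring

theorem signedPerm_mem_unitaryGroup (e : ι → ℤˣ) (π : Equiv.Perm ι) :
    signedPerm e π ∈ Matrix.unitaryGroup ι ℂ := by
  rw [Matrix.mem_unitaryGroup_iff, Matrix.star_eq_conjTranspose]
  ext i j
  have := signedPerm_mul_mul_conjTranspose_apply e π 1 i j
  rw [Matrix.mul_one] at this
  rw [this, Matrix.one_apply, Matrix.one_apply]
  by_cases h : i = j
  · subst h; simp
  · simp [h]

theorem sum_sign_mul_sign (i j : ι) :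
    ∑ e : ι → ℤˣ, ((e i * e j : ℤˣ) : ℤ) = if i = j then 2 ^ Fintype.card ι else 0 := by
  split_ifs with h
  · subst h
    simp [Finset.card_univ, Fintype.card_units_int]
  · refine Finset.sum_involution (fun e _ => Function.update e i (- e i)) ?_ ?_ ?_ ?_
    · intro e _
      simp [Function.update_of_ne (Ne.symm h)]
    · intro e _ _ h'
      exact absurd (congrFun h' i) (by simp)
    · simp
    · simp

theorem card_mul_sum_perm (f : ι → ℂ) (i : ι) :
    (Fintype.card ι : ℂ) * ∑ π : Equiv.Perm ι, f (π i) = (Fintype.card ι).factorial * ∑ j, f j := by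
  have h : ∀ j, ∑ π : Equiv.Perm ι, f (π i) = ∑ π : Equiv.Perm ι, f (π j) := by
    intro j
    refine Fintype.sum_equiv (Equiv.mulRight (Equiv.swap i j)) _ _ fun π => ?_
    simp
  calc _ = ∑ j : ι, ∑ π : Equiv.Perm ι, f (π j) := by
        rw [← Finset.sum_congr rfl fun j _ => h j]; simp
    _ = ∑ π : Equiv.Perm ι, ∑ j, f j := by
        rw [Finset.sum_comm]
        exact Finset.sum_congr rfl fun π _ => Equiv.sum_comp π f
    _ = _ := by simp [Finset.card_univ, Fintype.card_perm]

/-- Averaging over the signed permutations is the completely depolarizing map. -/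
theorem card_smul_sum_signedPerm (P : Matrix ι ι ℂ) :
    (Fintype.card ι : ℂ) • ∑ e : ι → ℤˣ, ∑ π : Equiv.Perm ι,
        signedPerm e π * P * (signedPerm e π)ᴴ
      = ((2 : ℂ) ^ Fintype.card ι * (Fintype.card ι).factorial * P.trace) • 1 := by
  ext i j
  simp only [Matrix.smul_apply, Matrix.sum_apply, signedPerm_mul_mul_conjTranspose_apply,
    ← Finset.mul_sum, ← Finset.sum_mul, smul_eq_mul]
  rw [← Int.cast_sum, sum_sign_mul_sign, Matrix.one_apply]
  split_ifs with h
  · subst h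
    have := card_mul_sum_perm (fun k => P k k) i
    rw [mul_left_comm, this, Matrix.trace]
    push_cast
    simp only [Matrix.diag]
    ring
  · simp
end SignedPerm

section Haar
variable {ι : Type*} [Fintype ι]

theorem sum_norm_sq_eq_trace {κ : Type*} [Fintype κ] (X : Matrix ι κ ℂ) :
    ((∑ i, ∑ j, ‖X i j‖ ^ 2 : ℝ) : ℂ) = (X * Xᴴ).trace := by
  simp [Matrix.trace, Matrix.mul_apply, Complex.mul_conj']

variable [DecidableEq ι]

theorem sum_norm_sq_mul_mul {κ : Type*} [Fintype κ] [DecidableEq κ] {U : Matrix ι ι ℂ}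
    {V : Matrix κ κ ℂ} (hU : Uᴴ * U = 1) (hV : V * Vᴴ = 1) (X : Matrix ι κ ℂ) :
    ∑ i, ∑ j, ‖(U * X * V) i j‖ ^ 2 = ∑ i, ∑ j, ‖X i j‖ ^ 2 := by
  apply Complex.ofReal_injective
  rw [sum_norm_sq_eq_trace, sum_norm_sq_eq_trace]
  calc _ = (U * (X * (V * Vᴴ) * Xᴴ * Uᴴ)).trace := by
        simp only [Matrix.conjTranspose_mul, Matrix.mul_assoc]
    _ = _ := by
        rw [Matrix.trace_mul_comm, hV, Matrix.mul_one, Matrix.mul_assoc, hU, Matrix.mul_one]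

theorem sum_norm_sq_unitary_mul_mul {U V : Matrix ι ι ℂ} (hU : U ∈ Matrix.unitaryGroup ι ℂ)
    (hV : V ∈ Matrix.unitaryGroup ι ℂ) (X : Matrix ι ι ℂ) :
    ∑ i, ∑ j, ‖(U * X * V) i j‖ ^ 2 = ∑ i, ∑ j, ‖X i j‖ ^ 2 :=
  sum_norm_sq_mul_mul (Matrix.mem_unitaryGroup_iff'.mp hU) (Matrix.mem_unitaryGroup_iff.mp hV) X

theorem abs_re_trace_unitary_mul_le (U : Matrix.unitaryGroup ι ℂ) (X : Matrix ι ι ℂ) :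
    |((U : Matrix ι ι ℂ) * X).trace.re| ≤ ∑ i, ∑ j, ‖X j i‖ := by
  refine (Complex.abs_re_le_norm _).trans ?_
  simp only [Matrix.trace, Matrix.diag, Matrix.mul_apply]
  refine (norm_sum_le _ _).trans (Finset.sum_le_sum fun i _ => (norm_sum_le _ _).trans
    (Finset.sum_le_sum fun j _ => ?_))
  rw [norm_mul]
  exact mul_le_of_le_one_left (norm_nonneg _) (entry_norm_bound_of_unitary U.2 i j)

variable [MeasurableSpace (Matrix.unitaryGroup ι ℂ)] [BorelSpace (Matrix.unitaryGroup ι ℂ)]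
  (ν : Measure (Matrix.unitaryGroup ι ℂ))

theorem integral_exp_re_trace_unitary_mul [ν.IsMulLeftInvariant]
    (W : Matrix.unitaryGroup ι ℂ) (X : Matrix ι ι ℂ) :
    ∫ U, Real.exp ((U : Matrix ι ι ℂ) * (X * (W : Matrix ι ι ℂ))).trace.re ∂ν
      = ∫ U, Real.exp ((U : Matrix ι ι ℂ) * X).trace.re ∂ν := by
  rw [← integral_mul_left_eq_self (μ := ν) (fun U => Real.exp ((U : Matrix ι ι ℂ) * X).trace.re) W]
  congr 1
  ext U
  rw [← Matrix.mul_assoc, Matrix.trace_mul_comm, ← Matrix.mul_assoc]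
  rfl

variable [IsProbabilityMeasure ν]

theorem integrable_exp_re_trace (X : Matrix ι ι ℂ) :
    Integrable (fun U : Matrix.unitaryGroup ι ℂ => Real.exp ((U : Matrix ι ι ℂ) * X).trace.re) ν := by
  refine Integrable.of_bound (C := Real.exp (∑ i, ∑ j, ‖X j i‖)) ?_ ?_
  · apply Continuous.aestronglyMeasurable
    have : Continuous fun U : Matrix.unitaryGroup ι ℂ => (U : Matrix ι ι ℂ) := continuous_subtype_val
    fun_prop
  · refine Filter.Eventually.of_forall fun U => ?_
    rw [Real.norm_eq_abs, Real.abs_exp]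
    exact Real.exp_le_exp.mpr ((le_abs_self _).trans (abs_re_trace_unitary_mul_le U X))

/-- Subgaussian moment generating function of linear functionals of a Haar unitary. -/
theorem integral_exp_re_trace_le [ν.IsMulLeftInvariant] [Nonempty ι]
    (X : Matrix ι ι ℂ) :
    ∫ U, Real.exp ((U : Matrix ι ι ℂ) * X).trace.re ∂ν
      ≤ Real.exp ((∑ i, ∑ j, ‖X i j‖ ^ 2) / Fintype.card ι) := by
  choose w hw r hr hbound using fun s : ι × ι → ℤˣ => exists_unitary_trace_mul (signMatrix s)
  set n : ℝ := (Fintype.card ι : ℝ) with hn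
  have hn0 : 0 < n := by simp [hn, Fintype.card_pos]
  set c : ℝ := (∑ s, r s) / (2 ^ (Fintype.card ι ^ 2) * n) with hc
  have hcpos : 0 < c ∧ n / 2 ≤ c ^ 2 := by
    set a := Real.sqrt (2 * n) with ha
    have ha0 : 0 < a := Real.sqrt_pos.mpr (by linarith)
    have ha2 : a ^ 2 = 2 * n := Real.sq_sqrt (by linarith)
    have h1 := Finset.sum_le_sum fun s (_ : s ∈ Finset.univ) => hbound s a ha0
    simp only [trace_signMatrix_sq] at h1
    rw [Finset.sum_sub_distrib, ← Finset.mul_sum, ← Finset.mul_sum] at h1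
    have h2 := sum_trace_signMatrix_pow_four_le (ι := ι)
    have h3 : ((Fintype.card ι : ℂ) ^ 2).re = n ^ 2 := by
      rw [hn]; norm_cast
    rw [h3] at h1
    simp only [Finset.sum_const, Finset.card_univ, Fintype.card_fun, Fintype.card_units_int,
      Fintype.card_prod, nsmul_eq_mul, ← sq (Fintype.card ι)] at h1
    push_cast at h1
    have h4 : ∑ s, r s = c * (2 ^ (Fintype.card ι ^ 2) * n) := by
      rw [hc]; field_simp
    rw [h4] at h1
    have hp : (0 : ℝ) < 2 ^ (Fintype.card ι ^ 2) := by positivity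
    rw [← hn] at h2
    have h5 : 3 * a ^ 2 * n ^ 2 - 2 * n ^ 3 ≤ 2 * a ^ 3 * (c * n) := by
      refine le_of_mul_le_mul_left ?_ hp
      linarith
    have h6 : n ≤ a * c := by
      have : 4 * n ^ 3 ≤ 4 * n ^ 2 * (a * c) := by
        have e : a ^ 3 = a * (2 * n) := by rw [← ha2]; ring
        rw [ha2, e] at h5
        linarith
      have h7 : 0 < 4 * n ^ 2 := by positivity
      refine le_of_mul_le_mul_left ?_ h7
      linarith
    have hc0 : 0 < c := by
      by_contra! h
      nlinarith
    refine ⟨hc0, ?_⟩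
    have : n ^ 2 ≤ (a * c) ^ 2 := by gcongr
    rw [mul_pow, ha2] at this
    have : n * n ≤ n * (2 * c ^ 2) := by linarith
    have := le_of_mul_le_mul_left this hn0
    linarith
  have key : ∀ Y : Matrix ι ι ℂ, ∫ U, Real.exp ((U : Matrix ι ι ℂ) * ((c : ℂ) • Y)).trace.re ∂ν
      ≤ Real.exp ((∑ i, ∑ j, ‖Y i j‖ ^ 2) / 2) := by
    intro Y
    let v : (ι → ℤˣ) × Equiv.Perm ι → Matrix.unitaryGroup ι ℂ :=
      fun p => ⟨signedPerm p.1 p.2, signedPerm_mem_unitaryGroup p.1 p.2⟩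
    let W : (ι × ι → ℤˣ) → Matrix.unitaryGroup ι ℂ := fun s => ⟨w s, hw s⟩
    set M : ℝ := 2 ^ Fintype.card ι * (Fintype.card ι).factorial with hM
    have hM0 : 0 < M := by positivity
    have hcardv : (Fintype.card ((ι → ℤˣ) × Equiv.Perm ι) : ℝ) = M := by
      simp [Fintype.card_units_int, Fintype.card_perm, hM]
    have hsum : ∑ s, ∑ p, (v p : Matrix ι ι ℂ) * (signMatrix s * w s) * (v p : Matrix ι ι ℂ)ᴴ
        = ((2 ^ (Fintype.card ι ^ 2) * M * c : ℝ) : ℂ) • (1 : Matrix ι ι ℂ) := by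
      have h1 : ∀ s, ∑ p, (v p : Matrix ι ι ℂ) * (signMatrix s * w s) * (v p : Matrix ι ι ℂ)ᴴ
          = ((M * r s / n : ℝ) : ℂ) • (1 : Matrix ι ι ℂ) := by
        intro s
        have h2 := card_smul_sum_signedPerm (signMatrix s * w s)
        rw [hr s] at h2
        rw [Fintype.sum_prod_type]
        have hnC : (Fintype.card ι : ℂ) ≠ 0 := by
          simp [Fintype.card_ne_zero]
        rw [← inv_smul_smul₀ hnC (∑ x, ∑ y, _), h2, smul_smul]
        congr 1
        rw [hM, hn]; push_cast; field_simp
      simp only [h1]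
      rw [← Finset.sum_smul, ← Complex.ofReal_sum]
      congr 2
      rw [← Finset.sum_div, ← Finset.mul_sum, hc]
      field_simp
    have hpt : ∀ U : Matrix.unitaryGroup ι ℂ,
        2 ^ (Fintype.card ι ^ 2) * M * Real.exp ((U : Matrix ι ι ℂ) * ((c : ℂ) • Y)).trace.re
          ≤ ∑ s, ∑ p, Real.exp ((U : Matrix ι ι ℂ) *
            (Y * (v p * (signMatrix s * w s) * (v p : Matrix ι ι ℂ)ᴴ))).trace.re := by
      intro U
      set m := ((U : Matrix ι ι ℂ) * ((c : ℂ) • Y)).trace.re with hm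
      set y : (ι × ι → ℤˣ) → (ι → ℤˣ) × Equiv.Perm ι → ℝ := fun s p => ((U : Matrix ι ι ℂ) *
            (Y * (v p * (signMatrix s * w s) * (v p : Matrix ι ι ℂ)ᴴ))).trace.re with hy
      have hys : ∑ s, ∑ p, y s p = 2 ^ (Fintype.card ι ^ 2) * M * m := by
        simp only [hy]
        simp_rw [← Complex.re_sum, ← Matrix.trace_sum, ← Matrix.mul_sum]
        rw [hsum, hm]
        simp only [Matrix.mul_smul, Matrix.mul_one, Matrix.trace_smul, smul_eq_mul,
          Complex.re_ofReal_mul]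
        ring
      have hcount : ∑ s : ι × ι → ℤˣ, ∑ p : (ι → ℤˣ) × Equiv.Perm ι, (1 : ℝ)
          = 2 ^ (Fintype.card ι ^ 2) * M := by
        simp only [Finset.sum_const, Finset.card_univ, nsmul_eq_mul, hcardv]
        simp [Fintype.card_units_int, sq]
      calc _ = ∑ s, ∑ p, Real.exp m * (1 + (y s p - m)) := by
            simp only [← Finset.mul_sum, Finset.sum_add_distrib, Finset.sum_sub_distrib, hys, hcount]
            have : ∑ s : ι × ι → ℤˣ, ∑ p : (ι → ℤˣ) × Equiv.Perm ι, m
                = 2 ^ (Fintype.card ι ^ 2) * M * m := by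
              rw [← hcount]; simp only [Finset.sum_mul, one_mul]
            rw [this]; ring
        _ ≤ _ := by
            gcongr with s _ p _
            have := Real.add_one_le_exp (y s p - m)
            calc Real.exp m * (1 + (y s p - m)) ≤ Real.exp m * Real.exp (y s p - m) := by
                  gcongr; linarith
              _ = _ := by rw [← Real.exp_add]; congr 1; ring
    have hint := integral_mono ((integrable_exp_re_trace ν ((c : ℂ) • Y)).const_mul _)
      (integrable_finsetSum _ fun s _ => integrable_finsetSum _ fun p _ =>
        integrable_exp_re_trace ν _) hpt
    rw [integral_const_mul, integral_finsetSum _ fun s _ => integrable_finsetSum _ fun p _ =>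
        integrable_exp_re_trace ν _] at hint
    have hswap : ∀ s p, ∫ U, Real.exp ((U : Matrix ι ι ℂ) *
            (Y * (v p * (signMatrix s * w s) * (v p : Matrix ι ι ℂ)ᴴ))).trace.re ∂ν
          = ∫ U, Real.exp ((U : Matrix ι ι ℂ) * (Y * v p * signMatrix s)).trace.re ∂ν := by
      intro s p
      rw [← integral_exp_re_trace_unitary_mul ν (W s * star (v p)) (Y * v p * signMatrix s)]
      congr! 5 with U
      simp only [Matrix.mul_assoc]
      rfl
    have hcyc : ∀ (U : Matrix.unitaryGroup ι ℂ) s p,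
        (signMatrix s * ((U : Matrix ι ι ℂ) * Y * (v p : Matrix ι ι ℂ))).trace
          = ((U : Matrix ι ι ℂ) * (Y * v p * signMatrix s)).trace := by
      intro U s p
      rw [Matrix.trace_mul_comm (signMatrix s)]
      simp only [Matrix.mul_assoc]
    have hfin : ∑ s, ∑ p, ∫ U, Real.exp ((U : Matrix ι ι ℂ) *
            (Y * (v p * (signMatrix s * w s) * (v p : Matrix ι ι ℂ)ᴴ))).trace.re ∂ν
          ≤ 2 ^ (Fintype.card ι ^ 2) * M * Real.exp ((∑ i, ∑ j, ‖Y i j‖ ^ 2) / 2) := by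
      simp only [hswap]
      rw [Finset.sum_comm]
      calc _ = ∑ p, ∫ U, ∑ s,
              Real.exp (signMatrix s * ((U : Matrix ι ι ℂ) * Y * (v p : Matrix ι ι ℂ))).trace.re ∂ν := by
            refine Finset.sum_congr rfl fun p _ => ?_
            rw [← integral_finsetSum _ fun s _ => integrable_exp_re_trace ν _]
            simp only [hcyc]
        _ ≤ ∑ p : (ι → ℤˣ) × Equiv.Perm ι,
              2 ^ (Fintype.card ι ^ 2) * Real.exp ((∑ i, ∑ j, ‖Y i j‖ ^ 2) / 2) := by
            refine Finset.sum_le_sum fun p _ => ?_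
            have hb : ∀ U : Matrix.unitaryGroup ι ℂ,
                ∑ s, Real.exp
                  (signMatrix s * ((U : Matrix ι ι ℂ) * Y * (v p : Matrix ι ι ℂ))).trace.re
                  ≤ 2 ^ (Fintype.card ι ^ 2) * Real.exp ((∑ i, ∑ j, ‖Y i j‖ ^ 2) / 2) := by
              intro U
              have := sum_exp_signMatrix_le ((U : Matrix ι ι ℂ) * Y * (v p : Matrix ι ι ℂ))
              rwa [sum_norm_sq_unitary_mul_mul U.2 (v p).2] at this
            have hi : Integrable (fun U : Matrix.unitaryGroup ι ℂ =>
                ∑ s, Real.exp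
                  (signMatrix s * ((U : Matrix ι ι ℂ) * Y * (v p : Matrix ι ι ℂ))).trace.re) ν := by
              refine integrable_finsetSum _ fun s _ => ?_
              simp only [hcyc]
              exact integrable_exp_re_trace ν _
            exact (integral_mono hi (integrable_const _) hb).trans_eq (by simp)
        _ = _ := by
            simp only [Finset.sum_const, Finset.card_univ, nsmul_eq_mul, hcardv]
            ring
    have hsplit : ∀ s, ∫ U, ∑ p, Real.exp ((U : Matrix ι ι ℂ) *
            (Y * (v p * (signMatrix s * w s) * (v p : Matrix ι ι ℂ)ᴴ))).trace.re ∂ν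
        = ∑ p, ∫ U, Real.exp ((U : Matrix ι ι ℂ) *
            (Y * (v p * (signMatrix s * w s) * (v p : Matrix ι ι ℂ)ᴴ))).trace.re ∂ν :=
      fun s => integral_finsetSum _ fun p _ => integrable_exp_re_trace ν _
    simp only [hsplit] at hint
    exact le_of_mul_le_mul_left (hint.trans hfin) (by positivity)
  have hc0 := hcpos.1
  have h := key ((c : ℂ)⁻¹ • X)
  rw [smul_smul, mul_inv_cancel₀ (by exact_mod_cast hc0.ne'), one_smul] at h
  refine h.trans (Real.exp_le_exp.mpr ?_)
  have h1 : ∑ i, ∑ j, ‖((c : ℂ)⁻¹ • X) i j‖ ^ 2 = (∑ i, ∑ j, ‖X i j‖ ^ 2) / c ^ 2 := by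
    simp only [Matrix.smul_apply, smul_eq_mul, norm_mul, mul_pow, ← Finset.mul_sum, norm_inv,
      Complex.norm_real, Real.norm_eq_abs, inv_pow, sq_abs]
    rw [div_eq_inv_mul]
  rw [h1, div_div]
  gcongr
  linarith [hcpos.2]
end Haar

section Net

theorem exists_half_net (E : Type*) [NormedAddCommGroup E] [NormedSpace ℝ E]
    [FiniteDimensional ℝ E] :
    ∃ N : Finset E, N.card ≤ 5 ^ Module.finrank ℝ E ∧ (∀ c ∈ N, ‖c‖ ≤ 1) ∧
      ∀ x : E, ‖x‖ = 1 → ∃ c ∈ N, ‖x - c‖ ≤ 1 / 2 := by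
  classical
  let P : Finset E → Prop := fun s =>
    (∀ c ∈ s, ‖c‖ ≤ 2) ∧ ∀ c ∈ s, ∀ d ∈ s, c ≠ d → 1 ≤ ‖c - d‖
  let A : Set ℕ := {k | ∃ s, P s ∧ s.card = k}
  have hA : A.Nonempty := ⟨0, ∅, by simp [P], by simp⟩
  have hbdd : BddAbove A := ⟨5 ^ Module.finrank ℝ E, by
    rintro k ⟨s, hs, rfl⟩
    exact Besicovitch.card_le_of_separated s hs.1 hs.2⟩
  obtain ⟨s, hs, hcard⟩ := Nat.sSup_mem hA hbdd
  refine ⟨s.image (fun c => (1 / 2 : ℝ) • c),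
    Finset.card_image_le.trans (Besicovitch.card_le_of_separated s hs.1 hs.2), ?_, ?_⟩
  · intro c hc
    obtain ⟨c', hc', rfl⟩ := Finset.mem_image.mp hc
    rw [norm_smul]
    have := hs.1 c' hc'
    norm_num
    linarith
  · intro x hx
    have hx2 : ‖(2 : ℝ) • x‖ = 2 := by rw [norm_smul, hx]; norm_num
    have : ∃ c ∈ s, ‖(2 : ℝ) • x - c‖ ≤ 1 := by
      by_contra! hcon
      have hmem : (2 : ℝ) • x ∉ s := fun h => by
        have := hcon _ h
        norm_num at this
      have hP : P (insert ((2 : ℝ) • x) s) := by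
        refine ⟨?_, ?_⟩
        · intro c hc
          rcases Finset.mem_insert.mp hc with rfl | hc
          · exact hx2.le
          · exact hs.1 c hc
        · intro c hc d hd hne
          rcases Finset.mem_insert.mp hc with rfl | hc
          · rcases Finset.mem_insert.mp hd with rfl | hd
            · exact absurd rfl hne
            · exact (hcon d hd).le
          · rcases Finset.mem_insert.mp hd with rfl | hd
            · rw [norm_sub_rev]; exact (hcon c hc).le
            · exact hs.2 c hc d hd hne
      have := le_csSup hbdd ⟨_, hP, rfl⟩
      rw [Finset.card_insert_of_notMem hmem, hcard] at this
      omega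
    obtain ⟨c, hc, hxc⟩ := this
    refine ⟨(1 / 2 : ℝ) • c, Finset.mem_image_of_mem _ hc, ?_⟩
    have h : x - (1 / 2 : ℝ) • c = (1 / 2 : ℝ) • ((2 : ℝ) • x - c) := by
      rw [smul_sub, smul_smul]; norm_num
    rw [h, norm_smul]
    norm_num
    linarith

theorem norm_le_of_net {E : Type*} [NormedAddCommGroup E] [InnerProductSpace ℂ E]
    {N : Finset E} (hN : ∀ x : E, ‖x‖ = 1 → ∃ c ∈ N, ‖x - c‖ ≤ 1 / 2) (T : E →L[ℂ] E) {s : ℝ}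
    (hs : 0 ≤ s) (h : ∀ a ∈ N, ∀ b ∈ N, (inner ℂ a (T b)).re ≤ s) : ‖T‖ ≤ 4 * s := by
  have h1 : ∀ b ∈ N, ‖T b‖ ≤ 2 * s := by
    intro b hb
    by_cases h0 : ‖T b‖ = 0
    · rw [h0]; positivity
    · obtain ⟨c, hc, hxc⟩ := hN (((‖T b‖⁻¹ : ℝ) : ℂ) • T b) (by
        rw [norm_smul, Complex.norm_real, norm_inv, norm_norm, inv_mul_cancel₀ h0])
      set u := ((‖T b‖⁻¹ : ℝ) : ℂ) • T b with hu
      have e1 : (inner ℂ u (T b)).re = ‖T b‖ := by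
        rw [hu, inner_smul_left, Complex.conj_ofReal, Complex.re_ofReal_mul]
        have : (inner ℂ (T b) (T b)).re = ‖T b‖ ^ 2 := inner_self_eq_norm_sq (𝕜 := ℂ) (T b)
        rw [this]
        field_simp
      have e2 : (inner ℂ u (T b)).re = (inner ℂ (u - c) (T b)).re + (inner ℂ c (T b)).re := by
        rw [← Complex.add_re, ← inner_add_left, sub_add_cancel]
      have e3 : (inner ℂ (u - c) (T b)).re ≤ ‖u - c‖ * ‖T b‖ :=
        (Complex.re_le_norm _).trans (norm_inner_le_norm _ _)
      have e4 := h c hc b hb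
      have e5 : ‖u - c‖ * ‖T b‖ ≤ 1 / 2 * ‖T b‖ := by gcongr
      linarith
  have h2 : ‖T‖ ≤ 2 * s + ‖T‖ / 2 := by
    refine ContinuousLinearMap.opNorm_le_of_unit_norm (by positivity) fun x hx => ?_
    obtain ⟨c, hc, hxc⟩ := hN x hx
    calc ‖T x‖ = ‖T c + T (x - c)‖ := by rw [← map_add, add_sub_cancel]
      _ ≤ ‖T c‖ + ‖T (x - c)‖ := norm_add_le _ _
      _ ≤ 2 * s + ‖T‖ * (1 / 2) :=
        add_le_add (h1 c hc) ((T.le_opNorm _).trans (by gcongr))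
      _ = _ := by ring
  linarith

end Net

section Tail
variable {ι : Type*} [Fintype ι] [DecidableEq ι]
  [MeasurableSpace (Matrix.unitaryGroup ι ℂ)] [BorelSpace (Matrix.unitaryGroup ι ℂ)]
  (ν : Measure (Matrix.unitaryGroup ι ℂ)) [IsProbabilityMeasure ν] [ν.IsMulLeftInvariant]
  [Nonempty ι]

theorem measureReal_re_trace_ge_le (X : Matrix ι ι ℂ) (hX : ∑ i, ∑ j, ‖X i j‖ ^ 2 ≤ 1) {s : ℝ}
    (hs : 0 ≤ s) :
    ν.real {U | s ≤ ((U : Matrix ι ι ℂ) * X).trace.re}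
      ≤ Real.exp (-(Fintype.card ι * s ^ 2 / 4)) := by
  set n : ℝ := (Fintype.card ι : ℝ) with hn
  have hn0 : 0 < n := by simp [hn, Fintype.card_pos]
  set t : ℝ := n * s / 2 with ht
  have e : ∀ U : Matrix.unitaryGroup ι ℂ, t * ((U : Matrix ι ι ℂ) * X).trace.re
      = ((U : Matrix ι ι ℂ) * ((t : ℂ) • X)).trace.re := by
    intro U
    rw [Matrix.mul_smul, Matrix.trace_smul, smul_eq_mul, Complex.re_ofReal_mul]
  have h := measure_ge_le_exp_mul_mgf (μ := ν) (t := t)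
    (X := fun U : Matrix.unitaryGroup ι ℂ => ((U : Matrix ι ι ℂ) * X).trace.re) s (by positivity) (by
      simp only [e]; exact integrable_exp_re_trace ν _)
  refine h.trans ?_
  have hm : mgf (fun U : Matrix.unitaryGroup ι ℂ => ((U : Matrix ι ι ℂ) * X).trace.re) ν t
      ≤ Real.exp (t ^ 2 / n) := by
    rw [mgf]
    simp only [e]
    refine (integral_exp_re_trace_le ν _).trans (Real.exp_le_exp.mpr ?_)
    gcongr
    simp only [Matrix.smul_apply, smul_eq_mul, norm_mul, mul_pow, ← Finset.mul_sum,
      Complex.norm_real, Real.norm_eq_abs, sq_abs]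
    exact mul_le_of_le_one_right (sq_nonneg _) hX
  calc _ ≤ Real.exp (-t * s) * Real.exp (t ^ 2 / n) := by gcongr
    _ = _ := by
      rw [← Real.exp_add, ht]
      congr 1
      field_simp
      ring

/-- The matrix obtained from `U` by permuting its entries. -/
def permuteEntries (g : ι × ι ≃ ι × ι) (U : Matrix ι ι ℂ) : Matrix ι ι ℂ :=
  Matrix.of fun p q => U (g (p, q)).1 (g (p, q)).2

/-- An entrywise rearrangement of a Haar unitary has bounded operator norm with high
probability. -/
theorem measureReal_permuteEntries_le (g : ι × ι ≃ ι × ι) {μ : ℝ} (hμ : 1 ≤ μ) :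
    ν.real {U | ∃ x : ι → ℂ, 640 * μ * ∑ q, ‖x q‖ ^ 2
        < ∑ p, ‖(permuteEntries g (U : Matrix ι ι ℂ) *ᵥ x) p‖ ^ 2} ≤ Real.exp (-μ) / 2 := by
  obtain ⟨N, hcard, hN1, hN⟩ := exists_half_net (EuclideanSpace ℂ ι)
  have hfr : Module.finrank ℝ (EuclideanSpace ℂ ι) = 2 * Fintype.card ι := by
    rw [finrank_real_of_complex, finrank_euclideanSpace]
  rw [hfr] at hcard
  set s : ℝ := Real.sqrt (40 * μ) with hs
  have hs0 : 0 ≤ s := Real.sqrt_nonneg _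
  have hs2 : s ^ 2 = 40 * μ := Real.sq_sqrt (by linarith)
  let X : EuclideanSpace ℂ ι × EuclideanSpace ℂ ι → Matrix ι ι ℂ := fun ab =>
    Matrix.of fun j i => star (ab.1 (g.symm (i, j)).1) * ab.2 (g.symm (i, j)).2
  have hX : ∀ ab ∈ N ×ˢ N, ∑ i, ∑ j, ‖X ab i j‖ ^ 2 ≤ 1 := by
    rintro ⟨a, b⟩ hab
    rw [Finset.mem_product] at hab
    have e1 : ∑ i, ∑ j, ‖X (a, b) i j‖ ^ 2 = ∑ p, ∑ q, (‖a p‖ ^ 2 * ‖b q‖ ^ 2) := by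
      rw [Finset.sum_comm, ← Fintype.sum_prod_type', ← Fintype.sum_prod_type']
      refine Fintype.sum_equiv g.symm _ _ fun r => ?_
      simp [X, mul_pow]
    rw [e1, ← Finset.sum_mul_sum, ← EuclideanSpace.norm_sq_eq, ← EuclideanSpace.norm_sq_eq]
    have ha := hN1 a hab.1
    have hb := hN1 b hab.2
    calc ‖a‖ ^ 2 * ‖b‖ ^ 2 ≤ 1 ^ 2 * 1 ^ 2 := by gcongr
      _ = 1 := by norm_num
  have hinner : ∀ (U : Matrix ι ι ℂ) (a b : EuclideanSpace ℂ ι),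
      inner ℂ a (WithLp.toLp 2 (permuteEntries g U *ᵥ b.ofLp)) = (U * X (a, b)).trace := by
    intro U a b
    rw [EuclideanSpace.inner_eq_star_dotProduct]
    have e1 : (U * X (a, b)).trace = ∑ p, ∑ q,
        U (g (p, q)).1 (g (p, q)).2 * (star (a p) * b q) := by
      simp only [Matrix.trace, Matrix.diag, Matrix.mul_apply]
      rw [← Fintype.sum_prod_type', ← Fintype.sum_prod_type']
      refine Fintype.sum_equiv g.symm _ _ fun r => ?_
      simp [X]
    rw [e1]
    simp only [dotProduct, Matrix.mulVec, permuteEntries, Matrix.of_apply, Finset.sum_mul,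
      Pi.star_apply]
    refine Finset.sum_congr rfl fun p _ => Finset.sum_congr rfl fun q _ => ?_
    ring
  have hsub : {U : Matrix.unitaryGroup ι ℂ | ∃ x : ι → ℂ, 640 * μ * ∑ q, ‖x q‖ ^ 2
        < ∑ p, ‖(permuteEntries g (U : Matrix ι ι ℂ) *ᵥ x) p‖ ^ 2}
      ⊆ ⋃ ab ∈ N ×ˢ N, {U | s ≤ ((U : Matrix ι ι ℂ) * X ab).trace.re} := by
    rintro U ⟨x, hx⟩
    by_contra hcon
    simp only [Set.mem_iUnion, Set.mem_ofPred_eq, not_exists, not_le] at hcon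
    let T : EuclideanSpace ℂ ι →L[ℂ] EuclideanSpace ℂ ι :=
      Matrix.toEuclideanCLM (𝕜 := ℂ) (permuteEntries g (U : Matrix ι ι ℂ))
    have hT : ∀ y : EuclideanSpace ℂ ι,
        T y = WithLp.toLp 2 (permuteEntries g (U : Matrix ι ι ℂ) *ᵥ y.ofLp) := fun y => rfl
    have hnorm := norm_le_of_net hN T hs0 fun a ha b hb => by
      rw [hT, hinner]
      exact (hcon (a, b) (Finset.mem_product.mpr ⟨ha, hb⟩)).le
    have h2 := T.le_opNorm (WithLp.toLp 2 x)
    have h3 : ‖T (WithLp.toLp 2 x)‖ ^ 2 ≤ (4 * s * ‖(WithLp.toLp 2 x : EuclideanSpace ℂ ι)‖) ^ 2 := by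
      gcongr
      exact h2.trans (by gcongr)
    rw [mul_pow, mul_pow, hs2, hT, EuclideanSpace.norm_sq_eq, EuclideanSpace.norm_sq_eq] at h3
    simp only at h3
    linarith
  set n : ℝ := (Fintype.card ι : ℝ) with hn
  have hn1 : 1 ≤ n := by
    rw [hn]; exact_mod_cast Fintype.card_pos
  have h625 : ((N ×ˢ N).card : ℝ) ≤ Real.exp (7 * n) := by
    have h1 : ((N ×ˢ N).card : ℝ) ≤ (625 : ℝ) ^ Fintype.card ι := by
      rw [Finset.card_product]
      have : N.card * N.card ≤ 625 ^ Fintype.card ι := by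
        calc _ ≤ 5 ^ (2 * Fintype.card ι) * 5 ^ (2 * Fintype.card ι) := Nat.mul_le_mul hcard hcard
          _ = (5 ^ 4) ^ Fintype.card ι := by rw [← pow_add, ← pow_mul]; ring_nf
          _ = _ := by norm_num
      exact_mod_cast this
    have h2 : (625 : ℝ) ≤ Real.exp 7 := by
      have h3 : (2.7 : ℝ) ^ 7 ≤ Real.exp 1 ^ 7 := by
        gcongr
        linarith [Real.exp_one_gt_d9]
      rw [← Real.exp_nat_mul] at h3
      norm_num at h3
      linarith
    calc _ ≤ (625 : ℝ) ^ Fintype.card ι := h1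
      _ ≤ Real.exp 7 ^ Fintype.card ι := by gcongr
      _ = _ := by rw [← Real.exp_nat_mul, mul_comm]
  calc _ ≤ ν.real (⋃ ab ∈ N ×ˢ N, {U | s ≤ ((U : Matrix ι ι ℂ) * X ab).trace.re}) :=
        measureReal_mono hsub (measure_ne_top _ _)
    _ ≤ ∑ ab ∈ N ×ˢ N, ν.real {U | s ≤ ((U : Matrix ι ι ℂ) * X ab).trace.re} :=
        measureReal_biUnion_finset_le _ _
    _ ≤ ∑ ab ∈ N ×ˢ N, Real.exp (-(n * s ^ 2 / 4)) :=
        Finset.sum_le_sum fun ab hab => measureReal_re_trace_ge_le ν (X ab) (hX ab hab) hs0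
    _ ≤ Real.exp (7 * n) * Real.exp (-(n * s ^ 2 / 4)) := by
        rw [Finset.sum_const, nsmul_eq_mul]
        gcongr
    _ ≤ Real.exp (-1) * Real.exp (-μ) := by
        rw [← Real.exp_add, ← Real.exp_add, hs2]
        refine Real.exp_le_exp.mpr ?_
        nlinarith [mul_nonneg (sub_nonneg.mpr hn1) (sub_nonneg.mpr hμ)]
    _ ≤ Real.exp (-μ) / 2 := by
        have : Real.exp (-1) ≤ 1 / 2 := by
          rw [Real.exp_neg, inv_le_comm₀ (Real.exp_pos _) (by norm_num)]
          linarith [Real.exp_one_gt_d9]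
        have := mul_le_mul_of_nonneg_right this (Real.exp_pos (-μ)).le
        linarith
end Tail


section ClassicalEntropy
variable {M K C : Type*} [Fintype M] [Fintype K] [Fintype C]

theorem mul_log_div_ge {w p q : ℝ} (hw : 0 < w) (hp : 0 < p) (hq : 0 < q) :
    w - q * (w / p) ≤ w * (Real.log p - Real.log q) := by
  have h := Real.log_le_sub_one_of_pos (div_pos hq hp)
  rw [Real.log_div hq.ne' hp.ne'] at h
  have := mul_le_mul_of_nonneg_left h hw.le
  have e : w * (q / p - 1) = q * (w / p) - w := by ring
  linarith

theorem sum_negMulLog_le_log_card {p : M → ℝ} (hp : ∀ m, 0 ≤ p m) (hp1 : ∑ m, p m = 1) :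
    ∑ m, Real.negMulLog (p m) ≤ Real.log (Fintype.card M) := by
  have hne : Nonempty M := by
    by_contra h
    rw [not_nonempty_iff] at h
    simp at hp1
  have hc : (0 : ℝ) < Fintype.card M := by exact_mod_cast Fintype.card_pos
  have h : ∀ m, Real.negMulLog (p m) - p m * Real.log (Fintype.card M)
      ≤ (Fintype.card M : ℝ)⁻¹ - p m := by
    intro m
    rcases (hp m).eq_or_lt with h0 | h0
    · simp [← h0]
    · have := mul_log_div_ge h0 h0 (inv_pos.mpr hc)
      rw [Real.log_inv, div_self h0.ne'] at this
      rw [Real.negMulLog]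
      linarith
  have := Finset.sum_le_sum fun m (_ : m ∈ Finset.univ) => h m
  rw [Finset.sum_sub_distrib, Finset.sum_sub_distrib, ← Finset.sum_mul, hp1, Finset.sum_const,
    Finset.card_univ, nsmul_eq_mul, mul_inv_cancel₀ hc.ne'] at this
  linarith

theorem sum_negMulLog_sub_log_le {p : M → ℝ} {s : K → ℝ} {w : M → K → ℝ} {κ : ℝ} (hκ : 0 < κ)
    (hs : ∀ k, 0 ≤ s k) (hs1 : ∑ k, s k = 1) (hw : ∀ m k, 0 ≤ w m k)
    (hp : ∀ m, p m = ∑ k, s k * w m k) (hw1 : ∀ k, ∑ m, w m k = 1)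
    (hwκ : ∀ m, ∑ k, (if s k = 0 then 0 else w m k) ≤ κ) :
    ∑ k, Real.negMulLog (s k) - Real.log κ ≤ ∑ m, Real.negMulLog (p m) := by
  have hsw : ∀ m k, 0 ≤ s k * w m k := fun m k => mul_nonneg (hs k) (hw m k)
  have hp0 : ∀ m, 0 ≤ p m := fun m => by
    rw [hp]; exact Finset.sum_nonneg fun k _ => hsw m k
  have h : ∀ m k, s k * w m k * Real.log (p m) - s k * w m k * (Real.log κ + Real.log (s k))
      ≤ p m / κ * (if s k = 0 then 0 else w m k) - s k * w m k := by
    intro m k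
    rcases (hs k).eq_or_lt with h0 | h0
    · simp [← h0]
    rcases (hw m k).eq_or_lt with h1 | h1
    · simp [← h1]
    have hpp : 0 < p m := by
      rw [hp]
      exact Finset.sum_pos' (fun k _ => hsw m k) ⟨k, Finset.mem_univ _, mul_pos h0 h1⟩
    have := mul_log_div_ge (mul_pos h0 h1) (mul_pos hκ h0) hpp
    rw [Real.log_mul hκ.ne' h0.ne'] at this
    have e : p m * (s k * w m k / (κ * s k)) = p m / κ * w m k := by
      field_simp
    rw [e] at this
    rw [if_neg h0.ne']
    linarith
  have h2 : ∀ m, p m * Real.log (p m)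
      - ∑ k, s k * w m k * (Real.log κ + Real.log (s k)) ≤ 0 := by
    intro m
    have := Finset.sum_le_sum fun k (_ : k ∈ Finset.univ) => h m k
    rw [Finset.sum_sub_distrib, Finset.sum_sub_distrib, ← Finset.sum_mul, ← Finset.mul_sum,
      ← hp] at this
    have h3 : p m / κ * ∑ k, (if s k = 0 then 0 else w m k) ≤ p m / κ * κ := by
      have := hp0 m
      gcongr
      exact hwκ m
    rw [div_mul_cancel₀ _ hκ.ne'] at h3
    linarith
  have h4 := Finset.sum_le_sum fun m (_ : m ∈ Finset.univ) => h2 m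
  rw [Finset.sum_sub_distrib, Finset.sum_comm] at h4
  have h5 : ∀ k, ∑ m, s k * w m k * (Real.log κ + Real.log (s k))
      = s k * Real.log κ - Real.negMulLog (s k) := by
    intro k
    rw [← Finset.sum_mul, ← Finset.mul_sum, hw1, Real.negMulLog]
    ring
  rw [Finset.sum_congr rfl fun k _ => h5 k, Finset.sum_sub_distrib, ← Finset.sum_mul, hs1] at h4
  simp only [Real.negMulLog, neg_mul, Finset.sum_neg_distrib, Finset.sum_const_zero] at h4 ⊢
  linarith

theorem sum_negMulLog_le_add {p : M → ℝ} {a : C → ℝ} {s : K → ℝ} {w : M → C → K → ℝ}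
    (hw : ∀ m c k, 0 ≤ w m c k) (hp : ∀ m, ∑ c, ∑ k, w m c k = p m)
    (ha : ∀ c, ∑ m, ∑ k, w m c k = a c) (hs : ∀ k, ∑ m, ∑ c, w m c k = s k)
    (ha1 : ∑ c, a c = 1) (hs1 : ∑ k, s k = 1)
    (hb : ∀ c k, ∑ m, w m c k / p m ≤ 1) :
    ∑ m, Real.negMulLog (p m) ≤ ∑ c, Real.negMulLog (a c) + ∑ k, Real.negMulLog (s k) := by
  have hle : ∀ m c k, w m c k ≤ p m ∧ w m c k ≤ a c ∧ w m c k ≤ s k := by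
    intro m c k
    refine ⟨?_, ?_, ?_⟩
    · rw [← hp]
      exact (Finset.single_le_sum (f := fun k => w m c k) (fun k _ => hw m c k)
        (Finset.mem_univ k)).trans (Finset.single_le_sum (f := fun c => ∑ k, w m c k)
        (fun c _ => Finset.sum_nonneg fun k _ => hw m c k) (Finset.mem_univ c))
    · rw [← ha]
      exact (Finset.single_le_sum (f := fun k => w m c k) (fun k _ => hw m c k)
        (Finset.mem_univ k)).trans (Finset.single_le_sum (f := fun m => ∑ k, w m c k)
        (fun m _ => Finset.sum_nonneg fun k _ => hw m c k) (Finset.mem_univ m))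
    · rw [← hs]
      exact (Finset.single_le_sum (f := fun c => w m c k) (fun c _ => hw m c k)
        (Finset.mem_univ c)).trans (Finset.single_le_sum (f := fun m => ∑ c, w m c k)
        (fun m _ => Finset.sum_nonneg fun c _ => hw m c k) (Finset.mem_univ m))
  have ha0 : ∀ c, 0 ≤ a c := fun c => by
    rw [← ha]; exact Finset.sum_nonneg fun m _ => Finset.sum_nonneg fun k _ => hw m c k
  have hs0 : ∀ k, 0 ≤ s k := fun k => by
    rw [← hs]; exact Finset.sum_nonneg fun m _ => Finset.sum_nonneg fun c _ => hw m c k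
  have h : ∀ m c k, w m c k - a c * s k * (w m c k / p m)
      ≤ w m c k * Real.log (p m) - w m c k * Real.log (a c) - w m c k * Real.log (s k) := by
    intro m c k
    rcases (hw m c k).eq_or_lt with h0 | h0
    · simp [← h0]
    obtain ⟨h1, h2, h3⟩ := hle m c k
    have := mul_log_div_ge h0 (h0.trans_le h1) (mul_pos (h0.trans_le h2) (h0.trans_le h3))
    rw [Real.log_mul (h0.trans_le h2).ne' (h0.trans_le h3).ne'] at this
    linarith
  have h1 := Finset.sum_le_sum fun m (_ : m ∈ Finset.univ) =>
    Finset.sum_le_sum fun c (_ : c ∈ Finset.univ) =>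
    Finset.sum_le_sum fun k (_ : k ∈ Finset.univ) => h m c k
  simp only [Finset.sum_sub_distrib] at h1
  have e1 : ∑ m, ∑ c, ∑ k, w m c k = 1 := by
    rw [Finset.sum_comm]; simp only [ha, ha1]
  have e2 : ∑ m, ∑ c, ∑ k, w m c k * Real.log (p m) = ∑ m, p m * Real.log (p m) := by
    simp only [← Finset.sum_mul, hp]
  have e3 : ∑ m, ∑ c, ∑ k, w m c k * Real.log (a c) = ∑ c, a c * Real.log (a c) := by
    rw [Finset.sum_comm]; simp only [← Finset.sum_mul, ha]
  have e4 : ∑ m, ∑ c, ∑ k, w m c k * Real.log (s k) = ∑ k, s k * Real.log (s k) := by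
    rw [Finset.sum_congr rfl fun m _ => Finset.sum_comm, Finset.sum_comm]
    simp only [← Finset.sum_mul, hs]
  have e5 : ∑ m, ∑ c, ∑ k, a c * s k * (w m c k / p m) ≤ 1 := by
    rw [Finset.sum_comm, Finset.sum_congr rfl fun c _ => Finset.sum_comm]
    simp only [← Finset.mul_sum]
    calc _ ≤ ∑ c, ∑ k, a c * s k * 1 := Finset.sum_le_sum fun c _ => Finset.sum_le_sum fun k _ =>
          mul_le_mul_of_nonneg_left (hb c k) (mul_nonneg (ha0 c) (hs0 k))
      _ = 1 := by simp only [mul_one, ← Finset.mul_sum, hs1, ha1]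
  rw [e1, e2, e3, e4] at h1
  simp only [Real.negMulLog, neg_mul, Finset.sum_neg_distrib]
  linarith

end ClassicalEntropy

section Density
variable {n : Type*} [Fintype n] [DecidableEq n]

/-- The entropy of a density matrix is the entropy of its spectrum. -/
theorem IsDensity.exists_spectral {ρ : Matrix n n ℂ} (hρ : IsDensity ρ) :
    ∃ (E : Matrix n n ℂ) (p : n → ℝ), Eᴴ * E = 1 ∧ E * Eᴴ = 1 ∧
      ρ = E * diagonal (fun k => (p k : ℂ)) * Eᴴ ∧ (∀ k, 0 ≤ p k) ∧ ∑ k, p k = 1 ∧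
      vN ρ = ∑ k, Real.negMulLog (p k) := by
  have h := hρ.1.1
  refine ⟨h.eigenvectorUnitary, h.eigenvalues,
    Matrix.mem_unitaryGroup_iff'.mp h.eigenvectorUnitary.2,
    Matrix.mem_unitaryGroup_iff.mp h.eigenvectorUnitary.2, h.eq_mul_diagonal_mul,
    hρ.1.eigenvalues_nonneg, ?_, ?_⟩
  · have := h.trace_eq_sum_eigenvalues
    rw [hρ.2] at this
    apply Complex.ofReal_injective
    simpa using this.symm
  · rw [vN, dif_pos h]
    simp [Real.negMulLog]

theorem IsDensity.vN_le_log_card {ρ : Matrix n n ℂ} (hρ : IsDensity ρ) :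
    vN ρ ≤ Real.log (Fintype.card n) := by
  obtain ⟨E, p, -, -, -, hp, hp1, hv⟩ := hρ.exists_spectral
  rw [hv]
  exact sum_negMulLog_le_log_card hp hp1

end Density

section PartialTrace
variable {A C X : Type*} [Fintype C] [Fintype X] [DecidableEq X]

/-- The partial trace along a factorization `X ≃ A × C` of the index type. -/
def ptrace (e : A × C ≃ X) (ρ : Matrix X X ℂ) : Matrix A A ℂ :=
  Matrix.of fun a a' => ∑ c, ρ (e (a, c)) (e (a', c))

theorem isDensity_ptrace [Fintype A] [DecidableEq A]
    {ρ : Matrix X X ℂ} (hρ : IsDensity ρ) (e : A × C ≃ X) :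
    IsDensity (ptrace e ρ) := by
  constructor
  · have : ptrace e ρ = ∑ c, ρ.submatrix (fun a => e (a, c)) (fun a => e (a, c)) := by
      ext a a'
      simp [ptrace, Matrix.sum_apply]
    rw [this]
    exact Matrix.posSemidef_sum _ fun c _ => hρ.1.submatrix _
  · rw [← hρ.2]
    simp only [Matrix.trace, Matrix.diag, ptrace, Matrix.of_apply]
    rw [← Fintype.sum_prod_type' (fun a c => ρ (e (a, c)) (e (a, c)))]
    exact Fintype.sum_equiv e _ _ fun x => rfl

/-- The vector in column `k` of `Φ`, regarded as a matrix along `X ≃ A × C`. -/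
def colMatrix (e : A × C ≃ X) (Φ : Matrix X X ℂ) (k : X) : Matrix A C ℂ :=
  Matrix.of fun a c => Φ (e (a, c)) k

theorem ptrace_mul_diagonal_mul (e : A × C ≃ X) (Φ : Matrix X X ℂ) (s : X → ℝ) :
    ptrace e (Φ * diagonal (fun k => (s k : ℂ)) * Φᴴ)
      = ∑ k, (s k : ℂ) • (colMatrix e Φ k * (colMatrix e Φ k)ᴴ) := by
  ext a a'
  have h : ∀ x y, (Φ * diagonal (fun k => (s k : ℂ)) * Φᴴ) x y
      = ∑ k, Φ x k * s k * star (Φ y k) := fun x y => by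
    rw [Matrix.mul_apply]
    simp only [Matrix.mul_diagonal, Matrix.conjTranspose_apply]
  simp only [ptrace, h, Matrix.of_apply, Matrix.sum_apply, Matrix.smul_apply, Matrix.mul_apply,
    colMatrix, Matrix.conjTranspose_apply, smul_eq_mul, Finset.mul_sum]
  rw [Finset.sum_comm]
  refine Finset.sum_congr rfl fun k _ => Finset.sum_congr rfl fun c _ => ?_
  ring

theorem conjTranspose_mul_mul_of_eq [Fintype A] [DecidableEq A]
    {E D σ : Matrix A A ℂ} (hE : Eᴴ * E = 1)
    (h : σ = E * D * Eᴴ) : Eᴴ * σ * E = D := by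
  rw [h]
  calc _ = (Eᴴ * E) * D * (Eᴴ * E) := by simp only [Matrix.mul_assoc]
    _ = D := by rw [hE, Matrix.one_mul, Matrix.mul_one]

theorem sum_norm_sq_colMatrix [Fintype A]
    (e : A × C ≃ X) {Φ : Matrix X X ℂ} (hΦ : Φᴴ * Φ = 1) (k : X) :
    ∑ a, ∑ c, ‖colMatrix e Φ k a c‖ ^ 2 = 1 := by
  simp only [colMatrix, Matrix.of_apply]
  rw [← Fintype.sum_prod_type' (fun a c => ‖Φ (e (a, c)) k‖ ^ 2),
    Fintype.sum_equiv e _ (fun x => ‖Φ x k‖ ^ 2) fun x => rfl]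
  apply Complex.ofReal_injective
  have := congrFun (congrFun hΦ k) k
  simp only [Matrix.mul_apply, Matrix.conjTranspose_apply, Matrix.one_apply_eq] at this
  push_cast
  rw [← this]
  refine Finset.sum_congr rfl fun x _ => ?_
  rw [← Complex.conj_mul']
  rfl

variable [Fintype A] [DecidableEq A] [DecidableEq C]

/-- If the eigenvectors of `ρ` overlap little with product vectors `x ⊗ c`, then the reduced
density has nearly as much entropy as `ρ` plus `- log κ`. -/
theorem vN_sub_log_le_vN_ptrace (e : A × C ≃ X) {ρ : Matrix X X ℂ} (hρ : IsDensity ρ) {κ : ℝ}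
    (hκ : 0 < κ)
    (h : ∀ (Φ : Matrix X X ℂ) (s : X → ℝ), Φᴴ * Φ = 1 →
      ρ = Φ * diagonal (fun k => (s k : ℂ)) * Φᴴ → ∀ x : A → ℂ,
      ∑ k, (if s k = 0 then 0 else ∑ c, ‖∑ a, star (Φ (e (a, c)) k) * x a‖ ^ 2)
        ≤ κ * ∑ a, ‖x a‖ ^ 2) :
    vN ρ - Real.log κ ≤ vN (ptrace e ρ) := by
  obtain ⟨Φ, s, hΦ, -, hρΦ, hs, hs1, hvρ⟩ := hρ.exists_spectral
  obtain ⟨E, p, hE, hE', hσ, hp, hp1, hvσ⟩ := (isDensity_ptrace hρ e).exists_spectral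
  have hD := conjTranspose_mul_mul_of_eq hE hσ
  rw [hρΦ, ptrace_mul_diagonal_mul] at hD
  rw [hvρ, hvσ]
  refine sum_negMulLog_sub_log_le
    (w := fun m k => ∑ c, ‖(Eᴴ * colMatrix e Φ k) m c‖ ^ 2) hκ hs hs1
    (fun m k => by positivity) ?_ ?_ ?_
  · intro m
    have := congrFun (congrFun hD m) m
    rw [Matrix.diagonal_apply_eq] at this
    apply Complex.ofReal_injective
    rw [← this, Matrix.mul_sum, Matrix.sum_mul, Matrix.sum_apply]
    push_cast
    refine Finset.sum_congr rfl fun k _ => ?_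
    rw [Matrix.mul_smul, Matrix.smul_mul, Matrix.smul_apply, smul_eq_mul]
    congr 1
    have : Eᴴ * (colMatrix e Φ k * (colMatrix e Φ k)ᴴ) * E
        = (Eᴴ * colMatrix e Φ k) * (Eᴴ * colMatrix e Φ k)ᴴ := by
      simp only [Matrix.conjTranspose_mul, Matrix.conjTranspose_conjTranspose, Matrix.mul_assoc]
    rw [this, Matrix.mul_apply]
    refine Finset.sum_congr rfl fun c _ => ?_
    rw [← Complex.mul_conj']
    rfl
  · intro k
    have := sum_norm_sq_mul_mul (U := Eᴴ) (V := (1 : Matrix C C ℂ))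
      (by rw [Matrix.conjTranspose_conjTranspose, hE']) (by simp) (colMatrix e Φ k)
    rw [Matrix.mul_one] at this
    rw [this, sum_norm_sq_colMatrix e hΦ]
  · intro m
    have h1 := h Φ s hΦ hρΦ fun a => E a m
    have h2 : ∑ a, ‖E a m‖ ^ 2 = 1 := by
      apply Complex.ofReal_injective
      have := congrFun (congrFun hE m) m
      simp only [Matrix.mul_apply, Matrix.conjTranspose_apply, Matrix.one_apply_eq] at this
      push_cast
      rw [← this]
      refine Finset.sum_congr rfl fun x _ => ?_
      rw [← Complex.conj_mul']
      rfl
    rw [h2, mul_one] at h1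
    refine le_of_eq_of_le (Finset.sum_congr rfl fun k _ => ?_) h1
    congr 1
    refine Finset.sum_congr rfl fun c _ => ?_
    rw [Matrix.mul_apply, ← norm_star, star_sum]
    congr 2
    refine Finset.sum_congr rfl fun a _ => ?_
    simp [colMatrix, mul_comm]

/-- Bessel's inequality for the rows of a matrix with orthogonal rows, tested against a
coordinate vector. -/
theorem sum_norm_sq_div_le_one {J : Type*} [Fintype J] {Z : Matrix A J ℂ} {p : A → ℝ}
    (hZ : Z * Zᴴ = diagonal fun m => (p m : ℂ)) (j : J) :
    ∑ m, ‖Z m j‖ ^ 2 / p m ≤ 1 := by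
  set t : ℝ := ∑ m, ‖Z m j‖ ^ 2 / p m with ht
  set y : A → ℂ := fun m => star (Z m j) / p m with hy
  have h1 : (y ᵥ* Z) j = t := by
    simp only [Matrix.vecMul, dotProduct, hy, ht]
    push_cast
    refine Finset.sum_congr rfl fun m _ => ?_
    rw [← Complex.conj_mul']
    simp only [RCLike.star_def]
    ring
  have h2 : ∑ i, ‖(y ᵥ* Z) i‖ ^ 2 = t := by
    apply Complex.ofReal_injective
    have e1 : ((∑ i, ‖(y ᵥ* Z) i‖ ^ 2 : ℝ) : ℂ) = (y ᵥ* (Z * Zᴴ)) ⬝ᵥ star y := by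
      rw [← Matrix.vecMul_vecMul, ← Matrix.dotProduct_mulVec]
      rw [← Matrix.star_vecMul]
      simp only [dotProduct, Pi.star_apply]
      push_cast
      refine Finset.sum_congr rfl fun m _ => ?_
      rw [← Complex.mul_conj']
      rfl
    rw [e1, hZ]
    simp only [Matrix.vecMul_diagonal, dotProduct, Pi.star_apply, ht, hy]
    push_cast
    refine Finset.sum_congr rfl fun m _ => ?_
    by_cases h0 : p m = 0
    · simp [h0]
    · have : (p m : ℂ) ≠ 0 := by exact_mod_cast h0
      rw [← Complex.conj_mul']
      simp only [RCLike.star_def, map_div₀, Complex.conj_conj, Complex.conj_ofReal]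
      field_simp
  have h3 : ‖(y ᵥ* Z) j‖ ^ 2 ≤ t := by
    rw [← h2]
    exact Finset.single_le_sum (f := fun i => ‖(y ᵥ* Z) i‖ ^ 2) (fun i _ => sq_nonneg _)
      (Finset.mem_univ j)
  rw [h1, Complex.norm_real, Real.norm_eq_abs, sq_abs] at h3
  nlinarith

theorem conjTranspose_transpose_mul_self_of_mul_conjTranspose {F : Matrix C C ℂ}
    (hF : F * Fᴴ = 1) : Fᴴᵀ * (Fᴴᵀ)ᴴ = 1 := by
  have : (Fᴴᵀ)ᴴ = Fᵀ := by ext; simp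
  rw [this, ← Matrix.transpose_mul, hF, Matrix.transpose_one]

/-- The entropies of the two marginals of a density differ by at most its own entropy. -/
theorem vN_ptrace_le_add (e : A × C ≃ X) {ρ : Matrix X X ℂ} (hρ : IsDensity ρ) :
    vN (ptrace e ρ) ≤ vN (ptrace ((Equiv.prodComm C A).trans e) ρ) + vN ρ := by
  obtain ⟨Φ, s, hΦ, -, hρΦ, hs, hs1, hvρ⟩ := hρ.exists_spectral
  obtain ⟨E, p, hE, hE', hσ, hp, hp1, hvσ⟩ := (isDensity_ptrace hρ e).exists_spectral
  obtain ⟨F, α, hF, hF', hτ, hα, hα1, hvτ⟩ :=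
    (isDensity_ptrace hρ ((Equiv.prodComm C A).trans e)).exists_spectral
  have hD := conjTranspose_mul_mul_of_eq hE hσ
  have hB := conjTranspose_mul_mul_of_eq hF hτ
  rw [hρΦ, ptrace_mul_diagonal_mul] at hD hB
  rw [hvρ, hvσ, hvτ]
  let Y : X → Matrix A C ℂ := fun k => Eᴴ * colMatrix e Φ k * Fᴴᵀ
  let Z : Matrix A (C × X) ℂ := Matrix.of fun m j => (Real.sqrt (s j.2) : ℂ) * Y j.2 m j.1
  have hnorm : ∀ m c k, ‖Z m (c, k)‖ ^ 2 = s k * ‖Y k m c‖ ^ 2 := by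
    intro m c k
    simp only [Z, Matrix.of_apply, norm_mul, mul_pow, Complex.norm_real, Real.norm_eq_abs, sq_abs,
      Real.sq_sqrt (hs k)]
  have hFF := conjTranspose_transpose_mul_self_of_mul_conjTranspose hF'
  have hEE := conjTranspose_transpose_mul_self_of_mul_conjTranspose hE'
  have hYY : ∀ k, Y k * (Y k)ᴴ = Eᴴ * (colMatrix e Φ k * (colMatrix e Φ k)ᴴ) * E := by
    intro k
    calc _ = Eᴴ * colMatrix e Φ k * (Fᴴᵀ * (Fᴴᵀ)ᴴ) * (Eᴴ * colMatrix e Φ k)ᴴ := by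
          simp only [Y, Matrix.conjTranspose_mul, Matrix.mul_assoc]
      _ = _ := by
          rw [hFF, Matrix.mul_one]
          simp only [Matrix.conjTranspose_mul, Matrix.conjTranspose_conjTranspose,
            Matrix.mul_assoc]
  have hYY' : ∀ k, (Y k)ᵀ * (Y k)ᵀᴴ = Fᴴ * (colMatrix ((Equiv.prodComm C A).trans e) Φ k *
      (colMatrix ((Equiv.prodComm C A).trans e) Φ k)ᴴ) * F := by
    intro k
    have : colMatrix ((Equiv.prodComm C A).trans e) Φ k = (colMatrix e Φ k)ᵀ := rfl
    rw [this]
    calc _ = Fᴴ * (colMatrix e Φ k)ᵀ * (Eᴴᵀ * (Eᴴᵀ)ᴴ) * (Fᴴ * (colMatrix e Φ k)ᵀ)ᴴ := by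
          simp only [Y, Matrix.transpose_mul, Matrix.transpose_transpose,
            Matrix.conjTranspose_mul, Matrix.mul_assoc]
      _ = _ := by
          rw [hEE, Matrix.mul_one]
          simp only [Matrix.conjTranspose_mul, Matrix.conjTranspose_conjTranspose,
            Matrix.mul_assoc]
  have hZ : Z * Zᴴ = diagonal fun m => (p m : ℂ) := by
    rw [← hD, Matrix.mul_sum, Matrix.sum_mul]
    ext m m'
    rw [Matrix.mul_apply, Fintype.sum_prod_type_right, Matrix.sum_apply]
    refine Finset.sum_congr rfl fun k _ => ?_
    rw [Matrix.mul_smul, Matrix.smul_mul, ← hYY, Matrix.smul_apply, Matrix.mul_apply,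
      smul_eq_mul, Finset.mul_sum]
    refine Finset.sum_congr rfl fun c _ => ?_
    have hsq : ((Real.sqrt (s k) : ℝ) : ℂ) * (Real.sqrt (s k) : ℝ) = (s k : ℝ) := by
      rw [← Complex.ofReal_mul, Real.mul_self_sqrt (hs k)]
    simp only [Z, Matrix.conjTranspose_apply, Matrix.of_apply, star_mul', RCLike.star_def,
      Complex.conj_ofReal]
    rw [← hsq]
    ring
  refine sum_negMulLog_le_add (w := fun m c k => ‖Z m (c, k)‖ ^ 2) (fun m c k => sq_nonneg _)
    ?_ ?_ ?_ hα1 hs1 fun c k => sum_norm_sq_div_le_one hZ (c, k)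
  · intro m
    rw [← Fintype.sum_prod_type']
    have := congrFun (congrFun hZ m) m
    rw [Matrix.diagonal_apply_eq] at this
    apply Complex.ofReal_injective
    rw [← this, Matrix.mul_apply]
    push_cast
    refine Finset.sum_congr rfl fun j _ => ?_
    rw [← Complex.mul_conj']
    rfl
  · intro c
    have := congrFun (congrFun hB c) c
    rw [Matrix.diagonal_apply_eq, Matrix.mul_sum, Matrix.sum_mul, Matrix.sum_apply] at this
    apply Complex.ofReal_injective
    rw [← this, Finset.sum_comm]
    push_cast
    refine Finset.sum_congr rfl fun k _ => ?_
    rw [Matrix.mul_smul, Matrix.smul_mul, ← hYY', Matrix.smul_apply, Matrix.mul_apply,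
      smul_eq_mul, Finset.mul_sum]
    refine Finset.sum_congr rfl fun m _ => ?_
    rw [← Complex.ofReal_pow, hnorm, Complex.ofReal_mul, Complex.ofReal_pow, ← Complex.mul_conj']
    rfl
  · intro k
    simp only [hnorm, ← Finset.mul_sum]
    rw [sum_norm_sq_mul_mul (by rw [Matrix.conjTranspose_conjTranspose, hE']) hFF,
      sum_norm_sq_colMatrix e hΦ, mul_one]

end PartialTrace

section Support
variable {A C X I : Type*} [Fintype A] [Fintype C] [Fintype X] [Fintype I]

theorem sum_norm_sq_mulVec_of_isometry [DecidableEq I] {M : Matrix X I ℂ} (hM : Mᴴ * M = 1)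
    (c : I → ℂ) : ∑ x, ‖(M *ᵥ c) x‖ ^ 2 = ∑ i, ‖c i‖ ^ 2 := by
  apply Complex.ofReal_injective
  have h : ∀ {J : Type _} [Fintype J] (y : J → ℂ), ((∑ j, ‖y j‖ ^ 2 : ℝ) : ℂ) = star y ⬝ᵥ y := by
    intro J _ y
    simp [dotProduct, Complex.conj_mul']
  have h' : ∀ y : I → ℂ, ((∑ j, ‖y j‖ ^ 2 : ℝ) : ℂ) = star y ⬝ᵥ y := by
    intro y
    simp [dotProduct, Complex.conj_mul']
  rw [h, h', Matrix.star_mulVec, ← Matrix.dotProduct_mulVec, Matrix.mulVec_mulVec, hM,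
    Matrix.one_mulVec]

variable [DecidableEq X] [DecidableEq I]

/-- Bessel's inequality for the eigenvectors of `ρ` with nonzero eigenvalue, when the support of
`ρ` is spanned by an orthonormal family. -/
theorem SuppIn.sum_norm_sq_eigenvector_le {ρ : Matrix X X ℂ} {v : I → X → ℂ}
    (hρ : SuppIn ρ v) (hv : ONFam v) {Φ : Matrix X X ℂ} {s : X → ℝ} (hΦ : Φᴴ * Φ = 1)
    (h : ρ = Φ * diagonal (fun k => (s k : ℂ)) * Φᴴ) (w : X → ℂ) :
    ∑ k, (if s k = 0 then 0 else ‖∑ x, star (Φ x k) * w x‖ ^ 2)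
      ≤ ∑ i, ‖∑ x, star (v i x) * w x‖ ^ 2 := by
  let V : Matrix X I ℂ := Matrix.of fun x i => v i x
  have hV : Vᴴ * V = 1 := by
    ext i j
    simpa [V, Matrix.mul_apply, Matrix.one_apply] using hv i j
  set w' : X → ℂ := V *ᵥ (Vᴴ *ᵥ w) with hw'
  have hperp : ∀ y ∈ Submodule.span ℂ (Set.range v), star (w - w') ⬝ᵥ y = 0 := by
    intro y hy
    induction hy using Submodule.span_induction with
    | mem y hy =>
      obtain ⟨i, rfl⟩ := hy
      have e1 : Vᴴ *ᵥ (w - w') = 0 := by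
        rw [Matrix.mulVec_sub, hw', Matrix.mulVec_mulVec, hV, Matrix.one_mulVec, sub_self]
      have e2 := congrFun e1 i
      rw [← star_eq_zero, ← Matrix.star_dotProduct_star, star_star, dotProduct_comm]
      simpa [V, Matrix.mulVec, dotProduct, mul_comm] using e2
    | zero => simp
    | add y z _ _ hy hz => rw [dotProduct_add, hy, hz, add_zero]
    | smul a y _ hy => rw [dotProduct_smul, hy, smul_zero]
  have hcol : ∀ k, s k ≠ 0 → ∑ x, star (Φ x k) * w x = (Φᴴ *ᵥ w') k := by
    intro k hk
    have hmem : (fun x => Φ x k) ∈ Submodule.span ℂ (Set.range v) := by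
      refine hρ ⟨(s k : ℂ)⁻¹ • Φ *ᵥ Pi.single k 1, ?_⟩
      have hk' : (s k : ℂ) ≠ 0 := by exact_mod_cast hk
      rw [Matrix.mulVecLin_apply, Matrix.mulVec_smul, Matrix.mulVec_mulVec, h, Matrix.mul_assoc,
        hΦ, Matrix.mul_one]
      ext x
      simp [Matrix.mul_diagonal]
      field_simp
    have h0 := hperp _ hmem
    have h1 : (Φᴴ *ᵥ (w - w')) k = 0 := by
      rw [← star_eq_zero, ← h0]
      simp [Matrix.mulVec, dotProduct, mul_comm]
    rw [Matrix.mulVec_sub, Pi.sub_apply, sub_eq_zero] at h1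
    rw [← h1]
    rfl
  have hΦ' : Φᴴᴴ * Φᴴ = 1 := by
    rw [Matrix.conjTranspose_conjTranspose, mul_eq_one_comm, hΦ]
  calc _ ≤ ∑ k, ‖(Φᴴ *ᵥ w') k‖ ^ 2 := Finset.sum_le_sum fun k _ => by
        split_ifs with hk
        · positivity
        · rw [hcol k hk]
    _ = ∑ i, ‖(Vᴴ *ᵥ w) i‖ ^ 2 := by
        rw [sum_norm_sq_mulVec_of_isometry hΦ', hw', sum_norm_sq_mulVec_of_isometry hV]
    _ = _ := rfl

variable [DecidableEq A] [DecidableEq C]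

theorem SuppIn.vN_sub_log_le_vN_ptrace (e : A × C ≃ X) {ρ : Matrix X X ℂ} (hρ : IsDensity ρ)
    {v : I → X → ℂ} (hsupp : SuppIn ρ v) (hv : ONFam v) {κ : ℝ} (hκ : 0 < κ)
    (h : ∀ x : A → ℂ, ∑ c, ∑ i, ‖∑ a, star (v i (e (a, c))) * x a‖ ^ 2 ≤ κ * ∑ a, ‖x a‖ ^ 2) :
    vN ρ - Real.log κ ≤ vN (ptrace e ρ) := by
  refine _root_.vN_sub_log_le_vN_ptrace e hρ hκ fun Φ s hΦ hρΦ x => le_trans ?_ (h x)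
  have hw : ∀ (c : C) (f : X → ℂ),
      ∑ y, star (f y) * (if (e.symm y).2 = c then x (e.symm y).1 else 0)
        = ∑ a, star (f (e (a, c))) * x a := by
    intro c f
    rw [← Fintype.sum_equiv e (fun r => star (f (e r)) * (if r.2 = c then x r.1 else 0)) _
      (fun r => by simp), Fintype.sum_prod_type]
    simp
  have hk : ∀ k, (if s k = 0 then 0 else ∑ c, ‖∑ a, star (Φ (e (a, c)) k) * x a‖ ^ 2)
      = ∑ c, (if s k = 0 then 0 else ‖∑ a, star (Φ (e (a, c)) k) * x a‖ ^ 2) := by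
    intro k
    split_ifs <;> simp
  rw [Finset.sum_congr rfl fun k _ => hk k, Finset.sum_comm]
  refine Finset.sum_le_sum fun c _ => ?_
  have := hsupp.sum_norm_sq_eigenvector_le hv hΦ hρΦ
    fun y => if (e.symm y).2 = c then x (e.symm y).1 else 0
  simpa only [hw c (fun y => v _ y), hw c (fun y => Φ y _)] using this

end Support

section Tripartite
variable {α β γ : Type*}

/-- Regrouping of three parties that splits off the second one. -/
def splitMiddle (α β γ : Type*) : (α × γ) × β ≃ α × β × γ where
  toFun x := (x.1.1, x.2, x.1.2)
  invFun x := ((x.1, x.2.2), x.2.1)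
  left_inv _ := rfl
  right_inv _ := rfl

theorem red12_eq_ptrace [Fintype γ]
    (ρ : Matrix (α × β × γ) (α × β × γ) ℂ) :
    red12 ρ = ptrace (Equiv.prodAssoc α β γ) ρ := rfl

theorem red13_eq_ptrace [Fintype β]
    (ρ : Matrix (α × β × γ) (α × β × γ) ℂ) :
    red13 ρ = ptrace (splitMiddle α β γ) ρ := rfl

theorem red23_eq_ptrace [Fintype α]
    (ρ : Matrix (α × β × γ) (α × β × γ) ℂ) :
    red23 ρ = ptrace (Equiv.prodComm (β × γ) α) ρ := rfl

theorem red1_eq_ptrace [Fintype β] [Fintype γ]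
    (ρ : Matrix (α × β × γ) (α × β × γ) ℂ) :
    red1 ρ = ptrace ((Equiv.prodComm α (β × γ)).trans (Equiv.prodComm (β × γ) α)) ρ := by
  ext a a'
  simp [red1, ptrace, Fintype.sum_prod_type]

theorem red2_eq_ptrace [Fintype α] [Fintype γ]
    (ρ : Matrix (α × β × γ) (α × β × γ) ℂ) :
    red2 ρ = ptrace ((Equiv.prodComm β (α × γ)).trans (splitMiddle α β γ)) ρ := by
  ext b b'
  simp [red2, ptrace, splitMiddle, Fintype.sum_prod_type]

theorem red3_eq_ptrace [Fintype α] [Fintype β]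
    (ρ : Matrix (α × β × γ) (α × β × γ) ℂ) :
    red3 ρ = ptrace ((Equiv.prodComm γ (α × β)).trans (Equiv.prodAssoc α β γ)) ρ := by
  ext c c'
  simp [red3, ptrace, Fintype.sum_prod_type]

theorem neg_two_mul_vN_le_I3 [Fintype α] [Fintype β] [Fintype γ]
    [DecidableEq α] [DecidableEq β] [DecidableEq γ]
    {ρ : Matrix (α × β × γ) (α × β × γ) ℂ} (hρ : IsDensity ρ) :
    -2 * vN ρ ≤ I3 ρ := by
  have h1 := vN_ptrace_le_add (Equiv.prodComm (β × γ) α) hρ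
  have h2 := vN_ptrace_le_add (splitMiddle α β γ) hρ
  have h3 := vN_ptrace_le_add (Equiv.prodAssoc α β γ) hρ
  rw [← red23_eq_ptrace, ← red1_eq_ptrace] at h1
  rw [← red13_eq_ptrace, ← red2_eq_ptrace] at h2
  rw [← red12_eq_ptrace, ← red3_eq_ptrace] at h3
  rw [I3]
  linarith

end Tripartite

section Code
variable {d : ℕ}

/-- The vectors `|ĩ⟩` spanning the code space of a unitary. -/
def codeVec (U : Matrix (Fin d × Fin d) (Fin d × Fin d) ℂ) (i : Fin d)
    (x : Fin d × Fin d × Fin d) : ℂ :=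
  (Real.sqrt d : ℂ)⁻¹ * U (x.2.1, x.2.2) (i, x.1)

theorem norm_sq_inv_sqrt_mul (d : ℕ) (z : ℂ) :
    ‖((Real.sqrt d : ℝ) : ℂ)⁻¹ * z‖ ^ 2 = (d : ℝ)⁻¹ * ‖z‖ ^ 2 := by
  rw [norm_mul, mul_pow, norm_inv, Complex.norm_real, Real.norm_eq_abs, inv_pow, sq_abs,
    Real.sq_sqrt (Nat.cast_nonneg d)]

theorem onFam_codeVec (hd : 1 ≤ d) {U : Matrix (Fin d × Fin d) (Fin d × Fin d) ℂ}
    (hU : Uᴴ * U = 1) : ONFam (codeVec U) := by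
  intro i j
  have hd0 : (d : ℂ) ≠ 0 := by exact_mod_cast (by omega : d ≠ 0)
  have hsq : (star ((Real.sqrt d : ℝ) : ℂ)⁻¹) * ((Real.sqrt d : ℝ) : ℂ)⁻¹ = (d : ℂ)⁻¹ := by
    rw [star_inv₀, ← mul_inv, RCLike.star_def, Complex.conj_ofReal, ← Complex.ofReal_mul,
      Real.mul_self_sqrt (Nat.cast_nonneg d), Complex.ofReal_natCast]
  have h : ∀ s₁, ∑ y : Fin d × Fin d, star (codeVec U i (s₁, y)) * codeVec U j (s₁, y)
      = (d : ℂ)⁻¹ * if i = j then 1 else 0 := by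
    intro s₁
    have := congrFun (congrFun hU (i, s₁)) (j, s₁)
    rw [Matrix.mul_apply, Matrix.one_apply] at this
    simp only [Prod.mk.injEq, and_true] at this
    rw [← this, Finset.mul_sum, ← hsq]
    refine Finset.sum_congr rfl fun y _ => ?_
    simp only [codeVec, star_mul', Matrix.conjTranspose_apply, Prod.mk.eta]
    ring
  rw [Fintype.sum_prod_type, Finset.sum_congr rfl fun s₁ _ => h s₁, Finset.sum_const,
    Finset.card_univ, Fintype.card_fin, nsmul_eq_mul, ← mul_assoc, mul_inv_cancel₀ hd0, one_mul]

/-- The rearrangement of the entries of `U` for the cut `12|3`. -/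
def cut12 (δ : Type*) : (δ × δ) × (δ × δ) ≃ (δ × δ) × (δ × δ) where
  toFun x := ((x.2.2, x.1.1), (x.1.2, x.2.1))
  invFun y := ((y.1.2, y.2.1), (y.2.2, y.1.1))
  left_inv _ := rfl
  right_inv _ := rfl

/-- The rearrangement of the entries of `U` for the cut `13|2`. -/
def cut13 (δ : Type*) : (δ × δ) × (δ × δ) ≃ (δ × δ) × (δ × δ) where
  toFun x := ((x.1.1, x.2.2), (x.1.2, x.2.1))
  invFun y := ((y.1.1, y.2.1), (y.2.2, y.1.2))
  left_inv _ := rfl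
  right_inv _ := rfl

theorem I3_le_of_suppIn_codeVec (hd : 1 ≤ d) {U : Matrix (Fin d × Fin d) (Fin d × Fin d) ℂ}
    (hU : Uᴴ * U = 1) {K : ℝ} (hK : 0 < K)
    (h12 : ∀ x, ∑ p, ‖(permuteEntries (cut12 (Fin d)) U *ᵥ x) p‖ ^ 2 ≤ K * ∑ q, ‖x q‖ ^ 2)
    (h13 : ∀ x, ∑ p, ‖(permuteEntries (cut13 (Fin d)) U *ᵥ x) p‖ ^ 2 ≤ K * ∑ q, ‖x q‖ ^ 2)
    {ρ : Matrix (Fin d × Fin d × Fin d) (Fin d × Fin d × Fin d) ℂ} (hρ : IsDensity ρ)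
    (hsupp : SuppIn ρ (codeVec U)) :
    I3 ρ ≤ -2 * vN ρ + 2 * Real.log K := by
  have hd0 : (0 : ℝ) < d := by exact_mod_cast hd
  have hv := onFam_codeVec hd hU
  have hin : ∀ {J : Type} [Fintype J] (f : J → Fin d × Fin d × Fin d) (i : Fin d) (x : J → ℂ),
      ‖∑ a, star (codeVec U i (f a)) * x a‖ ^ 2
        = (d : ℝ)⁻¹ * ‖∑ a, U ((f a).2.1, (f a).2.2) (i, (f a).1) * star (x a)‖ ^ 2 := by
    intro J _ f i x
    rw [← norm_sq_inv_sqrt_mul, ← norm_star, star_sum, Finset.mul_sum]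
    congr 2
    refine Finset.sum_congr rfl fun a _ => ?_
    simp only [codeVec, star_mul', star_star]
    ring
  have h23' : vN ρ - Real.log (d : ℝ)⁻¹ ≤ vN (red23 ρ) := by
    refine hsupp.vN_sub_log_le_vN_ptrace (Equiv.prodComm (Fin d × Fin d) (Fin d)) hρ hv
      (inv_pos.mpr hd0) fun x => ?_
    have hUU : (Uᵀ)ᴴ * Uᵀ = 1 := by
      have : (Uᵀ)ᴴ = Uᴴᵀ := by ext; simp
      rw [this, ← Matrix.transpose_mul, mul_eq_one_comm.mp hU, Matrix.transpose_one]
    have h := sum_norm_sq_mulVec_of_isometry hUU (star x)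
    simp only [hin, ← Finset.mul_sum]
    rw [Finset.sum_comm, ← Fintype.sum_prod_type']
    refine mul_le_mul_of_nonneg_left (le_of_eq ?_) (inv_pos.mpr hd0).le
    simpa [Matrix.mulVec, dotProduct] using h
  have h12' : vN ρ - Real.log ((d : ℝ)⁻¹ * K) ≤ vN (red12 ρ) := by
    refine hsupp.vN_sub_log_le_vN_ptrace (Equiv.prodAssoc (Fin d) (Fin d) (Fin d)) hρ hv
      (mul_pos (inv_pos.mpr hd0) hK) fun x => ?_
    have h := h12 (star x)
    simp only [hin, ← Finset.mul_sum]
    rw [← Fintype.sum_prod_type', mul_assoc]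
    refine mul_le_mul_of_nonneg_left ?_ (inv_pos.mpr hd0).le
    simpa [Matrix.mulVec, dotProduct, permuteEntries, cut12] using h
  have h13' : vN ρ - Real.log ((d : ℝ)⁻¹ * K) ≤ vN (red13 ρ) := by
    refine hsupp.vN_sub_log_le_vN_ptrace (splitMiddle (Fin d) (Fin d) (Fin d)) hρ hv
      (mul_pos (inv_pos.mpr hd0) hK) fun x => ?_
    have h := h13 (star x)
    simp only [hin, ← Finset.mul_sum]
    rw [← Fintype.sum_prod_type', mul_assoc]
    refine mul_le_mul_of_nonneg_left ?_ (inv_pos.mpr hd0).le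
    simpa [Matrix.mulVec, dotProduct, permuteEntries, cut13, splitMiddle] using h
  have h1 : vN (red1 ρ) ≤ Real.log d := by
    rw [red1_eq_ptrace]
    refine (isDensity_ptrace hρ _).vN_le_log_card.trans_eq ?_
    rw [Fintype.card_fin]
  have h2 : vN (red2 ρ) ≤ Real.log d := by
    rw [red2_eq_ptrace]
    refine (isDensity_ptrace hρ _).vN_le_log_card.trans_eq ?_
    rw [Fintype.card_fin]
  have h3 : vN (red3 ρ) ≤ Real.log d := by
    rw [red3_eq_ptrace]
    refine (isDensity_ptrace hρ _).vN_le_log_card.trans_eq ?_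
    rw [Fintype.card_fin]
  rw [Real.log_mul (inv_pos.mpr hd0).ne' hK.ne', Real.log_inv] at h12' h13'
  rw [Real.log_inv] at h23'
  rw [I3]
  linarith

end Code

theorem two_mul_log_le {μ : ℝ} (hμ : 1 ≤ μ) : 2 * Real.log (640 * μ)
    ≤ 6 * Real.log (48 * Real.exp 1 * Real.sqrt 2) + 3 * Real.log μ := by
  have h1 : Real.log 640 ≤ 3 * Real.log (48 * Real.exp 1 * Real.sqrt 2) := by
    have e : (48 : ℝ) ≤ 48 * Real.exp 1 * Real.sqrt 2 := by
      have := Real.one_le_sqrt.mpr (by norm_num : (1 : ℝ) ≤ 2)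
      nlinarith [Real.exp_one_gt_d9]
    calc Real.log 640 ≤ Real.log (48 ^ 3) := Real.log_le_log (by norm_num) (by norm_num)
      _ = 3 * Real.log 48 := by rw [Real.log_pow]; norm_num
      _ ≤ _ := by
        have := Real.log_le_log (by norm_num) e
        linarith
  rw [Real.log_mul (by norm_num) (by positivity)]
  linarith [Real.log_nonneg hμ]

/-- for a Haar-random unitary `u ∈ U(d²)` and the code space spanned by
`|ĩ⟩ = d^{-1/2} ∑ u((s2,s3),(i,s1)) |s1 s2 s3⟩`, with probability at least `1 − e^{−μ}` the
bound `−2 S(ρ̃) ≤ I₃(ρ̃) ≤ −2 S(ρ̃) + 6 log(48 e √2) + 3 log μ` holds simultaneously for every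
density matrix `ρ̃` supported in the code space. The Haar probability measure on `U(d²)` is
axiomatized as a left-invariant Borel probability measure `ν`. -/
theorem stmt13 (d : ℕ) (hd : 1 ≤ d) (μ : ℝ) (hμ : 1 ≤ μ)
    [MeasurableSpace (Matrix.unitaryGroup (Fin d × Fin d) ℂ)]
    [BorelSpace (Matrix.unitaryGroup (Fin d × Fin d) ℂ)]
    (ν : Measure (Matrix.unitaryGroup (Fin d × Fin d) ℂ))
    [IsProbabilityMeasure ν] [ν.IsMulLeftInvariant] :
    ENNReal.ofReal (1 - Real.exp (-μ)) ≤
      ν {U : Matrix.unitaryGroup (Fin d × Fin d) ℂ |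
          ∀ ρ : Matrix (Fin d × Fin d × Fin d) (Fin d × Fin d × Fin d) ℂ,
            IsDensity ρ →
            SuppIn ρ (fun (i : Fin d) (x : Fin d × Fin d × Fin d) =>
              (Real.sqrt d : ℂ)⁻¹ *
                (U : Matrix (Fin d × Fin d) (Fin d × Fin d) ℂ) (x.2.1, x.2.2) (i, x.1)) →
            -2 * vN ρ ≤ I3 ρ ∧
            I3 ρ ≤ -2 * vN ρ + 6 * Real.log (48 * Real.exp 1 * Real.sqrt 2)
                     + 3 * Real.log μ} := by
  have : Nonempty (Fin d × Fin d) := ⟨(⟨0, hd⟩, ⟨0, hd⟩)⟩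
  let bad (g : (Fin d × Fin d) × (Fin d × Fin d) ≃ (Fin d × Fin d) × (Fin d × Fin d)) :
      Set (Matrix.unitaryGroup (Fin d × Fin d) ℂ) :=
    {U | ∃ x : Fin d × Fin d → ℂ, 640 * μ * ∑ q, ‖x q‖ ^ 2
      < ∑ p, ‖(permuteEntries g (U : Matrix (Fin d × Fin d) (Fin d × Fin d) ℂ) *ᵥ x) p‖ ^ 2}
  set good : Set (Matrix.unitaryGroup (Fin d × Fin d) ℂ) := {U | _}
  have hsub : Set.univ ⊆ good ∪ (bad (cut12 (Fin d)) ∪ bad (cut13 (Fin d))) := by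
    intro U _
    by_cases hU : U ∈ bad (cut12 (Fin d)) ∪ bad (cut13 (Fin d))
    · exact Or.inr hU
    refine Or.inl fun ρ hρ hsupp => ⟨neg_two_mul_vN_le_I3 hρ, ?_⟩
    simp only [bad, Set.mem_union, Set.mem_ofPred_eq, not_or, not_exists, not_lt] at hU
    have := I3_le_of_suppIn_codeVec hd (Matrix.mem_unitaryGroup_iff'.mp U.2)
      (by positivity : 0 < 640 * μ) hU.1 hU.2 hρ hsupp
    linarith [two_mul_log_le hμ]
  have h1 := measureReal_mono (μ := ν) hsub (measure_ne_top _ _)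
  rw [probReal_univ] at h1
  have h2 := measureReal_union_le (μ := ν) good (bad (cut12 (Fin d)) ∪ bad (cut13 (Fin d)))
  have h3 := measureReal_union_le (μ := ν) (bad (cut12 (Fin d))) (bad (cut13 (Fin d)))
  have h4 := measureReal_permuteEntries_le ν (cut12 (Fin d)) hμ
  have h5 := measureReal_permuteEntries_le ν (cut13 (Fin d)) hμ
  rw [← ofReal_measureReal]
  refine ENNReal.ofReal_le_ofReal ?_
  linarith
end
end
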